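/- arXiv:1502.02416 — 6 statements merged into one kernel-verified Lean document; each statement's English description precedes it below -/
import Mathlib

section
/- Let k be an algebraically closed field of characteristic zero, S = k[x,y,z], and let f, g ∈ S be homogeneous of the same degree n ≥ 1 with ∇f ∧ ∇g ≠ 0. Assume that the set of points of the projective plane P²(k) at which all three components of ∇f ∧ ∇g vanish is finite. Then every w ∈ S³ satisfying ⟨w, ∇f ∧ ∇g⟩ = 0 can be written uniquely as w = a·∇f + b·∇g with a, b ∈ S; that is, the syzygy module of the three components of ∇f ∧ ∇g is the free module generated by ∇f and ∇g (i.e. F^∨ ≅ O(1−n)² in the paper's notation). -/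
open MvPolynomial

/-- The gradient `∇F = (∂F/∂x, ∂F/∂y, ∂F/∂z)` of a polynomial in `k[x,y,z]`. -/
noncomputable def grad {k : Type*} [CommRing k] (F : MvPolynomial (Fin 3) k) :
    Fin 3 → MvPolynomial (Fin 3) k :=
  fun i => pderiv i F

/-- The cross product `u ∧ v` of two triples of polynomials. -/
noncomputable def cross {k : Type*} [CommRing k] (u v : Fin 3 → MvPolynomial (Fin 3) k) :
    Fin 3 → MvPolynomial (Fin 3) k :=
  ![u 1 * v 2 - u 2 * v 1, u 2 * v 0 - u 0 * v 2, u 0 * v 1 - u 1 * v 0]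

/-- The dot product `⟨u, v⟩` of two triples of polynomials. -/
noncomputable def dot {k : Type*} [CommRing k] (u v : Fin 3 → MvPolynomial (Fin 3) k) :
    MvPolynomial (Fin 3) k :=
  u 0 * v 0 + u 1 * v 1 + u 2 * v 2

lemma eval_smul_homog {k : Type*} [Field k] {m : ℕ} {p : MvPolynomial (Fin 3) k}
    (hp : p.IsHomogeneous m) (u : k) (x : Fin 3 → k) :
    eval (fun j => u * x j) p = u ^ m * eval x p := by
  rw [eval_eq, eval_eq, Finset.mul_sum]
  apply Finset.sum_congr rfl
  intro d hd
  have h := hp (mem_support_iff.mp hd)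
  have h' : ∑ i ∈ d.support, d i = m := by
    rw [← h, Finsupp.weight_apply]; simp [Finsupp.sum]
  simp only [mul_pow, Finset.prod_mul_distrib, Finset.prod_pow_eq_pow_sum, h']
  ring

lemma const_of_zeros {k : Type*} [Field k] [IsAlgClosed k] [CharZero k]
    (d : MvPolynomial (Fin 3) k) (hd : d ≠ 0) (T : Finset (Fin 3 → k))
    (hT : ∀ x, eval x d = 0 → ∃ p ∈ T, ∃ s : k, x = s • p) : IsUnit d := by
  classical
  obtain ⟨a, ha⟩ : ∃ a, eval a d ≠ 0 := by
    by_contra! h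
    exact hd (MvPolynomial.funext (fun x => by simpa using h x))
  have hl : ∀ p : Fin 3 → k, ∃ v : Fin 3 → k, v ≠ 0 ∧
      v 0 * a 0 + v 1 * a 1 + v 2 * a 2 = 0 ∧ v 0 * p 0 + v 1 * p 1 + v 2 * p 2 = 0 := by
    intro p
    have hdet : (Matrix.of ![a, p, 0] : Matrix (Fin 3) (Fin 3) k).det = 0 := by
      simp [Matrix.det_fin_three]
    obtain ⟨v, hv, h⟩ := Matrix.exists_mulVec_eq_zero_iff.mpr hdet
    have h0 := congrFun h 0
    have h1 := congrFun h 1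
    simp [Matrix.mulVec, dotProduct, Fin.sum_univ_three] at h0 h1
    exact ⟨v, hv, by linear_combination h0, by linear_combination h1⟩
  choose v hv hva hvp using hl
  let l : (Fin 3 → k) → MvPolynomial (Fin 3) k := fun p =>
    C (v p 0) * X 0 + C (v p 1) * X 1 + C (v p 2) * X 2
  have hl0 : ∀ p, l p ≠ 0 := by
    intro p h
    apply hv p
    funext i
    have := congrArg (eval (Pi.single i 1)) h
    fin_cases i <;> simpa [l] using this
  have hP : (∏ p ∈ T, l p) ≠ 0 := Finset.prod_ne_zero_iff.mpr (fun p _ => hl0 p)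
  have key : (d - C (eval a d)) * ∏ p ∈ T, l p = 0 := by
    apply MvPolynomial.funext
    intro b
    rw [map_mul, map_prod, map_zero]
    by_cases hb : ∃ p ∈ T, eval b (l p) = 0
    · obtain ⟨p, hp, h⟩ := hb
      rw [Finset.prod_eq_zero hp h, mul_zero]
    push Not at hb
    let q : Polynomial k := aeval (fun i => Polynomial.C (a i) + Polynomial.X * Polynomial.C (b i - a i)) d
    have hq : ∀ t, q.eval t = eval (fun i => a i + t * (b i - a i)) d := by
      intro t
      change Polynomial.evalRingHom t (aeval _ d) = _
      rw [MvPolynomial.map_aeval]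
      have e : (Polynomial.evalRingHom t).comp (algebraMap k (Polynomial k)) = RingHom.id k := by
        ext x; simp
      rw [e]
      simp only [Polynomial.coe_evalRingHom, Polynomial.eval_add, Polynomial.eval_mul,
        Polynomial.eval_C, Polynomial.eval_X]
      rfl
    have hdeg : q.degree = 0 := by
      by_contra hdeg
      obtain ⟨t, ht⟩ := IsAlgClosed.exists_root q hdeg
      rw [Polynomial.IsRoot.def, hq] at ht
      obtain ⟨p, hp, s, hs⟩ := hT _ ht
      apply hb p hp
      have ht0 : t ≠ 0 := by
        rintro rfl
        rw [← hq, hq] at ht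
        simp at ht
        exact ha ht
      have e0 := congrFun hs 0
      have e1 := congrFun hs 1
      have e2 := congrFun hs 2
      simp only [Pi.smul_apply, smul_eq_mul] at e0 e1 e2
      simp only [l, map_add, map_mul, eval_C, eval_X]
      apply mul_left_cancel₀ ht0
      linear_combination v p 0 * e0 + v p 1 * e1 + v p 2 * e2 + s * hvp p - (1 - t) * hva p
    have hc := Polynomial.eq_C_of_degree_eq_zero hdeg
    have h0 := hq 0
    have h1 := hq 1
    rw [hc, Polynomial.eval_C] at h0 h1
    have : eval b d = eval a d := by
      rw [h0] at h1; simpa using h1.symm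
    simp [this]
  have hdc : d = C (eval a d) := by
    rcases mul_eq_zero.mp key with h | h
    · exact sub_eq_zero.mp h
    · exact absurd h hP
  rw [hdc]
  exact (isUnit_iff_ne_zero.mpr ha).map C

lemma cross_homog {k : Type*} [Field k] (n : ℕ) (f g : MvPolynomial (Fin 3) k)
    (hf : f.IsHomogeneous n) (hg : g.IsHomogeneous n) (i : Fin 3) :
    (cross (grad f) (grad g) i).IsHomogeneous ((n - 1) + (n - 1)) := by
  have h : ∀ i j, (grad f i * grad g j).IsHomogeneous ((n-1)+(n-1)) :=
    fun i j => (hf.pderiv).mul (hg.pderiv)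
  fin_cases i <;> exact (h _ _).sub (h _ _)

lemma unit_of_dvd {k : Type*} [Field k] [IsAlgClosed k] [CharZero k]
    (n : ℕ) (f g : MvPolynomial (Fin 3) k)
    (hf : f.IsHomogeneous n) (hg : g.IsHomogeneous n)
    (hne : cross (grad f) (grad g) ≠ 0)
    (hfin : {p : Projectivization k (Fin 3 → k) |
        ∀ i, eval p.rep (cross (grad f) (grad g) i) = 0}.Finite)
    (d : MvPolynomial (Fin 3) k) (hd : ∀ i, d ∣ cross (grad f) (grad g) i) : IsUnit d := by
  classical
  have hd0 : d ≠ 0 := by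
    rintro rfl
    exact hne (funext fun i => zero_dvd_iff.mp (hd i))
  apply const_of_zeros d hd0 (insert 0 (hfin.toFinset.image Projectivization.rep))
  intro x hx
  by_cases hx0 : x = 0
  · exact ⟨0, by simp, 0, by simp [hx0]⟩
  obtain ⟨u, hu⟩ := Projectivization.exists_smul_eq_mk_rep k x hx0
  refine ⟨(Projectivization.mk k x hx0).rep, ?_, (u⁻¹ : kˣ), ?_⟩
  · apply Finset.mem_insert_of_mem
    apply Finset.mem_image_of_mem
    rw [Set.Finite.mem_toFinset]
    intro i
    obtain ⟨e, he⟩ := hd i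
    have h0 : eval x (cross (grad f) (grad g) i) = 0 := by rw [he, map_mul, hx, zero_mul]
    rw [← hu]
    have h2 : eval (fun j => (u:k) * x j) (cross (grad f) (grad g) i) =
        (u:k) ^ ((n-1)+(n-1)) * eval x (cross (grad f) (grad g) i) :=
      eval_smul_homog (cross_homog n f g hf hg i) u x
    rw [h0, mul_zero] at h2
    exact h2
  · rw [← hu]
    change x = (u⁻¹ : kˣ) • (u • x)
    rw [inv_smul_smul]

lemma dvd_aux {R : Type*} [CommRing R] [IsDomain R] [UniqueFactorizationMonoid R]
    (c A : Fin 3 → R) (hu : ∀ d, (∀ i, d ∣ c i) → IsUnit d) (hc : c ≠ 0)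
    (h : ∀ i j, A i * c j = A j * c i) : ∃ a, ∀ i, A i = a * c i := by
  classical
  let _ : GCDMonoid R := UniqueFactorizationMonoid.toGCDMonoid R
  obtain ⟨j, hj⟩ := Function.ne_iff.mp hc
  simp only [Pi.zero_apply] at hj
  have hg : IsUnit (gcd (c 0) (gcd (c 1) (c 2))) := by
    apply hu
    intro i
    fin_cases i
    · exact gcd_dvd_left _ _
    · exact (gcd_dvd_right _ _).trans (gcd_dvd_left _ _)
    · exact (gcd_dvd_right _ _).trans (gcd_dvd_right _ _)
  have hi : ∀ i, c j ∣ A j * c i := fun i => ⟨A i, by rw [← h i j]; ring⟩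
  have h1 : c j ∣ A j * gcd (c 1) (c 2) :=
    (dvd_gcd (hi 1) (hi 2)).trans (gcd_mul_left' _ _ _).dvd
  have h2 : c j ∣ A j * gcd (c 0) (gcd (c 1) (c 2)) :=
    (dvd_gcd (hi 0) h1).trans (gcd_mul_left' _ _ _).dvd
  obtain ⟨a, ha⟩ := (hg.dvd_mul_right).mp h2
  refine ⟨a, fun i => mul_right_cancel₀ hj ?_⟩
  rw [h i j, ha]; ring

/-- if `f, g` are homogeneous of degree `n ≥ 1`, `∇f ∧ ∇g ≠ 0`, and the
set of points of `P²(k)` where all three components of `∇f ∧ ∇g` vanish is finite,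
then every `w ∈ S³` with `⟨w, ∇f ∧ ∇g⟩ = 0` is uniquely of the form `a·∇f + b·∇g`;
i.e. the syzygy module of `∇f ∧ ∇g` is freely generated by `∇f` and `∇g`
(`F^∨ ≅ O(1−n)²`). -/
theorem syzygies_of_cross_grad {k : Type*} [Field k] [IsAlgClosed k] [CharZero k]
    (n : ℕ) (hn : 1 ≤ n) (f g : MvPolynomial (Fin 3) k)
    (hf : f.IsHomogeneous n) (hg : g.IsHomogeneous n)
    (hne : cross (grad f) (grad g) ≠ 0)
    (hfin : {p : Projectivization k (Fin 3 → k) |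
        ∀ i, eval p.rep (cross (grad f) (grad g) i) = 0}.Finite) :
    ∀ w : Fin 3 → MvPolynomial (Fin 3) k,
      dot w (cross (grad f) (grad g)) = 0 →
        ∃! ab : MvPolynomial (Fin 3) k × MvPolynomial (Fin 3) k,
          w = fun i => ab.1 * grad f i + ab.2 * grad g i := by
  intro w hw
  set u := grad f
  set v := grad g
  have hu := unit_of_dvd n f g hf hg hne hfin
  change ∀ d, (∀ i, d ∣ cross u v i) → IsUnit d at hu
  obtain ⟨j, hj⟩ := Function.ne_iff.mp hne
  simp only [Pi.zero_apply] at hj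
  have hw' := hw
  simp only [dot, cross, Matrix.cons_val_zero, Matrix.cons_val_one, Matrix.cons_val] at hw'
  obtain ⟨a, ha⟩ := dvd_aux (cross u v) (cross w v) hu hne (by
    intro i j
    fin_cases i <;> fin_cases j <;> simp [cross] <;>
    first
    | ring1
    | linear_combination v 0 * hw'
    | linear_combination (-v 0) * hw'
    | linear_combination v 1 * hw'
    | linear_combination (-v 1) * hw'
    | linear_combination v 2 * hw'
    | linear_combination (-v 2) * hw')
  obtain ⟨b, hb⟩ := dvd_aux (cross u v) (cross u w) hu hne (by
    intro i j
    fin_cases i <;> fin_cases j <;> simp [cross] <;>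
    first
    | ring1
    | linear_combination u 0 * hw'
    | linear_combination (-u 0) * hw'
    | linear_combination u 1 * hw'
    | linear_combination (-u 1) * hw'
    | linear_combination u 2 * hw'
    | linear_combination (-u 2) * hw')
  have cram : ∀ i, cross u v j * w i = cross w v j * u i + cross u w j * v i := by
    intro i
    clear_value u v
    clear ha hb hu hj
    fin_cases i <;> fin_cases j <;> simp [cross] <;>
    first
    | ring1
    | linear_combination hw'
  refine ⟨(a, b), ?_, ?_⟩
  · funext i
    apply mul_left_cancel₀ hj
    rw [cram, ha, hb]; ring
  · rintro ⟨a', b'⟩ h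
    simp only at h
    have e : ∀ i, w i = a' * u i + b' * v i := fun i => congrFun h i
    have h1 : cross w v j = a' * cross u v j := by
      clear_value u v
      clear ha hb hu hj cram
      fin_cases j <;> simp [cross, e] <;> ring
    have h2 : cross u w j = b' * cross u v j := by
      clear_value u v
      clear ha hb hu hj cram h1
      fin_cases j <;> simp [cross, e] <;> ring
    rw [ha] at h1
    rw [hb] at h2
    rw [mul_right_cancel₀ hj h1, mul_right_cancel₀ hj h2]
end

section
/- Let k be an algebraically closed field of characteristic zero, S = k[x,y,z], and let f, g ∈ S be homogeneous of the same degree n ≥ 1. Assume that the set of points of P²(k) at which all three components of ∇f ∧ ∇g vanish is finite, and let I ⊆ S be the homogeneous ideal generated by the three components of ∇f ∧ ∇g. Then for all sufficiently large d, the dimension of the degree-d graded piece of S/I equals 3(n−1)²; that is, the singular scheme sg(F) of the pencil has length 3(n−1)². -/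
open MvPolynomial

section Helpers

variable {k : Type*} [Field k]

theorem hc_mul_of_right {w p : MvPolynomial (Fin 3) k} {j : ℕ} (hw : w.IsHomogeneous j) (m : ℕ) :
    homogeneousComponent (m + j) (p * w) = homogeneousComponent m p * w := by
  letI := MvPolynomial.gradedAlgebra (σ := Fin 3) (R := k)
  have h := DirectSum.coe_decompose_mul_add_of_right_mem (homogeneousSubmodule (Fin 3) k)
    (i := m) (a := p) (b := w) hw
  rw [← decomposition.decompose'_apply, ← decomposition.decompose'_apply]
  exact h

theorem hc_mul_top (p q : MvPolynomial (Fin 3) k) :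
    homogeneousComponent (p.totalDegree + q.totalDegree) (p * q) =
      homogeneousComponent p.totalDegree p * homogeneousComponent q.totalDegree q := by
  classical
  ext d
  by_cases hd : d.degree = p.totalDegree + q.totalDegree
  · rw [coeff_homogeneousComponent, if_pos hd, coeff_mul, coeff_mul]
    refine Finset.sum_congr rfl ?_
    rintro ⟨x, y⟩ hxy
    have hxy : x + y = d := by simpa using hxy
    simp only [coeff_homogeneousComponent]
    by_cases hx : coeff x p = 0
    · simp [hx]
    by_cases hy : coeff y q = 0
    · simp [hy]
    have h1 : x.degree ≤ p.totalDegree := le_totalDegree (mem_support_iff.2 hx)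
    have h2 : y.degree ≤ q.totalDegree := le_totalDegree (mem_support_iff.2 hy)
    have h3 : x.degree + y.degree = d.degree := by rw [← hxy]; simp
    rw [if_pos (by omega), if_pos (by omega)]
  · rw [coeff_homogeneousComponent, if_neg hd]
    exact (((homogeneousComponent_isHomogeneous _ _).mul
      (homogeneousComponent_isHomogeneous _ _)).coeff_eq_zero hd).symm

theorem hc_top_ne_zero {p : MvPolynomial (Fin 3) k} (hp : p ≠ 0) :
    homogeneousComponent p.totalDegree p ≠ 0 := by
  obtain ⟨d, hd, h⟩ := Finset.exists_mem_eq_sup p.support (support_nonempty.2 hp)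
    (fun s => s.sum fun _ e => e)
  intro h0
  have h1 := coeff_homogeneousComponent p.totalDegree p d
  rw [h0, if_pos (by rw [totalDegree, h]; rfl)] at h1
  exact (mem_support_iff.1 hd) (by simpa using h1.symm)

theorem hc_top_dvd {p w : MvPolynomial (Fin 3) k} {D : ℕ} (hw : w.IsHomogeneous D)
    (h : p ∣ w) : homogeneousComponent p.totalDegree p ∣ w := by
  by_cases hw0 : w = 0
  · simp [hw0]
  obtain ⟨q, rfl⟩ := h
  have h1 := hw.totalDegree hw0
  rw [totalDegree_mul_of_isDomain (left_ne_zero_of_mul hw0) (right_ne_zero_of_mul hw0)] at h1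
  have h2 := hc_mul_top p q
  rw [h1, homogeneousComponent_eq_self hw] at h2
  exact ⟨_, h2⟩

theorem homog_eval_smul {h : MvPolynomial (Fin 3) k} {e : ℕ} (hh : h.IsHomogeneous e)
    (c : k) (v : Fin 3 → k) : eval (c • v) h = c ^ e * eval v h := by
  rw [eval_eq, eval_eq, Finset.mul_sum]
  refine Finset.sum_congr rfl fun d hd => ?_
  have h1 : d.degree = e := hh.degree_eq_sum_deg_support hd |>.symm
  have h2 : ∑ i ∈ d.support, d i = e := h1
  simp only [Pi.smul_apply, smul_eq_mul, mul_pow, Finset.prod_mul_distrib]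
  rw [Finset.prod_pow_eq_pow_sum, h2]
  ring

theorem exists_root_on_line [IsAlgClosed k] {h : MvPolynomial (Fin 3) k} {e : ℕ}
    (hh : h.IsHomogeneous e) (he : e ≠ 0) {P : Fin 3 → k} (hP : eval P h ≠ 0) (v : Fin 3 → k) :
    ∃ s : k, eval (s • P + v) h = 0 := by
  let q (A B : Fin 3 → k) : Polynomial k :=
    aeval (fun i => Polynomial.C (A i) * Polynomial.X + Polynomial.C (B i)) h
  have hq : ∀ A B s, (q A B).eval s = eval (s • A + B) h := by
    intro A B s
    have : (Polynomial.evalRingHom s).comp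
        (aeval (fun i => Polynomial.C (A i) * Polynomial.X + Polynomial.C (B i)) :
          MvPolynomial (Fin 3) k →ₐ[k] Polynomial k).toRingHom = eval (s • A + B) := by
      apply MvPolynomial.ringHom_ext
      · intro r; simp
      · intro i; simp; ring
    exact congrArg (fun φ => φ h) this
  by_contra! hcon
  have hdeg : (q P v).degree = 0 := by
    by_contra h0
    obtain ⟨s, hs⟩ := IsAlgClosed.exists_root (q P v) h0
    exact hcon s (by rw [← hq]; exact hs)
  obtain ⟨c, hc⟩ : ∃ c, q P v = Polynomial.C c := ⟨_, Polynomial.eq_C_of_degree_eq_zero hdeg⟩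
  have hinf : q v P = Polynomial.C c * Polynomial.X ^ e := by
    apply Polynomial.eq_of_infinite_eval_eq
    refine Set.Infinite.mono (s := {0}ᶜ) ?_ (Set.finite_singleton (0 : k)).infinite_compl
    intro u hu
    have hu : u ≠ 0 := hu
    show _ = _
    rw [hq]
    have h1 : u • v + P = u • (u⁻¹ • P + v) := by
      rw [smul_add, smul_smul, mul_inv_cancel₀ hu, one_smul, add_comm]
    rw [h1, homog_eval_smul hh, ← hq, hc]
    simp; ring
  have h0 := hq v P 0
  rw [hinf] at h0
  simp [he] at h0
  exact hP h0.symm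

theorem infinite_zeros_aux [IsAlgClosed k] {h : MvPolynomial (Fin 3) k} {e : ℕ}
    (hh : h.IsHomogeneous e) (he : e ≠ 0) (h0 : h ≠ 0) :
    {p : Projectivization k (Fin 3 → k) | eval p.rep h = 0}.Infinite := by
  haveI : Infinite k := IsAlgClosed.instInfinite
  obtain ⟨P, hP⟩ : ∃ P, eval P h ≠ 0 := by
    by_contra! hc
    exact h0 (MvPolynomial.funext fun x => by simpa using hc x)
  have hP0 : P ≠ 0 := by
    rintro rfl
    apply hP
    have := homog_eval_smul hh 0 (0 : Fin 3 → k)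
    simpa [he] using this
  obtain ⟨i, hi⟩ : ∃ i, P i ≠ 0 := by
    by_contra! hc
    exact hP0 (funext hc)
  obtain ⟨j, l, hji, hli, hjl⟩ : ∃ j l : Fin 3, j ≠ i ∧ l ≠ i ∧ j ≠ l := by
    clear hi; revert i; decide
  let v : k → Fin 3 → k := fun t => Pi.single j 1 + Pi.single l t
  choose s hs using fun t => exists_root_on_line hh he hP (v t)
  let pt : k → Fin 3 → k := fun t => s t • P + v t
  have ei : ∀ t, pt t i = s t * P i := by
    intro t; simp [pt, v, hji.symm, hli.symm]
  have ej : ∀ t, pt t j = s t * P j + 1 := by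
    intro t; simp [pt, v, hjl]
  have el : ∀ t, pt t l = s t * P l + t := by
    intro t; simp [pt, v, hjl.symm]
  have hne : ∀ t, pt t ≠ 0 := by
    intro t ht
    have h1 := ei t
    have h2 := ej t
    rw [ht] at h1 h2
    have : s t = 0 := by
      have := h1.symm
      simpa [hi] using this
    rw [this] at h2
    simp at h2
  have hinj : Function.Injective fun t => Projectivization.mk k (pt t) (hne t) := by
    intro t t' htt
    obtain ⟨c, hc⟩ := (Projectivization.mk_eq_mk_iff' k _ _ (hne t) (hne t')).1 htt
    have h1 := congrFun hc i
    have h2 := congrFun hc j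
    have h3 := congrFun hc l
    simp only [Pi.smul_apply, smul_eq_mul] at h1 h2 h3
    rw [ei, ei] at h1
    rw [ej, ej] at h2
    rw [el, el] at h3
    have h4 : c * s t' = s t := mul_right_cancel₀ hi (by rw [← h1]; ring)
    have h5 : c = 1 := by linear_combination h2 - P j * h4
    subst h5
    linear_combination -h3 + P l * h4
  refine Set.infinite_of_injective_forall_mem hinj fun t => ?_
  obtain ⟨c, hc⟩ := Projectivization.exists_smul_eq_mk_rep k (pt t) (hne t)
  show eval (Projectivization.mk k (pt t) (hne t)).rep h = 0
  rw [← hc, Units.smul_def, homog_eval_smul hh, hs t, mul_zero]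

theorem not_common_factor [IsAlgClosed k] {w : Fin 3 → MvPolynomial (Fin 3) k} {D : ℕ}
    (hw : ∀ i, (w i).IsHomogeneous D)
    (hfin : {p : Projectivization k (Fin 3 → k) | ∀ i, eval p.rep (w i) = 0}.Finite)
    {p : MvPolynomial (Fin 3) k} (hp : p ≠ 0) (hpw : ∀ i, p ∣ w i) : IsUnit p := by
  by_contra hu
  have ht : p.totalDegree ≠ 0 := by
    intro h0
    rw [totalDegree_eq_zero_iff_eq_C] at h0
    apply hu
    rw [h0]
    refine IsUnit.map C (isUnit_iff_ne_zero.2 ?_)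
    intro h1
    rw [h1] at h0
    exact hp (by simpa using h0)
  refine infinite_zeros_aux (homogeneousComponent_isHomogeneous _ p) ht (hc_top_ne_zero hp)
    (hfin.subset ?_)
  intro x hx i
  obtain ⟨q, hq⟩ := hc_top_dvd (hw i) (hpw i)
  rw [hq, map_mul]
  rw [show eval x.rep (homogeneousComponent p.totalDegree p) = 0 from hx, zero_mul]

theorem w_ne_zero [IsAlgClosed k] {w : Fin 3 → MvPolynomial (Fin 3) k} {D : ℕ}
    (hw : ∀ i, (w i).IsHomogeneous D)
    (hfin : {p : Projectivization k (Fin 3 → k) | ∀ i, eval p.rep (w i) = 0}.Finite) :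
    ∃ i, w i ≠ 0 := by
  by_contra! hc
  have := not_common_factor hw hfin (p := X 0) (X_ne_zero 0) (fun i => by simp [hc i])
  have h2 := (MvPolynomial.isUnit_iff_totalDegree_of_isReduced.1 this).2
  simp at h2

/-- Parallel to a primitive vector implies multiple. -/
theorem exists_mul_of_parallel {R : Type*} [CommRing R] [IsDomain R] [UniqueFactorizationMonoid R]
    {w W : Fin 3 → R} (hprim : ∀ p, p ≠ 0 → (∀ i, p ∣ w i) → IsUnit p) (hw : ∃ i, w i ≠ 0)
    (h : ∀ i j, W i * w j = W j * w i) : ∃ a, ∀ i, W i = a * w i := by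
  obtain ⟨i, hi⟩ := hw
  letI : GCDMonoid R := UniqueFactorizationMonoid.toGCDMonoid R
  have hdvd : w i ∣ W i := by
    have key : w i ∣ gcd (W i * w 0) (gcd (W i * w 1) (W i * w 2)) :=
      dvd_gcd (h i 0 ▸ dvd_mul_left _ _) (dvd_gcd (h i 1 ▸ dvd_mul_left _ _)
        (h i 2 ▸ dvd_mul_left _ _))
    have k1 : gcd (W i * w 0) (gcd (W i * w 1) (W i * w 2)) ∣ W i * gcd (w 0) (gcd (w 1) (w 2)) :=
      ((gcd_mul_left' (W i) (w 1) (w 2)).gcd (Associated.refl (W i * w 0)) |> fun t =>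
        (gcd_comm' _ _).trans (t.trans ((gcd_comm' _ _).trans (gcd_mul_left' _ _ _)))).dvd
    have d0 : ∀ j, gcd (w 0) (gcd (w 1) (w 2)) ∣ w j := by
      intro j
      fin_cases j
      · exact gcd_dvd_left _ _
      · exact (gcd_dvd_right _ _).trans (gcd_dvd_left _ _)
      · exact (gcd_dvd_right _ _).trans (gcd_dvd_right _ _)
    have hu : IsUnit (gcd (w 0) (gcd (w 1) (w 2))) := by
      refine hprim _ ?_ d0
      intro h0
      have := d0 i
      rw [h0, zero_dvd_iff] at this
      exact hi this
    exact (hu.dvd_mul_right).1 (key.trans k1)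
  obtain ⟨a, ha⟩ := hdvd
  refine ⟨a, fun j => mul_right_cancel₀ hi ?_⟩
  rw [← h i j, ha]; ring

theorem hilbert_burch [IsAlgClosed k] {u v : Fin 3 → MvPolynomial (Fin 3) k}
    (hprim : ∀ p, p ≠ 0 → (∀ i, p ∣ cross u v i) → IsUnit p) (hw : ∃ i, cross u v i ≠ 0)
    (x : Fin 3 → MvPolynomial (Fin 3) k) (hx : ∑ i, x i * cross u v i = 0) :
    ∃ a b, ∀ i, x i = a * u i + b * v i := by
  have hx' : x 0 * (u 1 * v 2 - u 2 * v 1) + x 1 * (u 2 * v 0 - u 0 * v 2)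
      + x 2 * (u 0 * v 1 - u 1 * v 0) = 0 := by
    simpa [Fin.sum_univ_three, cross] using hx
  obtain ⟨a, ha⟩ := exists_mul_of_parallel (W := cross x v) hprim hw (by
    intro i j
    fin_cases i <;> fin_cases j <;> simp [cross, -mul_eq_mul_right_iff] <;> grind)
  obtain ⟨b, hb⟩ := exists_mul_of_parallel (W := cross u x) hprim hw (by
    intro i j
    fin_cases i <;> fin_cases j <;> simp [cross, -mul_eq_mul_right_iff] <;> grind)
  refine ⟨a, b, fun j => ?_⟩
  obtain ⟨i, hi⟩ := hw
  have ha0 := ha 0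
  have ha1 := ha 1
  have ha2 := ha 2
  have hb0 := hb 0
  have hb1 := hb 1
  have hb2 := hb 2
  simp [cross] at ha0 ha1 ha2 hb0 hb1 hb2
  apply mul_right_cancel₀ hi
  clear hi ha hb hprim hx
  fin_cases i <;> fin_cases j <;> simp [cross, -mul_eq_mul_right_iff] <;> grind

theorem cross_indep {u v : Fin 3 → MvPolynomial (Fin 3) k} (hw : ∃ i, cross u v i ≠ 0)
    {a b : MvPolynomial (Fin 3) k} (h : ∀ i, a * u i + b * v i = 0) : a = 0 ∧ b = 0 := by
  obtain ⟨i, hi⟩ := hw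
  have h0 := h 0
  have h1 := h 1
  have h2 := h 2
  constructor
  · apply mul_right_cancel₀ hi
    clear hi h
    fin_cases i <;> simp [cross, -mul_eq_zero] <;> grind
  · apply mul_right_cancel₀ hi
    clear hi h
    fin_cases i <;> simp [cross, -mul_eq_zero] <;> grind

theorem finrank_homog (d : ℕ) :
    Module.finrank k (homogeneousSubmodule (Fin 3) k d) = (d + 2).choose 2 := by
  classical
  rw [homogeneousSubmodule_eq_finsupp_supported]
  rw [(AddMonoidAlgebra.supportedEquivFinsupp (R := k) (S := k) _).finrank_eq]
  have hs : {x : Fin 3 →₀ ℕ | x.degree = d} = ↑(Finset.univ.finsuppAntidiag d : Finset (Fin 3 →₀ ℕ)) := by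
    ext x
    simp [Finset.mem_finsuppAntidiag, Finsupp.degree_eq_sum]
  rw [hs, Module.finrank_finsupp_self]
  simp only [Finset.coe_sort_coe, Fintype.card_coe]
  rw [Finset.card_finsuppAntidiag_nat_eq_choose]
  simp
  rw [add_comm 2 d]
  exact Nat.choose_symm_add

end Helpers

section Main

variable {k : Type*} [Field k]

theorem choose_identity (b m : ℕ) :
    (b + 3 * m + 2).choose 2 + 2 * (b + 2).choose 2 =
      3 * (b + m + 2).choose 2 + 3 * m ^ 2 := by
  have h : ∀ a : ℕ, 2 * (a + 2).choose 2 = (a + 2) * (a + 1) := by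
    intro a
    rw [Nat.choose_two_right]
    have := Nat.div_mul_cancel (Nat.even_mul_pred_self (a + 2)).two_dvd
    rw [show a + 2 - 1 = a + 1 by omega] at *
    omega
  have h1 := h (b + 3 * m)
  have h2 := h b
  have h3 := h (b + m)
  nlinarith

instance homog_finite (d : ℕ) : Module.Finite k (homogeneousSubmodule (Fin 3) k d) :=
  Module.Finite.iff_fg.2 (homogeneousSubmodule_fg _ _ d)

/-- The map `H_a³ → H_(a+2m)`, `x ↦ Σ xᵢ wᵢ`. -/
noncomputable def mapL (w : Fin 3 → MvPolynomial (Fin 3) k) (a D : ℕ)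
    (hw : ∀ i, (w i).IsHomogeneous D) :
    (Fin 3 → homogeneousSubmodule (Fin 3) k a) →ₗ[k] homogeneousSubmodule (Fin 3) k (a + D) where
  toFun x := ⟨∑ i, (x i : MvPolynomial (Fin 3) k) * w i,
    Submodule.sum_mem _ fun i _ => IsHomogeneous.mul (x i).2 (hw i)⟩
  map_add' x y := by
    apply Subtype.ext
    simp [add_mul, Finset.sum_add_distrib]
  map_smul' c x := by
    apply Subtype.ext
    simp [Finset.smul_sum]

/-- The map `H_b² → H_(b+m)³`, `(α, β) ↦ α u + β v`. -/
noncomputable def mapM (u v : Fin 3 → MvPolynomial (Fin 3) k) (b m : ℕ)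
    (hu : ∀ i, (u i).IsHomogeneous m) (hv : ∀ i, (v i).IsHomogeneous m) :
    (homogeneousSubmodule (Fin 3) k b × homogeneousSubmodule (Fin 3) k b) →ₗ[k]
      (Fin 3 → homogeneousSubmodule (Fin 3) k (b + m)) where
  toFun x := fun i => ⟨(x.1 : MvPolynomial (Fin 3) k) * u i + (x.2 : MvPolynomial (Fin 3) k) * v i,
    IsHomogeneous.add (IsHomogeneous.mul x.1.2 (hu i)) (IsHomogeneous.mul x.2.2 (hv i))⟩
  map_add' x y := by
    funext i
    apply Subtype.ext
    simp
    ring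
  map_smul' c x := by
    funext i
    apply Subtype.ext
    simp

theorem finrank_quotient_piece [IsAlgClosed k] {u v : Fin 3 → MvPolynomial (Fin 3) k} {m : ℕ}
    (hu : ∀ i, (u i).IsHomogeneous m) (hv : ∀ i, (v i).IsHomogeneous m)
    (hfin : {p : Projectivization k (Fin 3 → k) | ∀ i, eval p.rep (cross u v i) = 0}.Finite)
    (I : Ideal (MvPolynomial (Fin 3) k))
    (hI : I = Ideal.span {cross u v 0, cross u v 1, cross u v 2}) (b : ℕ) :
    Module.finrank k
      (Submodule.map (Ideal.Quotient.mkₐ k I).toLinearMap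
        (homogeneousSubmodule (Fin 3) k (b + m + (m + m)))) = 3 * m ^ 2 := by
  have hw : ∀ i, (cross u v i).IsHomogeneous (m + m) := by
    intro i
    fin_cases i
    · exact ((hu 1).mul (hv 2)).sub ((hu 2).mul (hv 1))
    · exact ((hu 2).mul (hv 0)).sub ((hu 0).mul (hv 2))
    · exact ((hu 0).mul (hv 1)).sub ((hu 1).mul (hv 0))
  have hw0 := w_ne_zero hw hfin
  have hprim : ∀ p, p ≠ 0 → (∀ i, p ∣ cross u v i) → IsUnit p :=
    fun p hp h => not_common_factor hw hfin hp h
  let L := mapL (cross u v) (b + m) (m + m) hw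
  let M := mapM u v b m hu hv
  let φ := (Ideal.Quotient.mkₐ k I).toLinearMap.domRestrict
    (homogeneousSubmodule (Fin 3) k (b + m + (m + m)))
  have hMinj : LinearMap.ker M = ⊥ := by
    rw [LinearMap.ker_eq_bot']
    rintro ⟨x, y⟩ hxy
    have h1 : ∀ i, (x : MvPolynomial (Fin 3) k) * u i + (y : MvPolynomial (Fin 3) k) * v i = 0 :=
      fun i => congrArg Subtype.val (congrFun hxy i)
    obtain ⟨ha, hb⟩ := cross_indep hw0 h1
    exact Prod.ext (Subtype.ext ha) (Subtype.ext hb)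
  have hkerL : LinearMap.ker L = LinearMap.range M := by
    ext x
    rw [LinearMap.mem_ker, LinearMap.mem_range]
    constructor
    · intro hx
      have hx' : ∑ i, (x i : MvPolynomial (Fin 3) k) * cross u v i = 0 := congrArg Subtype.val hx
      obtain ⟨α, β, h⟩ := hilbert_burch hprim hw0 (fun i => (x i : MvPolynomial (Fin 3) k)) hx'
      refine ⟨(⟨homogeneousComponent b α, homogeneousComponent_mem _ _⟩,
        ⟨homogeneousComponent b β, homogeneousComponent_mem _ _⟩), ?_⟩
      funext i
      apply Subtype.ext
      show homogeneousComponent b α * u i + homogeneousComponent b β * v i = x i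
      rw [← hc_mul_of_right (hu i), ← hc_mul_of_right (hv i), ← map_add, ← h i]
      exact homogeneousComponent_eq_self (x i).2
    · rintro ⟨⟨α, β⟩, rfl⟩
      apply Subtype.ext
      show ∑ i, ((α : MvPolynomial (Fin 3) k) * u i + (β : MvPolynomial (Fin 3) k) * v i)
        * cross u v i = 0
      simp [Fin.sum_univ_three, cross]
      ring
  have hspan : ∀ p, p ∈ I ↔ ∃ c : Fin 3 → MvPolynomial (Fin 3) k, ∑ i, c i * cross u v i = p := by
    intro p
    have : ({cross u v 0, cross u v 1, cross u v 2} : Set (MvPolynomial (Fin 3) k)) =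
        Set.range (cross u v) := by
      ext q
      simp [Fin.exists_fin_succ, eq_comm]
    rw [hI, this]
    exact Ideal.mem_span_range_iff_exists_fun
  have hkerφ : LinearMap.ker φ = LinearMap.range L := by
    ext p
    rw [LinearMap.mem_ker, LinearMap.mem_range]
    have hφ : φ p = 0 ↔ (p : MvPolynomial (Fin 3) k) ∈ I := Ideal.Quotient.eq_zero_iff_mem
    rw [hφ, hspan]
    constructor
    · rintro ⟨c, hc⟩
      refine ⟨fun i => ⟨homogeneousComponent (b + m) (c i), homogeneousComponent_mem _ _⟩, ?_⟩
      apply Subtype.ext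
      show ∑ i, homogeneousComponent (b + m) (c i) * cross u v i = p
      rw [Finset.sum_congr rfl fun i _ => (hc_mul_of_right (hw i) (b + m)).symm, ← map_sum, hc]
      exact homogeneousComponent_eq_self p.2
    · rintro ⟨x, rfl⟩
      exact ⟨fun i => x i, rfl⟩
  have e1 := LinearMap.finrank_range_add_finrank_ker φ
  have e2 := LinearMap.finrank_range_add_finrank_ker L
  have e3 := LinearMap.finrank_range_add_finrank_ker M
  rw [hkerφ, finrank_homog] at e1
  rw [hkerL, Module.finrank_pi_fintype, Finset.sum_const, finrank_homog] at e2
  rw [hMinj, finrank_bot, Module.finrank_prod, finrank_homog] at e3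
  have e4 : LinearMap.range φ = Submodule.map (Ideal.Quotient.mkₐ k I).toLinearMap
        (homogeneousSubmodule (Fin 3) k (b + m + (m + m))) := LinearMap.range_domRestrict _ _
  rw [← e4]
  have e5 := choose_identity b m
  rw [show b + 3 * m = b + m + (m + m) by ring] at e5
  simp at e2
  omega

end Main
/-- if the zero locus in `P²(k)` of the three components of `∇f ∧ ∇g`
is finite, and `I` is the ideal they generate, then for all large `d` the dimension
of the degree-`d` piece of `S/I` equals `3(n−1)²`: the singular scheme `sg(F)` of the
pencil has length `3(n−1)²`. -/
theorem length_singular_scheme_of_pencil {k : Type*} [Field k] [IsAlgClosed k]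
    [CharZero k] (n : ℕ) (hn : 1 ≤ n) (f g : MvPolynomial (Fin 3) k)
    (hf : f.IsHomogeneous n) (hg : g.IsHomogeneous n)
    (hfin : {p : Projectivization k (Fin 3 → k) |
        ∀ i, eval p.rep (cross (grad f) (grad g) i) = 0}.Finite)
    (I : Ideal (MvPolynomial (Fin 3) k))
    (hI : I = Ideal.span {cross (grad f) (grad g) 0, cross (grad f) (grad g) 1,
        cross (grad f) (grad g) 2}) :
    ∃ N : ℕ, ∀ d ≥ N,
      Module.finrank k
        (Submodule.map (Ideal.Quotient.mkₐ k I).toLinearMap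
          (homogeneousSubmodule (Fin 3) k d)) = 3 * (n - 1) ^ 2 := by
  have hu : ∀ i, (grad f i).IsHomogeneous (n - 1) := fun i => hf.pderiv
  have hv : ∀ i, (grad g i).IsHomogeneous (n - 1) := fun i => hg.pderiv
  refine ⟨3 * (n - 1), fun d hd => ?_⟩
  have h := finrank_quotient_piece hu hv hfin I hI (d - 3 * (n - 1))
  rwa [show d - 3 * (n - 1) + (n - 1) + ((n - 1) + (n - 1)) = d by omega] at h
end

section
/- Let k be an algebraically closed field of characteristic zero, S = k[x,y,z], and let f, g ∈ S be linearly independent homogeneous polynomials of the same degree n ≥ 1. Suppose two distinct members of the pencil are non-reduced: suppose (α₁ : β₁) ≠ (α₂ : β₂) in P¹(k) and there exist non-constant homogeneous h₁, h₂ and homogeneous q₁, q₂ in S with α₁f + β₁g = h₁²·q₁ and α₂f + β₂g = h₂²·q₂. Then there exists p ∈ k³, p ≠ 0, with ∇f(p) = 0 and ∇g(p) = 0; in particular every member αf + βg of the pencil is singular at p. -/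
open MvPolynomial

/-- Substitution killing the variables of index `< j`. -/
noncomputable def killVars (k : Type*) [Field k] (j : ℕ) :
    MvPolynomial (Fin 3) k →ₐ[k] MvPolynomial (Fin 3) k :=
  aeval (fun i : Fin 3 => if i.val < j then 0 else X i)

lemma killVars_comp (k : Type*) [Field k] (j : ℕ) (p : MvPolynomial (Fin 3) k) :
    killVars k (j + 1) (killVars k j p) = killVars k (j + 1) p := by
  have : (killVars k (j + 1)).comp (killVars k j) = killVars k (j + 1) := by
    apply MvPolynomial.algHom_ext
    intro i
    by_cases h : i.val < j
    · simp [killVars, h]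
      intro h2
      omega
    · simp [killVars, h]
  exact DFunLike.congr_fun this p

lemma killVars_lt (k : Type*) [Field k] (j : ℕ) (hj : j < 3) :
    RingHom.ker (killVars k j) < RingHom.ker (killVars k (j + 1)) := by
  refine SetLike.lt_iff_le_and_exists.mpr ⟨?_, X ⟨j, hj⟩, ?_, ?_⟩
  · intro p hp
    rw [RingHom.mem_ker] at hp ⊢
    rw [← killVars_comp, hp, map_zero]
  · simp [RingHom.mem_ker, killVars]
  · simp [RingHom.mem_ker, killVars]

lemma three_le_height (k : Type*) [Field k] :
    3 ≤ (RingHom.ker (killVars k 3)).height := by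
  have i (j : ℕ) : (RingHom.ker (killVars k j)).IsPrime := RingHom.ker_isPrime _
  have a := Ideal.height_add_one_le_of_lt_of_isPrime (killVars_lt k 0 (by norm_num))
  have b := Ideal.height_add_one_le_of_lt_of_isPrime (killVars_lt k 1 (by norm_num))
  have c := Ideal.height_add_one_le_of_lt_of_isPrime (killVars_lt k 2 (by norm_num))
  norm_num at a b c
  calc (3 : ℕ∞) = 0 + 1 + 1 + 1 := by norm_num
    _ ≤ (RingHom.ker (killVars k 0)).height + 1 + 1 + 1 := by gcongr; exact zero_le
    _ ≤ _ := by
      refine le_trans ?_ c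
      gcongr
      refine le_trans ?_ b
      gcongr

lemma killVars_three (k : Type*) [Field k] (p : MvPolynomial (Fin 3) k) :
    killVars k 3 p = C (constantCoeff p) := by
  have : (fun i : Fin 3 => if i.val < 3 then (0 : MvPolynomial (Fin 3) k) else X i)
      = fun _ => 0 := by
    funext i; simp [i.isLt]
  rw [killVars, this, aeval_zero', algebraMap_eq]

/-- Two forms of positive degree in three variables have a common nonzero zero. -/
lemma exists_common_zero {k : Type*} [Field k] [IsAlgClosed k]
    (a b : MvPolynomial (Fin 3) k) (ha : constantCoeff a = 0) (hb : constantCoeff b = 0) :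
    ∃ p : Fin 3 → k, p ≠ 0 ∧ eval p a = 0 ∧ eval p b = 0 := by
  by_contra hcon
  push Not at hcon
  have hle : Ideal.span {a, b} ≤ RingHom.ker (killVars k 3) := by
    rw [Ideal.span_le]
    rintro p (rfl | rfl) <;> simp [RingHom.mem_ker, killVars_three, ha, hb]
  have hrad : RingHom.ker (killVars k 3) ≤ (Ideal.span {a, b}).radical := by
    intro p hp
    rw [RingHom.mem_ker, killVars_three, C_eq_zero] at hp
    rw [← vanishingIdeal_zeroLocus_eq_radical (K := k)]
    intro x hx
    rw [zeroLocus_span] at hx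
    have hxa : eval x a = 0 := by simpa using hx a (by simp)
    have hxb : eval x b = 0 := by simpa using hx b (by simp)
    have hx0 : x = 0 := by
      by_contra h
      exact hcon x h hxa hxb
    subst hx0
    simpa using hp
  have hmin : RingHom.ker (killVars k 3) ∈ (Ideal.span {a, b}).minimalPrimes := by
    refine ⟨⟨RingHom.ker_isPrime _, hle⟩, ?_⟩
    rintro J ⟨hJ, hJ'⟩ -
    exact hrad.trans (hJ.radical_le_iff.mpr hJ')
  have h2 := Ideal.height_le_card_of_mem_minimalPrimes_span (Set.toFinite _) hmin
  have h3 := (three_le_height k).trans h2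
  have h4 : Set.ncard {a, b} ≤ 2 := by
    have := Set.ncard_insert_le a {b}
    rwa [Set.ncard_singleton] at this
  have : 3 ≤ Set.ncard {a, b} := by exact_mod_cast h3
  omega

/-- if two distinct members `α₁f + β₁g = h₁²q₁` and `α₂f + β₂g = h₂²q₂`
of the pencil are non-reduced, then there is a nonzero `p ∈ k³` with
`∇f(p) = 0 = ∇g(p)`; in particular every member of the pencil is singular at `p`. -/
theorem common_singular_point_of_two_nonreduced_members {k : Type*} [Field k]
    [IsAlgClosed k] [CharZero k] (n : ℕ) (hn : 1 ≤ n)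
    (f g : MvPolynomial (Fin 3) k)
    (hf : f.IsHomogeneous n) (hg : g.IsHomogeneous n)
    (hind : LinearIndependent k ![f, g])
    (α₁ β₁ α₂ β₂ : k)
    (h1 : (α₁, β₁) ≠ (0, 0)) (h2 : (α₂, β₂) ≠ (0, 0))
    (hdist : α₁ * β₂ - α₂ * β₁ ≠ 0)
    (h₁ h₂ q₁ q₂ : MvPolynomial (Fin 3) k)
    (d₁ d₂ e₁ e₂ : ℕ) (hd₁ : 1 ≤ d₁) (hd₂ : 1 ≤ d₂)
    (hh₁ne : h₁ ≠ 0) (hh₂ne : h₂ ≠ 0)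
    (hh₁ : h₁.IsHomogeneous d₁) (hh₂ : h₂.IsHomogeneous d₂)
    (hq₁ : q₁.IsHomogeneous e₁) (hq₂ : q₂.IsHomogeneous e₂)
    (heq1 : C α₁ * f + C β₁ * g = h₁ ^ 2 * q₁)
    (heq2 : C α₂ * f + C β₂ * g = h₂ ^ 2 * q₂) :
    ∃ p : Fin 3 → k, p ≠ 0 ∧
      (∀ i, eval p (grad f i) = 0) ∧ (∀ i, eval p (grad g i) = 0) ∧
      ∀ α β : k, ∀ i, eval p (grad (C α * f + C β * g) i) = 0 := by
  have hc (h : MvPolynomial (Fin 3) k) (d : ℕ) (hd : 1 ≤ d) (hh : h.IsHomogeneous d) :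
      constantCoeff h = 0 := by
    rw [constantCoeff_eq]
    apply hh.coeff_eq_zero
    simp
    omega
  obtain ⟨p, hp, hp1, hp2⟩ := exists_common_zero h₁ h₂ (hc _ _ hd₁ hh₁) (hc _ _ hd₂ hh₂)
  have e1 (i : Fin 3) : α₁ * eval p (pderiv i f) + β₁ * eval p (pderiv i g) = 0 := by
    have := congrArg (fun F => eval p (pderiv i F)) heq1
    simpa [Derivation.leibniz, Derivation.leibniz_pow, hp1] using this
  have e2 (i : Fin 3) : α₂ * eval p (pderiv i f) + β₂ * eval p (pderiv i g) = 0 := by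
    have := congrArg (fun F => eval p (pderiv i F)) heq2
    simpa [Derivation.leibniz, Derivation.leibniz_pow, hp2] using this
  have hF (i : Fin 3) : eval p (pderiv i f) = 0 := by
    apply (mul_eq_zero.mp _).resolve_left hdist
    linear_combination β₂ * e1 i - β₁ * e2 i
  have hG (i : Fin 3) : eval p (pderiv i g) = 0 := by
    apply (mul_eq_zero.mp _).resolve_left hdist
    linear_combination α₁ * e2 i - α₂ * e1 i
  refine ⟨p, hp, hF, hG, fun α β i => ?_⟩
  simp [grad, Derivation.leibniz, hF, hG]
end

section
/- Let k be an algebraically closed field of characteristic zero, S = k[x,y,z], and let f, g be homogeneous of degree n ≥ 1 generating a pencil whose base locus is smooth (the common zeros of f and g in P²(k) are exactly n² distinct points) and in which every member αf + βg is squarefree and some member is smooth (has no zero of its gradient in k³ ∖ {0}). Let (α₁:β₁), …, (α_k:β_k) be k ≥ 2 distinct points of P¹(k), F = ∏_{i=1}^{k}(αᵢ f + βᵢ g), and J = (∂F/∂x, ∂F/∂y, ∂F/∂z) ⊆ S. Then the S-module T(F) = {v ∈ S³ : ⟨v, ∇F⟩ = 0} is free with a homogeneous basis of degrees 2n−2 and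 n(k−2)+1 if and only if for all sufficiently large d the dimension of the degree-d graded piece of S/J equals n²(k−1)² + 3(n−1)²; that is, D_k is free with exponents (2n−2, n(k−2)+1) if and only if the length of its Jacobian scheme equals n²(k−1)² + 3(n−1)². -/
open MvPolynomial

namespace FreeJac

/-- Component of a product with a homogeneous right factor. -/
lemma homComp_mul {k : Type*} [Field k] (p q : ℕ) (h B : MvPolynomial (Fin 3) k)
    (hB : B.IsHomogeneous q) :
    homogeneousComponent (p + q) (h * B) = homogeneousComponent p h * B := by
  conv_lhs => rw [← sum_homogeneousComponent h, Finset.sum_mul, map_sum]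
  have h1 : ∀ i, homogeneousComponent (p + q) (homogeneousComponent i h * B) =
      if i = p then homogeneousComponent p h * B else 0 := by
    intro i
    rw [homogeneousComponent_of_mem ((homogeneousComponent_isHomogeneous i h).mul hB)]
    by_cases hip : i = p
    · simp [hip]
    · rw [if_neg hip, if_neg (by omega)]
  simp only [h1]
  rw [Finset.sum_ite_eq']
  split_ifs with hm
  · rfl
  · rw [homogeneousComponent_eq_zero _ _ (by simpa using hm), zero_mul]

lemma not_dvd_pderiv {k : Type*} [Field k] [CharZero k] (h : MvPolynomial (Fin 3) k)
    (h0 : h ≠ 0) (hu : ¬ IsUnit h) : ¬ ∀ i, h ∣ pderiv i h := by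
  intro H
  have key : ∀ i, pderiv i h = 0 := by
    intro i
    by_contra hne
    obtain ⟨q, hq⟩ := H i
    have hq0 : q ≠ 0 := by
      rintro rfl
      simp at hq
      exact hne hq
    have h1 : (pderiv i h).totalDegree = h.totalDegree + q.totalDegree := by
      rw [hq, totalDegree_mul_of_isDomain h0 hq0]
    obtain ⟨s, hs, hs'⟩ : ∃ s ∈ (pderiv i h).support, s.degree = (pderiv i h).totalDegree := by
      obtain ⟨s, hs, hs'⟩ := Finset.exists_mem_eq_sup _ (support_nonempty.2 hne)
        (fun s : Fin 3 →₀ ℕ => s.sum fun _ e => e)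
      exact ⟨s, hs, hs'.symm⟩
    rw [mem_support_iff, coeff_pderiv] at hs
    have h2 : s + Finsupp.single i 1 ∈ h.support := by
      rw [mem_support_iff]
      exact left_ne_zero_of_mul hs
    have h3 := le_totalDegree h2
    have h4 : ((s + Finsupp.single i 1).sum fun _ e => e) = s.degree + 1 := by
      change (s + Finsupp.single i 1).degree = _
      simp
    omega
  apply hu
  have : h = C (coeff 0 h) := by
    ext s
    rw [coeff_C]
    split_ifs with hs
    · rw [hs]
    · obtain ⟨i, hi⟩ : ∃ i, s i ≠ 0 := by
        by_contra hcon
        push Not at hcon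
        exact hs (Finsupp.ext fun i => (hcon i).symm)
      obtain ⟨t, rfl⟩ : ∃ t, s = t + Finsupp.single i 1 :=
        ⟨s - Finsupp.single i 1, (tsub_add_cancel_of_le (by
          rw [Finsupp.single_le_iff]; omega)).symm⟩
      have := coeff_pderiv (i := i) h t
      rw [key i, coeff_zero] at this
      rcases mul_eq_zero.1 this.symm with h' | h'
      · exact h'
      · exact absurd h' (Nat.cast_add_one_ne_zero _)
  rw [this]
  refine (IsUnit.mk0 _ ?_).map C
  intro h'
  rw [h'] at this
  exact h0 (by simpa using this)

/-- Smooth: a large degree piece is contained in the Jacobian ideal. -/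
lemma exists_deg_le {k : Type*} [Field k] [IsAlgClosed k] (c : Fin 3 → MvPolynomial (Fin 3) k)
    (n : ℕ) (hsm : ∀ p : Fin 3 → k, p ≠ 0 → ∃ i, eval p (c i) ≠ 0) :
    ∃ N, n ≤ N ∧ ∀ a : MvPolynomial (Fin 3) k, a.IsHomogeneous N →
      a ∈ Ideal.span (Set.range c) := by
  have hX : ∀ i : Fin 3, (X i : MvPolynomial (Fin 3) k) ∈ (Ideal.span (Set.range c)).radical := by
    intro i
    rw [← vanishingIdeal_zeroLocus_eq_radical (K := k)]
    rw [mem_vanishingIdeal_iff]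
    intro x hx
    rw [zeroLocus_span] at hx
    have : x = 0 := by
      by_contra hne
      obtain ⟨j, hj⟩ := hsm x hne
      exact hj (by simpa [aeval_eq_eval] using hx (c j) ⟨j, rfl⟩)
    simp [this]
  choose r hr using fun i => (Ideal.mem_radical_iff.1 (hX i))
  refine ⟨r 0 + r 1 + r 2 + n, by omega, fun a ha => ?_⟩
  rw [a.as_sum]
  refine Ideal.sum_mem _ fun s hs => ?_
  have hdeg : s.degree = r 0 + r 1 + r 2 + n := by
    by_contra hne
    exact mem_support_iff.1 hs (ha.coeff_eq_zero hne)
  obtain ⟨i, hi⟩ : ∃ i, r i ≤ s i := by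
    by_contra hcon
    push Not at hcon
    have : s.degree = s 0 + s 1 + s 2 := by
      rw [Finsupp.degree_eq_sum, Fin.sum_univ_three]
    have h0 := hcon 0
    have h1 := hcon 1
    have h2 := hcon 2
    omega
  have : monomial s (coeff s a) = monomial (s - Finsupp.single i (r i)) (coeff s a) * X i ^ r i := by
    rw [X_pow_eq_monomial, monomial_mul, mul_one, tsub_add_cancel_of_le]
    rwa [Finsupp.single_le_iff]
  rw [this]
  exact Ideal.mul_mem_left _ _ (hr i)

/-- A prime cannot divide two variables. -/
lemma not_dvd_X {k : Type*} [Field k] (h : MvPolynomial (Fin 3) k) (hp : Prime h)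
    (h0 : h ∣ X 0) (h1 : h ∣ X 1) : False := by
  have hx0 : Irreducible (X 0 : MvPolynomial (Fin 3) k) := (X_prime (i := (0 : Fin 3))).irreducible
  have := (hp.irreducible.associated_of_dvd hx0 h0).symm.dvd.trans h1
  rw [X_dvd_X] at this
  simp at this

/-- If a prime divides all 2×2 minors of `(∇H, ∇G)` and `G` is smooth, then it divides
some `∇(H - μ G)`. -/
lemma exists_mu {k : Type*} [Field k] [IsAlgClosed k] (n : ℕ)
    (G H : Fin 3 → MvPolynomial (Fin 3) k) (hG : ∀ i, (G i).IsHomogeneous n)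
    (hH : ∀ i, (H i).IsHomogeneous n)
    (hsm : ∀ p : Fin 3 → k, p ≠ 0 → ∃ i, eval p (G i) ≠ 0)
    (h : MvPolynomial (Fin 3) k) (hp : Prime h)
    (hd : ∀ i j, h ∣ H i * G j - H j * G i) :
    ∃ μ : k, ∀ i, h ∣ H i - C μ * G i := by
  obtain ⟨N, hnN, hN⟩ := exists_deg_le G n hsm
  have hprime : (Ideal.span {h}).IsPrime := (Ideal.span_singleton_prime hp.ne_zero).2 hp
  let A := MvPolynomial (Fin 3) k ⧸ Ideal.span {h}
  let π : MvPolynomial (Fin 3) k →ₐ[k] A := Ideal.Quotient.mkₐ k _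
  let K := FractionRing A
  let ι : A →ₐ[k] K := IsScalarTower.toAlgHom k A K
  let φ : MvPolynomial (Fin 3) k →ₐ[k] K := ι.comp π
  have hφ : ∀ a, φ a = 0 ↔ h ∣ a := by
    intro a
    have hinj : Function.Injective ι := IsFractionRing.injective A K
    have : φ a = ι (π a) := rfl
    rw [this, map_eq_zero_iff ι hinj]
    change Ideal.Quotient.mk _ a = 0 ↔ _
    rw [Ideal.Quotient.eq_zero_iff_mem, Ideal.mem_span_singleton]
  have hXN : ∃ i : Fin 3, φ (X i ^ N) ≠ 0 := by
    by_contra hcon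
    push Not at hcon
    exact not_dvd_X h hp (hp.dvd_of_dvd_pow ((hφ _).1 (hcon 0)))
      (hp.dvd_of_dvd_pow ((hφ _).1 (hcon 1)))
  obtain ⟨i₁, hi₁⟩ := hXN
  obtain ⟨i₀, hi₀⟩ : ∃ i, φ (G i) ≠ 0 := by
    by_contra hcon
    push Not at hcon
    apply hi₁
    have hle : Ideal.span (Set.range G) ≤ RingHom.ker φ := by
      rw [Ideal.span_le]
      rintro _ ⟨i, rfl⟩
      exact hcon i
    exact hle (hN _ (isHomogeneous_X_pow i₁ N))
  let lam : K := φ (H i₀) / φ (G i₀)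
  have hlam : ∀ j, lam * φ (G j) = φ (H j) := by
    intro j
    have := (hφ _).2 (hd i₀ j)
    simp only [map_sub, map_mul] at this
    simp only [lam]
    rw [div_mul_eq_mul_div, div_eq_iff hi₀]
    exact sub_eq_zero.1 this
  let W : Submodule k K := (homogeneousSubmodule (Fin 3) k N).map φ.toLinearMap
  have hWfin : FiniteDimensional k (homogeneousSubmodule (Fin 3) k N) :=
    Module.Finite.iff_fg.2 (homogeneousSubmodule_fg (Fin 3) k N)
  have hW : ∀ w ∈ W, LinearMap.mulLeft k lam w ∈ W := by
    rintro _ ⟨a, ha, rfl⟩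
    obtain ⟨c, hc⟩ := (Ideal.mem_span_range_iff_exists_fun).1 (hN a ha)
    have hc' : a = ∑ i, homogeneousComponent (N - n) (c i) * G i := by
      have h1 : homogeneousComponent N a = a := homogeneousComponent_eq_self ha
      rw [← h1, ← hc, map_sum]
      refine Finset.sum_congr rfl fun i _ => ?_
      rw [← homComp_mul _ n _ _ (hG i), Nat.sub_add_cancel hnN]
    refine ⟨∑ i, homogeneousComponent (N - n) (c i) * H i, ?_, ?_⟩
    · refine Submodule.sum_mem _ fun i _ => ?_
      have := (homogeneousComponent_isHomogeneous (N - n) (c i)).mul (hH i)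
      rwa [Nat.sub_add_cancel hnN] at this
    · conv_rhs => rw [hc']
      simp only [AlgHom.toLinearMap_apply, LinearMap.mulLeft_apply, map_sum, map_mul]
      refine Finset.sum_congr rfl fun i _ => ?_
      rw [← hlam, mul_left_comm]
  have : Nontrivial W := by
    refine ⟨⟨0, ⟨φ (X i₁ ^ N), ⟨_, isHomogeneous_X_pow i₁ N, rfl⟩⟩, ?_⟩⟩
    intro h'
    exact hi₁ (congrArg Subtype.val h').symm
  have : FiniteDimensional k W := inferInstance
  obtain ⟨μ, hμ⟩ := Module.End.exists_eigenvalue ((LinearMap.mulLeft k lam).restrict hW)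
  obtain ⟨w, hw, hw0⟩ := hμ.exists_hasEigenvector
  rw [Module.End.mem_eigenspace_iff] at hw
  have hw' : lam * (w : K) = μ • (w : K) := congrArg Subtype.val hw
  have hw0' : (w : K) ≠ 0 := fun h' => hw0 (Subtype.ext h')
  have hl : lam = algebraMap k K μ := by
    rw [Algebra.smul_def] at hw'
    exact mul_right_cancel₀ hw0' hw'
  refine ⟨μ, fun i => (hφ _).1 ?_⟩
  have hC : φ (C μ) = algebraMap k K μ := φ.commutes μ
  rw [map_sub, map_mul, hC, ← hl, hlam, sub_self]

/-- The cross product of the gradients is primitive. -/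
lemma cross_primitive {k : Type*} [Field k] [IsAlgClosed k] [CharZero k]
    (n : ℕ) (hn : 1 ≤ n) (f g : MvPolynomial (Fin 3) k)
    (hf : f.IsHomogeneous n) (hg : g.IsHomogeneous n)
    (hred : ∀ α β : k, (α, β) ≠ (0, 0) → Squarefree (C α * f + C β * g))
    (hsm : ∃ α β : k, (α, β) ≠ (0, 0) ∧ ∀ p : Fin 3 → k, p ≠ 0 →
        ∃ i, eval p (grad (C α * f + C β * g) i) ≠ 0)
    (h : MvPolynomial (Fin 3) k) (hp : Prime h)
    (hd : ∀ i j, h ∣ pderiv i f * pderiv j g - pderiv j f * pderiv i g) : False := by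
  obtain ⟨α, β, hαβ, hs⟩ := hsm
  -- the second member
  obtain ⟨γ, δ, hdet⟩ : ∃ γ δ : k, γ * β - δ * α ≠ 0 := by
    by_cases hα : α = 0
    · refine ⟨1, 0, ?_⟩
      intro hβ
      apply hαβ
      simp at hβ
      rw [hα, hβ]
    · exact ⟨0, -1, by simpa using hα⟩
  have hmem : ∀ a b : k, (C a * f + C b * g).IsHomogeneous n := fun a b =>
    (hf.C_mul a).add (hg.C_mul b)
  obtain ⟨μ, hμ⟩ := exists_mu (n - 1) (grad (C α * f + C β * g)) (grad (C γ * f + C δ * g))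
    (fun i => (hmem _ _).pderiv) (fun i => (hmem _ _).pderiv) hs h hp (by
      intro i j
      have : grad (C γ * f + C δ * g) i * grad (C α * f + C β * g) j -
          grad (C γ * f + C δ * g) j * grad (C α * f + C β * g) i =
          C (γ * β - δ * α) * (pderiv i f * pderiv j g - pderiv j f * pderiv i g) := by
        simp only [grad, map_add, pderiv_C_mul, map_sub, map_mul]
        ring
      rw [this]
      exact (hd i j).mul_left _)
  set E := C (γ - μ * α) * f + C (δ - μ * β) * g with hE
  have hne : (γ - μ * α, δ - μ * β) ≠ (0, 0) := by
    intro h'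
    rw [Prod.mk.injEq] at h'
    apply hdet
    linear_combination β * h'.1 - α * h'.2
  have hEd : ∀ i, h ∣ pderiv i E := by
    intro i
    have : pderiv i E = grad (C γ * f + C δ * g) i - C μ * grad (C α * f + C β * g) i := by
      simp only [hE, grad, map_add, pderiv_C_mul]
      simp only [map_sub, map_mul]
      ring
    rw [this]
    exact hμ i
  have hEsq := hred _ _ hne
  rw [← hE] at hEsq
  have hEh : E.IsHomogeneous n := hmem _ _
  have hdE : h ∣ E := by
    have h1 := hEh.sum_X_mul_pderiv
    have h2 : h ∣ n • E := by
      rw [← h1]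
      exact Finset.dvd_sum fun i _ => (hEd i).mul_left _
    have h3 : E = C ((n : k)⁻¹) * (n • E) := by
      rw [nsmul_eq_mul, ← mul_assoc, ← C_eq_coe_nat, ← C_mul, inv_mul_cancel₀, C_1, one_mul]
      exact_mod_cast (by omega : n ≠ 0)
    rw [h3]
    exact h2.mul_left _
  obtain ⟨q, hq⟩ := hdE
  have hq' : ¬ h ∣ q := by
    rintro ⟨r, rfl⟩
    exact hp.not_isUnit (hEsq h ⟨r, by rw [hq]; ring⟩)
  apply not_dvd_pderiv h hp.ne_zero hp.not_isUnit
  intro i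
  have := hEd i
  rw [hq, pderiv_mul, dvd_add_left (Dvd.intro _ rfl)] at this
  exact (hp.dvd_or_dvd this).resolve_right hq'


lemma dvd_of_primitive {R : Type*} [CommRing R] [IsDomain R] [UniqueFactorizationMonoid R]
    (u : Fin 3 → R) (hu : ∀ h, Prime h → ¬ ∀ i, h ∣ u i) (hu0 : ∃ i, u i ≠ 0) (a b : R)
    (hab : ∀ i, a ∣ u i * b) : a ∣ b := by
  classical
  let _ : GCDMonoid R := UniqueFactorizationMonoid.toGCDMonoid R
  have h1 : a ∣ gcd (u 0) (gcd (u 1) (u 2)) * b := by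
    have h2 : a ∣ gcd (u 1 * b) (u 2 * b) := dvd_gcd (hab 1) (hab 2)
    have h3 : a ∣ gcd (u 1) (u 2) * b := h2.trans (gcd_mul_right' b (u 1) (u 2)).dvd
    have h4 : a ∣ gcd (u 0 * b) (gcd (u 1) (u 2) * b) := dvd_gcd (hab 0) h3
    exact h4.trans (gcd_mul_right' b (u 0) _).dvd
  set G := gcd (u 0) (gcd (u 1) (u 2)) with hG
  have hGd : ∀ i, G ∣ u i := by
    intro i
    fin_cases i
    · exact gcd_dvd_left _ _
    · exact (gcd_dvd_right _ _).trans (gcd_dvd_left _ _)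
    · exact (gcd_dvd_right _ _).trans (gcd_dvd_right _ _)
  have hG0 : G ≠ 0 := by
    intro h0
    obtain ⟨i, hi⟩ := hu0
    exact hi (by simpa [h0] using hGd i)
  have hGu : IsUnit G := by
    by_contra hnu
    obtain ⟨p, hp, hpd⟩ := WfDvdMonoid.exists_irreducible_factor hnu hG0
    exact hu p hp.prime fun i => hpd.trans (hGd i)
  exact (hGu.dvd_mul_left).1 h1

lemma proportional_of_primitive {R : Type*} [CommRing R] [IsDomain R]
    [UniqueFactorizationMonoid R]
    (u w : Fin 3 → R) (hu : ∀ h, Prime h → ¬ ∀ i, h ∣ u i) (hu0 : ∃ i, u i ≠ 0)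
    (hw : ∀ i j, w i * u j = w j * u i) : ∃ c, ∀ i, w i = c * u i := by
  obtain ⟨i, hi⟩ := hu0
  have : u i ∣ w i := dvd_of_primitive u hu ⟨i, hi⟩ _ _ fun j =>
    ⟨w j, by rw [mul_comm (u j), hw i j, mul_comm]⟩
  obtain ⟨c, hc⟩ := this
  refine ⟨c, fun j => mul_right_cancel₀ hi ?_⟩
  rw [← hw i j, hc]
  ring

lemma relPrime_syz {R : Type*} [CommRing R] [IsDomain R] [UniqueFactorizationMonoid R]
    (A B p q : R) (h : IsRelPrime A B) (hpq : A * p + B * q = 0) :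
    ∃ c, p = c * B ∧ q = -(c * A) := by
  by_cases hB : B = 0
  · subst hB
    have hA : IsUnit A := isRelPrime_zero_right.1 h
    obtain ⟨A', hA'⟩ := hA.exists_right_inv
    refine ⟨-(A' * q), ?_, ?_⟩
    · have : A * p = 0 := by simpa using hpq
      rw [mul_zero]
      exact (mul_eq_zero.1 this).resolve_left hA.ne_zero
    · linear_combination (-q) * hA'
  · have h1 : B ∣ A * p := ⟨-q, by linear_combination hpq⟩
    obtain ⟨c, hc⟩ := h.symm.dvd_of_dvd_mul_left h1
    refine ⟨c, by rw [hc, mul_comm], mul_left_cancel₀ hB ?_⟩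
    rw [hc] at hpq
    linear_combination hpq

/-- `X 0 ^ N, X 1 ^ N, X 2 ^ N` behaves as a regular sequence. -/
lemma koszul_X {k : Type*} [Field k] (N : ℕ) (c c2 c3 : MvPolynomial (Fin 3) k)
    (h : X 2 ^ N * c - X 1 ^ N * c2 + X 0 ^ N * c3 = 0) :
    ∃ a b, c = X 1 ^ N * a - X 0 ^ N * b := by
  let I : Ideal (MvPolynomial (Fin 3) k) := Ideal.span
    ((fun s => monomial s (1 : k)) '' {Finsupp.single 0 N, Finsupp.single 1 N})
  have hI : ∀ x, x ∈ I ↔ ∃ a b, x = X 1 ^ N * a - X 0 ^ N * b := by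
    intro x
    simp only [I, Set.image_pair, ← X_pow_eq_monomial]
    rw [Ideal.mem_span_pair]
    constructor
    · rintro ⟨a, b, rfl⟩
      exact ⟨b, -a, by ring⟩
    · rintro ⟨a, b, rfl⟩
      exact ⟨-b, a, by ring⟩
  rw [← hI]
  have h1 : X 2 ^ N * c ∈ I := (hI _).2 ⟨c2, c3, by linear_combination h⟩
  rw [mem_ideal_span_monomial_image] at h1 ⊢
  intro s hs
  have h2 : s + Finsupp.single 2 N ∈ (X 2 ^ N * c).support := by
    rw [mem_support_iff, X_pow_eq_monomial, add_comm, coeff_monomial_mul, one_mul]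
    exact mem_support_iff.1 hs
  obtain ⟨t, ht, hts⟩ := h1 _ h2
  refine ⟨t, ht, ?_⟩
  rcases ht with rfl | rfl
  · rw [Finsupp.single_le_iff] at hts ⊢
    simpa using hts
  · rw [Finsupp.single_le_iff] at hts ⊢
    simpa using hts

/-- Depth argument. -/
lemma koszul_lift {k : Type*} [Field k] (N : ℕ) (pf pg u : Fin 3 → MvPolynomial (Fin 3) k)
    (A B : MvPolynomial (Fin 3) k) (hu0 : ∃ i, u i ≠ 0)
    (huf : dot u pf = 0) (hug : dot u pg = 0)
    (hker : ∀ w, dot w pf = 0 → dot w pg = 0 → ∃ c, ∀ i, w i = c * u i)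
    (h : ∀ i : Fin 3, ∃ v, dot v pf = X i ^ N * B ∧ dot v pg = -(X i ^ N * A)) :
    ∃ v, dot v pf = B ∧ dot v pg = -A := by
  choose v hvf hvg using h
  obtain ⟨i₀, hi₀⟩ := hu0
  have hc : ∀ i j : Fin 3, ∃ c, ∀ l, X j ^ N * v i l - X i ^ N * v j l = c * u l := by
    intro i j
    refine hker (fun l => X j ^ N * v i l - X i ^ N * v j l) ?_ ?_
    · have h1 := hvf i
      have h2 := hvf j
      simp only [dot] at h1 h2 ⊢
      linear_combination X j ^ N * h1 - X i ^ N * h2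
    · have h1 := hvg i
      have h2 := hvg j
      simp only [dot] at h1 h2 ⊢
      linear_combination X j ^ N * h1 - X i ^ N * h2
  obtain ⟨c, hc1⟩ := hc 0 1
  obtain ⟨c2, hc2⟩ := hc 0 2
  obtain ⟨c3, hc3⟩ := hc 1 2
  obtain ⟨a, b, hab⟩ := koszul_X N c c2 c3 (by
    apply mul_right_cancel₀ hi₀
    linear_combination (-X 2 ^ N) * hc1 i₀ + X 1 ^ N * hc2 i₀ - X 0 ^ N * hc3 i₀)
  have hrel : IsRelPrime (X 0 ^ N : MvPolynomial (Fin 3) k) (X 1 ^ N) := by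
    apply IsRelPrime.pow
    rw [UniqueFactorizationMonoid.isRelPrime_iff_no_prime_factors (X_ne_zero _)]
    intro d hd0 hd1 hd
    exact not_dvd_X d hd hd0 hd1
  have hdv : ∀ l, ∃ y, v 0 l - a * u l = X 0 ^ N * y := by
    intro l
    have : (X 0 ^ N : MvPolynomial (Fin 3) k) ∣ X 1 ^ N * (v 0 l - a * u l) :=
      ⟨v 1 l - b * u l, by linear_combination hc1 l + u l * hab⟩
    exact hrel.dvd_of_dvd_mul_left this
  choose y hy using hdv
  have hX : (X 0 ^ N : MvPolynomial (Fin 3) k) ≠ 0 := pow_ne_zero _ (X_ne_zero _)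
  refine ⟨y, mul_left_cancel₀ hX ?_, mul_left_cancel₀ hX ?_⟩
  · have h1 := hvf 0
    simp only [dot] at h1 huf ⊢
    linear_combination h1 - a * huf - pf 0 * hy 0 - pf 1 * hy 1 - pf 2 * hy 2
  · have h1 := hvg 0
    simp only [dot] at h1 hug ⊢
    linear_combination h1 - a * hug - pg 0 * hy 0 - pg 1 * hy 1 - pg 2 * hy 2

/-- Coprimality of the two coefficients of `∇F`. -/
lemma coeffs_relPrime {k : Type*} [Field k] [CharZero k] (f g : MvPolynomial (Fin 3) k)
    (hcop : ∀ h, Prime h → h ∣ f → h ∣ g → False)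
    (m : ℕ) (hm : 2 ≤ m) (α β : Fin m → k)
    (hnz : ∀ i, (α i, β i) ≠ (0, 0))
    (hdist : ∀ i j, i ≠ j → α i * β j - α j * β i ≠ 0) :
    ∀ h, Prime h →
      h ∣ (∑ i, C (α i) * ∏ j ∈ Finset.univ.erase i, (C (α j) * f + C (β j) * g)) →
      h ∣ (∑ i, C (β i) * ∏ j ∈ Finset.univ.erase i, (C (α j) * f + C (β j) * g)) → False := by
  intro h hp hA hB
  set L : Fin m → MvPolynomial (Fin 3) k := fun j => C (α j) * f + C (β j) * g with hL
  set Q : Fin m → MvPolynomial (Fin 3) k := fun i => ∏ j ∈ Finset.univ.erase i, L j with hQ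
  have hA' : h ∣ ∑ i, C (α i) * Q i := hA
  have hB' : h ∣ ∑ i, C (β i) * Q i := hB
  have hLQ : ∀ i, L i * Q i = ∏ j, L j := fun i => Finset.mul_prod_erase _ L (Finset.mem_univ i)
  have hF : h ∣ ∏ j, L j := by
    have h1 : f * (∑ i, C (α i) * Q i) + g * (∑ i, C (β i) * Q i) = C (m : k) * ∏ j, L j := by
      rw [Finset.mul_sum, Finset.mul_sum, ← Finset.sum_add_distrib]
      have : ∀ i ∈ Finset.univ, f * (C (α i) * Q i) + g * (C (β i) * Q i) = ∏ j, L j := by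
        intro i _
        rw [← hLQ i]
        simp only [hL]
        ring
      rw [Finset.sum_congr rfl this]
      simp
    have h2 : h ∣ C (m : k) * ∏ j, L j := by
      rw [← h1]
      exact (hA'.mul_left _).add (hB'.mul_left _)
    have h3 : IsUnit (C (m : k) : MvPolynomial (Fin 3) k) :=
      (IsUnit.mk0 _ (by exact_mod_cast (by omega : m ≠ 0))).map C
    exact (h3.dvd_mul_left).1 h2
  obtain ⟨i, -, hi⟩ := (hp.dvd_finsetProd_iff _).1 hF
  have hsplit : ∀ c : Fin m → k, h ∣ ∑ l, C (c l) * Q l → h ∣ C (c i) * Q i := by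
    intro c hc
    rw [← Finset.add_sum_erase _ _ (Finset.mem_univ i)] at hc
    rwa [dvd_add_left] at hc
    refine Finset.dvd_sum fun l hl => Dvd.dvd.mul_left ?_ _
    refine hi.trans (Finset.dvd_prod_of_mem L ?_)
    rw [Finset.mem_erase] at hl ⊢
    exact ⟨hl.1.symm, Finset.mem_univ _⟩
  have hQi : h ∣ Q i := by
    have h1 := hsplit α hA'
    have h2 := hsplit β hB'
    by_cases hα : α i = 0
    · have hβ : β i ≠ 0 := fun h' => hnz i (by rw [hα, h'])
      exact (((IsUnit.mk0 _ hβ).map C).dvd_mul_left).1 h2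
    · exact (((IsUnit.mk0 _ hα).map C).dvd_mul_left).1 h1
  obtain ⟨j, hj, hjd⟩ := (hp.dvd_finsetProd_iff _).1 hQi
  have hij : i ≠ j := fun h' => (Finset.mem_erase.1 hj).1 h'.symm
  have hu : IsUnit (C (α i * β j - α j * β i) : MvPolynomial (Fin 3) k) :=
    (IsUnit.mk0 _ (hdist i j hij)).map C
  refine hcop h hp ((hu.dvd_mul_left).1 ?_) ((hu.dvd_mul_left).1 ?_)
  · have : C (α i * β j - α j * β i) * f = C (β j) * L i - C (β i) * L j := by
      simp only [hL, map_sub, map_mul]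
      ring
    rw [this]
    exact (hi.mul_left _).sub (hjd.mul_left _)
  · have : C (α i * β j - α j * β i) * g = C (α i) * L j - C (α j) * L i := by
      simp only [hL, map_sub, map_mul]
      ring
    rw [this]
    exact (hjd.mul_left _).sub (hi.mul_left _)

lemma pderiv_prod_aux {k : Type*} [Field k] {ι : Type*} [DecidableEq ι] (s : Finset ι)
    (L : ι → MvPolynomial (Fin 3) k) (l : Fin 3) :
    pderiv l (∏ i ∈ s, L i) = ∑ i ∈ s, (∏ j ∈ s.erase i, L j) * pderiv l (L i) := by
  induction s using Finset.induction_on with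
  | empty => simp
  | insert a s ha ih =>
    rw [Finset.prod_insert ha, pderiv_mul, ih, Finset.sum_insert ha, Finset.erase_insert ha,
      Finset.mul_sum]
    congr 1
    · ring
    · refine Finset.sum_congr rfl fun i hi => ?_
      have hai : a ≠ i := fun h => ha (h ▸ hi)
      rw [Finset.erase_insert_of_ne hai, Finset.prod_insert
        (fun h => ha (Finset.mem_of_mem_erase h))]
      ring

lemma pderiv_prod {k : Type*} [Field k] (f g : MvPolynomial (Fin 3) k)
    (m : ℕ) (α β : Fin m → k) (l : Fin 3) :
    pderiv l (∏ i, (C (α i) * f + C (β i) * g)) =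
      (∑ i, C (α i) * ∏ j ∈ Finset.univ.erase i, (C (α j) * f + C (β j) * g)) * pderiv l f +
      (∑ i, C (β i) * ∏ j ∈ Finset.univ.erase i, (C (α j) * f + C (β j) * g)) * pderiv l g := by
  rw [pderiv_prod_aux, Finset.sum_mul, Finset.sum_mul, ← Finset.sum_add_distrib]
  refine Finset.sum_congr rfl fun i _ => ?_
  simp only [map_add, pderiv_C_mul]
  ring


lemma finrank_map_add {k V W : Type*} [Field k] [AddCommGroup V] [Module k V] [AddCommGroup W]
    [Module k W] (φ : V →ₗ[k] W) (U : Submodule k V) [FiniteDimensional k U] :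
    Module.finrank k (U.map φ) + Module.finrank k (U ⊓ LinearMap.ker φ : Submodule k V) =
      Module.finrank k U := by
  rw [← LinearMap.finrank_range_add_finrank_ker (φ.domRestrict U), LinearMap.range_domRestrict]
  congr 1
  rw [LinearMap.ker_domRestrict]
  have : (U ⊓ LinearMap.ker φ) = ((LinearMap.ker φ).comap U.subtype).map U.subtype := by
    rw [Submodule.map_comap_subtype]
  rw [this]
  exact (Submodule.equivMapOfInjective U.subtype U.injective_subtype
    ((LinearMap.ker φ).comap U.subtype)).finrank_eq.symm

instance finDimHom {k : Type*} [Field k] (d : ℕ) :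
    FiniteDimensional k (homogeneousSubmodule (Fin 3) k d) :=
  Module.Finite.iff_fg.2 (homogeneousSubmodule_fg (Fin 3) k d)

lemma finrank_hom (k : Type*) [Field k] (d : ℕ) :
    2 * Module.finrank k (homogeneousSubmodule (Fin 3) k d) = (d + 1) * (d + 2) := by
  have h1 : Module.finrank k (homogeneousSubmodule (Fin 3) k d) =
      ((Finset.univ : Finset (Fin 3)).finsuppAntidiag d).card := by
    have hspan : homogeneousSubmodule (Fin 3) k d = Submodule.span k (Set.range
        fun s : (Finset.univ : Finset (Fin 3)).finsuppAntidiag d =>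
          (basisMonomials (Fin 3) k) s.1) := by
      have hmem : ∀ s : Fin 3 →₀ ℕ,
          s ∈ (Finset.univ : Finset (Fin 3)).finsuppAntidiag d ↔ s.degree = d := by
        intro s
        rw [Finset.mem_finsuppAntidiag, Finsupp.degree_eq_sum]
        simp
      apply le_antisymm
      · intro a ha
        rw [a.as_sum]
        refine Submodule.sum_mem _ fun s hs => ?_
        have hdeg : s.degree = d := by
          by_contra hne
          exact mem_support_iff.1 hs (IsHomogeneous.coeff_eq_zero ha hne)
        have : monomial s (coeff s a) = coeff s a • (basisMonomials (Fin 3) k) s := by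
          rw [coe_basisMonomials, smul_monomial, smul_eq_mul, mul_one]
        rw [this]
        exact Submodule.smul_mem _ _ (Submodule.subset_span ⟨⟨s, (hmem s).2 hdeg⟩, rfl⟩)
      · rw [Submodule.span_le]
        rintro _ ⟨s, rfl⟩
        simp only [coe_basisMonomials]
        exact isHomogeneous_monomial _ ((hmem s.1).1 s.2)
    rw [hspan, finrank_span_eq_card]
    · simp
    · exact (basisMonomials (Fin 3) k).linearIndependent.comp _ Subtype.val_injective
  rw [h1, Finset.card_finsuppAntidiag_nat_eq_choose]
  have h2 : (Finset.univ : Finset (Fin 3)).card + d - 1 = d + 2 := by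
    simp
    omega
  rw [h2, Nat.choose_symm_add, Nat.choose_two_right, Nat.mul_div_cancel']
  · have : d + 2 - 1 = d + 1 := by omega
    rw [this, mul_comm]
  · exact (Nat.even_mul_pred_self (d + 2)).two_dvd

/-- triples of homogeneous polynomials -/
noncomputable def triples (k : Type*) [Field k] (e : ℕ) :
    Submodule k (Fin 3 → MvPolynomial (Fin 3) k) :=
  Submodule.pi Set.univ fun _ => homogeneousSubmodule (Fin 3) k e

lemma mem_triples {k : Type*} [Field k] {e : ℕ} {w : Fin 3 → MvPolynomial (Fin 3) k} :
    w ∈ triples k e ↔ ∀ i, (w i).IsHomogeneous e := by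
  simp [triples, Submodule.mem_pi]

noncomputable def triplesEquiv (k : Type*) [Field k] (e : ℕ) :
    triples k e ≃ₗ[k] (Fin 3 → homogeneousSubmodule (Fin 3) k e) where
  toFun w i := ⟨w.1 i, mem_triples.1 w.2 i⟩
  invFun w := ⟨fun i => (w i).1, mem_triples.2 fun i => (w i).2⟩
  map_add' _ _ := rfl
  map_smul' _ _ := rfl
  left_inv _ := rfl
  right_inv _ := rfl

instance finDimTriples {k : Type*} [Field k] (e : ℕ) : FiniteDimensional k (triples k e) :=
  Module.Finite.equiv (triplesEquiv k e).symm

lemma finrank_triples (k : Type*) [Field k] (e : ℕ) :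
    Module.finrank k (triples k e) = 3 * Module.finrank k (homogeneousSubmodule (Fin 3) k e) := by
  rw [(triplesEquiv k e).finrank_eq, Module.finrank_pi_fintype]
  simp

/-- `w ↦ ⟨w, p⟩` as a linear map. -/
noncomputable def dotL {k : Type*} [Field k] (p : Fin 3 → MvPolynomial (Fin 3) k) :
    (Fin 3 → MvPolynomial (Fin 3) k) →ₗ[k] MvPolynomial (Fin 3) k where
  toFun w := dot w p
  map_add' x y := by simp only [dot, Pi.add_apply]; ring
  map_smul' c x := by simp only [dot, Pi.smul_apply, smul_eq_C_mul, RingHom.id_apply]; ring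

@[simp] lemma dotL_apply {k : Type*} [Field k] (p w : Fin 3 → MvPolynomial (Fin 3) k) :
    dotL p w = dot w p := rfl

lemma dot_comp {k : Type*} [Field k] (p w : Fin 3 → MvPolynomial (Fin 3) k) (e q : ℕ)
    (hp : ∀ i, (p i).IsHomogeneous q) :
    dot (fun i => homogeneousComponent e (w i)) p = homogeneousComponent (e + q) (dot w p) := by
  simp only [dot, map_add, homComp_mul _ _ _ _ (hp _)]

lemma dot_hom {k : Type*} [Field k] (p w : Fin 3 → MvPolynomial (Fin 3) k) (e q : ℕ)
    (hw : ∀ i, (w i).IsHomogeneous e)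
    (hp : ∀ i, (p i).IsHomogeneous q) : (dot w p).IsHomogeneous (e + q) :=
  (((hw 0).mul (hp 0)).add ((hw 1).mul (hp 1))).add ((hw 2).mul (hp 2))

/-- First count: dimension of `(S/J)_{e+q}` -/
lemma count_quot {k : Type*} [Field k] (p : Fin 3 → MvPolynomial (Fin 3) k) (e q : ℕ)
    (hp : ∀ i, (p i).IsHomogeneous q) (J : Ideal (MvPolynomial (Fin 3) k))
    (hJ : J = Ideal.span {p 0, p 1, p 2}) :
    Module.finrank k (Submodule.map (Ideal.Quotient.mkₐ k J).toLinearMap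
            (homogeneousSubmodule (Fin 3) k (e + q))) +
      3 * Module.finrank k (homogeneousSubmodule (Fin 3) k e) =
    Module.finrank k (homogeneousSubmodule (Fin 3) k (e + q)) +
      Module.finrank k (triples k e ⊓ LinearMap.ker (dotL p) : Submodule k _) := by
  have h1 := finrank_map_add (Ideal.Quotient.mkₐ k J).toLinearMap
    (homogeneousSubmodule (Fin 3) k (e + q))
  have h2 := finrank_map_add (dotL p) (triples k e)
  rw [finrank_triples] at h2
  have h3 : homogeneousSubmodule (Fin 3) k (e + q) ⊓
      LinearMap.ker (Ideal.Quotient.mkₐ k J).toLinearMap = (triples k e).map (dotL p) := by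
    ext x
    rw [Submodule.mem_inf, LinearMap.mem_ker, Submodule.mem_map]
    have hx : (Ideal.Quotient.mkₐ k J).toLinearMap x = 0 ↔ x ∈ J :=
      Ideal.Quotient.eq_zero_iff_mem
    rw [hx, hJ]
    constructor
    · rintro ⟨hxh, hxJ⟩
      rw [Ideal.mem_span_insert'] at hxJ
      obtain ⟨a, ha⟩ := hxJ
      rw [Ideal.mem_span_pair] at ha
      obtain ⟨b, c, hbc⟩ := ha
      refine ⟨fun i => homogeneousComponent e ((![-a, b, c] : Fin 3 → _) i), ?_, ?_⟩
      · exact mem_triples.2 fun i => homogeneousComponent_isHomogeneous _ _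
      · rw [dotL_apply, dot_comp p _ e q hp, ← homogeneousComponent_eq_self hxh]
        congr 1
        simp [dot]
        linear_combination hbc
    · rintro ⟨w, hw, rfl⟩
      refine ⟨dot_hom p w e q (mem_triples.1 hw) hp, ?_⟩
      rw [dotL_apply, dot]
      refine Ideal.add_mem _ (Ideal.add_mem _ ?_ ?_) ?_ <;>
        exact Ideal.mul_mem_left _ _ (Ideal.subset_span (by simp))
  rw [h3] at h1
  omega

/-- numerics -/
lemma numerics (k : Type*) [Field k] (n' m' t : ℕ) (a b : ℕ) (ha : a = 2 * n')
    (hb : b = (n' + 1) * m' + 1) (x T : ℕ)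
    (hx : x + 3 * Module.finrank k (homogeneousSubmodule (Fin 3) k (a + b + t)) =
      Module.finrank k (homogeneousSubmodule (Fin 3) k (a + b + t + (a + b))) + T) :
    x = (n' + 1) ^ 2 * (m' + 1) ^ 2 + 3 * n' ^ 2 ↔
      T = Module.finrank k (homogeneousSubmodule (Fin 3) k (b + t)) +
        Module.finrank k (homogeneousSubmodule (Fin 3) k (a + t)) := by
  have h1 := finrank_hom k (a + b + t)
  have h2 := finrank_hom k (a + b + t + (a + b))
  have h3 := finrank_hom k (b + t)
  have h4 := finrank_hom k (a + t)
  have hab : (n' + 1) ^ 2 * (m' + 1) ^ 2 + 3 * n' ^ 2 = a ^ 2 + a * b + b ^ 2 := by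
    subst ha hb
    ring
  rw [hab]
  zify at *
  constructor
  · intro h
    linarith
  · intro h
    linarith


/-- Freeness gives the dimension of the syzygies. -/
lemma count_free {k : Type*} [Field k] (pF u v : Fin 3 → MvPolynomial (Fin 3) k) (a b t : ℕ)
    (hu : ∀ i, (u i).IsHomogeneous a) (hv : ∀ i, (v i).IsHomogeneous b)
    (huF : dot u pF = 0) (hvF : dot v pF = 0)
    (hbas : ∀ w : Fin 3 → MvPolynomial (Fin 3) k, dot w pF = 0 →
          ∃! ab : MvPolynomial (Fin 3) k × MvPolynomial (Fin 3) k,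
            w = fun i => ab.1 * u i + ab.2 * v i) :
    Module.finrank k (triples k (a + b + t) ⊓ LinearMap.ker (dotL pF) : Submodule k _) =
      Module.finrank k (homogeneousSubmodule (Fin 3) k (b + t)) +
        Module.finrank k (homogeneousSubmodule (Fin 3) k (a + t)) := by
  let Φ : (homogeneousSubmodule (Fin 3) k (b + t) × homogeneousSubmodule (Fin 3) k (a + t)) →ₗ[k]
      (Fin 3 → MvPolynomial (Fin 3) k) :=
    { toFun := fun ab i => ab.1.1 * u i + ab.2.1 * v i
      map_add' := fun x y => by
        funext i
        simp only [Prod.fst_add, Prod.snd_add, Submodule.coe_add, Pi.add_apply]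
        ring
      map_smul' := fun c x => by
        funext i
        simp only [Prod.smul_fst, Prod.smul_snd, Submodule.coe_smul, Pi.smul_apply,
          smul_eq_C_mul, RingHom.id_apply]
        ring }
  have hΦ : ∀ x y i, Φ (x, y) i = x.1 * u i + y.1 * v i := fun _ _ _ => rfl
  have hdot : ∀ x y : MvPolynomial (Fin 3) k, dot (fun i => x * u i + y * v i) pF = 0 := by
    intro x y
    simp only [dot] at huF hvF ⊢
    linear_combination x * huF + y * hvF
  have hinj : Function.Injective Φ := by
    rintro ⟨x, y⟩ ⟨x', y'⟩ h
    obtain ⟨p, hp, hpu⟩ := hbas _ (hdot x.1 y.1)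
    have h1 := hpu (x.1, y.1) rfl
    have h2 := hpu (x'.1, y'.1) h
    have h3 := h1.trans h2.symm
    rw [Prod.mk.injEq] at h3
    exact Prod.ext (Subtype.ext h3.1) (Subtype.ext h3.2)
  have hrange : triples k (a + b + t) ⊓ LinearMap.ker (dotL pF) = LinearMap.range Φ := by
    ext w
    rw [Submodule.mem_inf, LinearMap.mem_ker, dotL_apply, mem_triples, LinearMap.mem_range]
    constructor
    · rintro ⟨hw, hwF⟩
      obtain ⟨p, hp, -⟩ := hbas w hwF
      refine ⟨(⟨homogeneousComponent (b + t) p.1, homogeneousComponent_mem _ _⟩,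
        ⟨homogeneousComponent (a + t) p.2, homogeneousComponent_mem _ _⟩), ?_⟩
      funext i
      rw [hΦ]
      simp only
      rw [← homogeneousComponent_eq_self (hw i), hp, map_add, ← homComp_mul _ a _ _ (hu i),
        ← homComp_mul _ b _ _ (hv i)]
      congr 3 <;> ring
    · rintro ⟨⟨x, y⟩, rfl⟩
      refine ⟨fun i => ?_, hdot _ _⟩
      rw [hΦ]
      have h1 := IsHomogeneous.mul x.2 (hu i)
      have h2 := IsHomogeneous.mul y.2 (hv i)
      rw [show b + t + a = a + b + t by ring] at h1
      rw [show a + t + b = a + b + t by ring] at h2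
      exact h1.add h2
  rw [hrange, LinearMap.finrank_range_of_inj hinj, Module.finrank_prod]

/-- The right dimension of the syzygies gives surjectivity of `φ` in that degree. -/
lemma surj_of_count {k : Type*} [Field k] (pF pf pg u : Fin 3 → MvPolynomial (Fin 3) k)
    (A B : MvPolynomial (Fin 3) k) (a b t n' : ℕ)
    (hu : ∀ i, (u i).IsHomogeneous a) (hu0 : ∃ i, u i ≠ 0)
    (huf : dot u pf = 0) (hug : dot u pg = 0)
    (hpf : ∀ i, (pf i).IsHomogeneous n') (hpg : ∀ i, (pg i).IsHomogeneous n')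
    (hA : A.IsHomogeneous (b + n')) (hB : B.IsHomogeneous (b + n'))
    (hAB : IsRelPrime A B) (hAB0 : A ≠ 0 ∨ B ≠ 0)
    (hpF : ∀ w, dot w pF = A * dot w pf + B * dot w pg)
    (hker : ∀ w, dot w pf = 0 → dot w pg = 0 → ∃ c, ∀ i, w i = c * u i)
    (hcount : Module.finrank k
        (triples k (a + b + t) ⊓ LinearMap.ker (dotL pF) : Submodule k _) =
      Module.finrank k (homogeneousSubmodule (Fin 3) k (b + t)) +
        Module.finrank k (homogeneousSubmodule (Fin 3) k (a + t))) :
    ∀ h : MvPolynomial (Fin 3) k, h.IsHomogeneous (a + t) →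
      ∃ w, dot w pf = h * B ∧ dot w pg = -(h * A) := by
  set T : Submodule k (Fin 3 → MvPolynomial (Fin 3) k) :=
    triples k (a + b + t) ⊓ LinearMap.ker (dotL pF) with hT
  have hTfin : FiniteDimensional k T := Submodule.finiteDimensional_inf_left _ _
  let ψ := (dotL pf).prod (dotL pg)
  let ρ : MvPolynomial (Fin 3) k →ₗ[k] MvPolynomial (Fin 3) k × MvPolynomial (Fin 3) k :=
    (LinearMap.mulRight k B).prod (LinearMap.mulRight k (-A))
  have hρ : ∀ h, ρ h = (h * B, h * -A) := fun _ => rfl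
  have hψ : ∀ w, ψ w = (dot w pf, dot w pg) := fun _ => rfl
  have hρinj : Function.Injective ρ := by
    rw [injective_iff_map_eq_zero]
    intro h hh
    rw [hρ, Prod.mk_eq_zero] at hh
    rcases hAB0 with h0 | h0
    · exact (mul_eq_zero.1 hh.2).resolve_right (neg_ne_zero.2 h0)
    · exact (mul_eq_zero.1 hh.1).resolve_right h0
  let σ : MvPolynomial (Fin 3) k →ₗ[k] (Fin 3 → MvPolynomial (Fin 3) k) :=
    LinearMap.pi fun i => LinearMap.mulRight k (u i)
  have hσ : ∀ c i, σ c i = c * u i := fun _ _ => rfl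
  have hσinj : Function.Injective σ := by
    rw [injective_iff_map_eq_zero]
    intro c hc
    obtain ⟨i, hi⟩ := hu0
    have := congrFun hc i
    rw [hσ] at this
    exact (mul_eq_zero.1 this).resolve_right hi
  have h1 := finrank_map_add ψ T
  have h2 : T ⊓ LinearMap.ker ψ = (homogeneousSubmodule (Fin 3) k (b + t)).map σ := by
    ext w
    rw [Submodule.mem_inf, LinearMap.mem_ker, hψ, Prod.mk_eq_zero, Submodule.mem_map]
    constructor
    · rintro ⟨hw, hwf, hwg⟩
      obtain ⟨c, hc⟩ := hker w hwf hwg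
      refine ⟨homogeneousComponent (b + t) c, homogeneousComponent_mem _ _, ?_⟩
      funext i
      rw [hσ, ← homComp_mul _ a _ _ (hu i), ← hc,
        show b + t + a = a + b + t by ring]
      exact homogeneousComponent_eq_self (mem_triples.1 hw.1 i)
    · rintro ⟨c, hc, rfl⟩
      have hf0 : dot (σ c) pf = 0 := by
        simp only [dot, hσ] at huf ⊢
        linear_combination c * huf
      have hg0 : dot (σ c) pg = 0 := by
        simp only [dot, hσ] at hug ⊢
        linear_combination c * hug
      refine ⟨⟨mem_triples.2 fun i => ?_, ?_⟩, hf0, hg0⟩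
      · have h3 := IsHomogeneous.mul hc (hu i)
        rw [show b + t + a = a + b + t by ring] at h3
        exact h3
      · rw [SetLike.mem_coe, LinearMap.mem_ker, dotL_apply, hpF, hf0, hg0]
        simp
  have hle : T.map ψ ≤ (homogeneousSubmodule (Fin 3) k (a + t)).map ρ := by
    rintro _ ⟨w, hw, rfl⟩
    have hwF : dot w pF = 0 := hw.2
    rw [hpF] at hwF
    obtain ⟨c, hc1, hc2⟩ := relPrime_syz A B _ _ hAB hwF
    refine ⟨homogeneousComponent (a + t) c, homogeneousComponent_mem _ _, ?_⟩
    have hw' := mem_triples.1 hw.1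
    rw [hρ, hψ, ← homComp_mul _ _ _ _ hB, ← homComp_mul _ _ _ _ hA.neg,
      show c * -A = dot w pg by rw [hc2]; ring, ← hc1,
      show a + t + (b + n') = a + b + t + n' by ring,
      homogeneousComponent_eq_self (dot_hom pf w _ _ hw' hpf),
      homogeneousComponent_eq_self (dot_hom pg w _ _ hw' hpg)]
  have h3 : Module.finrank k ((homogeneousSubmodule (Fin 3) k (b + t)).map σ) =
      Module.finrank k (homogeneousSubmodule (Fin 3) k (b + t)) :=
    (Submodule.equivMapOfInjective σ hσinj _).finrank_eq.symm
  have h4 : Module.finrank k ((homogeneousSubmodule (Fin 3) k (a + t)).map ρ) =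
      Module.finrank k (homogeneousSubmodule (Fin 3) k (a + t)) :=
    (Submodule.equivMapOfInjective ρ hρinj _).finrank_eq.symm
  rw [h2, h3] at h1
  have heq : T.map ψ = (homogeneousSubmodule (Fin 3) k (a + t)).map ρ :=
    Submodule.eq_of_le_of_finrank_eq hle (by omega)
  intro h hh
  have : ρ h ∈ T.map ψ := by
    rw [heq]
    exact ⟨h, hh, rfl⟩
  obtain ⟨w, -, hw⟩ := this
  rw [hψ, hρ, Prod.mk.injEq] at hw
  exact ⟨w, hw.1, by rw [hw.2]; ring⟩

lemma all_pairs (P : Fin 3 → Fin 3 → Prop) (hr : ∀ i, P i i) (hs : ∀ i j, P i j → P j i)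
    (h01 : P 0 1) (h02 : P 0 2) (h12 : P 1 2) : ∀ i j, P i j := by
  intro i j
  fin_cases i <;> fin_cases j
  · exact hr 0
  · exact h01
  · exact h02
  · exact hs _ _ h01
  · exact hr 1
  · exact h12
  · exact hs _ _ h02
  · exact hs _ _ h12
  · exact hr 2

end FreeJac

/-- Theorem, freeness criterion via the length of the Jacobian scheme:
let `f, g` be homogeneous of degree `n ≥ 1` generating a pencil with smooth base locus
(exactly `n²` distinct common zeros in `P²(k)`), all of whose members are squarefree
and some member of which is smooth.  For `k ≥ 2` distinct members with product `F` and
Jacobian ideal `J`, the module `T(F) = {v ∈ S³ : ⟨v, ∇F⟩ = 0}` is free with a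
homogeneous basis of degrees `2n−2` and `n(k−2)+1` if and only if the length of the
Jacobian scheme (the eventual dimension of the graded pieces of `S/J`) equals
`n²(k−1)² + 3(n−1)²`. -/
theorem free_iff_length_jacobian {k : Type*} [Field k] [IsAlgClosed k] [CharZero k]
    (n : ℕ) (hn : 1 ≤ n) (f g : MvPolynomial (Fin 3) k)
    (hf : f.IsHomogeneous n) (hg : g.IsHomogeneous n)
    (hbfin : {p : Projectivization k (Fin 3 → k) |
        eval p.rep f = 0 ∧ eval p.rep g = 0}.Finite)
    (hbcard : {p : Projectivization k (Fin 3 → k) |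
        eval p.rep f = 0 ∧ eval p.rep g = 0}.ncard = n ^ 2)
    (hred : ∀ α β : k, (α, β) ≠ (0, 0) → Squarefree (C α * f + C β * g))
    (hsm : ∃ α β : k, (α, β) ≠ (0, 0) ∧ ∀ p : Fin 3 → k, p ≠ 0 →
        ∃ i, eval p (grad (C α * f + C β * g) i) ≠ 0)
    (m : ℕ) (hm : 2 ≤ m) (α β : Fin m → k)
    (hnz : ∀ i, (α i, β i) ≠ (0, 0))
    (hdist : ∀ i j, i ≠ j → α i * β j - α j * β i ≠ 0)
    (F : MvPolynomial (Fin 3) k)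
    (hF : F = ∏ i, (C (α i) * f + C (β i) * g))
    (J : Ideal (MvPolynomial (Fin 3) k))
    (hJ : J = Ideal.span {pderiv (0 : Fin 3) F, pderiv (1 : Fin 3) F,
        pderiv (2 : Fin 3) F}) :
    ((∃ u v : Fin 3 → MvPolynomial (Fin 3) k,
        (∀ i, (u i).IsHomogeneous (2 * n - 2)) ∧
        (∀ i, (v i).IsHomogeneous (n * (m - 2) + 1)) ∧
        dot u (grad F) = 0 ∧ dot v (grad F) = 0 ∧
        ∀ w : Fin 3 → MvPolynomial (Fin 3) k, dot w (grad F) = 0 →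
          ∃! ab : MvPolynomial (Fin 3) k × MvPolynomial (Fin 3) k,
            w = fun i => ab.1 * u i + ab.2 * v i) ↔
      ∃ N : ℕ, ∀ d ≥ N,
        Module.finrank k
          (Submodule.map (Ideal.Quotient.mkₐ k J).toLinearMap
            (homogeneousSubmodule (Fin 3) k d)) =
          n ^ 2 * (m - 1) ^ 2 + 3 * (n - 1) ^ 2) := by
  obtain ⟨n', rfl⟩ : ∃ n', n = n' + 1 := ⟨n - 1, by omega⟩
  obtain ⟨m', rfl⟩ : ∃ m', m = m' + 2 := ⟨m - 2, by omega⟩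
  have ea : 2 * (n' + 1) - 2 = 2 * n' := by omega
  have eb : (n' + 1) * (m' + 2 - 2) + 1 = (n' + 1) * m' + 1 := by simp
  have er : (n' + 1) ^ 2 * (m' + 2 - 1) ^ 2 + 3 * (n' + 1 - 1) ^ 2 =
      (n' + 1) ^ 2 * (m' + 1) ^ 2 + 3 * n' ^ 2 := by simp
  rw [ea, eb, er]
  obtain ⟨a, ha⟩ : ∃ a, a = 2 * n' := ⟨_, rfl⟩
  obtain ⟨b, hb⟩ : ∃ b, b = (n' + 1) * m' + 1 := ⟨_, rfl⟩
  rw [← ha, ← hb]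
  have hL : ∀ i, (C (α i) * f + C (β i) * g).IsHomogeneous (n' + 1) := fun i =>
    (hf.C_mul _).add (hg.C_mul _)
  -- homogeneity of the gradients
  have hFh : F.IsHomogeneous (a + b + 1) := by
    have h1 := IsHomogeneous.prod Finset.univ (fun i => C (α i) * f + C (β i) * g)
      (fun _ => n' + 1) (fun i _ => hL i)
    rw [← hF] at h1
    convert h1 using 1
    rw [ha, hb]
    simp
    ring
  have hgF : ∀ i, (grad F i).IsHomogeneous (a + b) := fun i => hFh.pderiv
  have hgf : ∀ i, (grad f i).IsHomogeneous n' := fun i => hf.pderiv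
  have hgg : ∀ i, (grad g i).IsHomogeneous n' := fun i => hg.pderiv
  -- primitivity
  have hprim : ∀ h, Prime h → ¬ ∀ i, h ∣ cross (grad f) (grad g) i := by
    intro h hp hd
    refine FreeJac.cross_primitive (n' + 1) hn f g hf hg hred hsm h hp ?_
    have h0 : h ∣ grad f 1 * grad g 2 - grad f 2 * grad g 1 := hd 0
    have h1 : h ∣ grad f 2 * grad g 0 - grad f 0 * grad g 2 := hd 1
    have h2 : h ∣ grad f 0 * grad g 1 - grad f 1 * grad g 0 := hd 2
    simp only [grad] at h0 h1 h2
    refine FreeJac.all_pairs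
      (fun i j => h ∣ pderiv i f * pderiv j g - pderiv j f * pderiv i g) ?_ ?_ h2 ?_ h0
    · intro i
      simp
    · intro i j hij
      exact (dvd_sub_comm).1 hij
    · exact (dvd_sub_comm).1 h1
  have hu0 : ∃ i, cross (grad f) (grad g) i ≠ 0 := by
    by_contra hcon
    push Not at hcon
    exact hprim (X 0) X_prime fun i => by rw [hcon i]; exact dvd_zero _
  have huh : ∀ i, (cross (grad f) (grad g) i).IsHomogeneous a := by
    have hm2 : ∀ i j, (grad f i * grad g j).IsHomogeneous a := fun i j => by
      have := (hgf i).mul (hgg j)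
      rwa [← two_mul, ← ha] at this
    intro i
    fin_cases i
    · exact (hm2 1 2).sub (hm2 2 1)
    · exact (hm2 2 0).sub (hm2 0 2)
    · exact (hm2 0 1).sub (hm2 1 0)
  have huf : dot (cross (grad f) (grad g)) (grad f) = 0 := by
    simp [dot, cross]
    ring
  have hug : dot (cross (grad f) (grad g)) (grad g) = 0 := by
    simp [dot, cross]
    ring
  have hker : ∀ w, dot w (grad f) = 0 → dot w (grad g) = 0 →
      ∃ c, ∀ i, w i = c * cross (grad f) (grad g) i := by
    intro w hwf hwg
    refine FreeJac.proportional_of_primitive _ w hprim hu0 ?_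
    simp only [dot] at hwf hwg
    have h01 : w 0 * cross (grad f) (grad g) 1 = w 1 * cross (grad f) (grad g) 0 := by
      simp [cross]
      linear_combination (grad f 2) * hwg - (grad g 2) * hwf
    have h02 : w 0 * cross (grad f) (grad g) 2 = w 2 * cross (grad f) (grad g) 0 := by
      simp [cross]
      linear_combination (grad g 1) * hwf - (grad f 1) * hwg
    have h12 : w 1 * cross (grad f) (grad g) 2 = w 2 * cross (grad f) (grad g) 1 := by
      simp [cross]
      linear_combination (grad f 0) * hwg - (grad g 0) * hwf
    exact FreeJac.all_pairs
      (fun i j => w i * cross (grad f) (grad g) j = w j * cross (grad f) (grad g) i)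
      (fun _ => rfl) (fun _ _ hij => hij.symm) h01 h02 h12
  have hcop : ∀ h, Prime h → h ∣ f → h ∣ g → False := by
    rintro h hp ⟨q, rfl⟩ ⟨r, rfl⟩
    refine FreeJac.cross_primitive (n' + 1) hn _ _ hf hg hred hsm h hp ?_
    intro i j
    simp only [pderiv_mul]
    refine ⟨pderiv i h * q * pderiv j r + pderiv i q * pderiv j h * r
      + h * pderiv i q * pderiv j r - pderiv j h * q * pderiv i r - pderiv j q * pderiv i h * r
      - h * pderiv j q * pderiv i r, ?_⟩
    ring
  -- the two coefficients
  obtain ⟨A, hAdef⟩ : ∃ A, A = ∑ i, C (α i) *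
    ∏ j ∈ Finset.univ.erase i, (C (α j) * f + C (β j) * g) := ⟨_, rfl⟩
  obtain ⟨B, hBdef⟩ : ∃ B, B = ∑ i, C (β i) *
    ∏ j ∈ Finset.univ.erase i, (C (α j) * f + C (β j) * g) := ⟨_, rfl⟩
  have hnp := FreeJac.coeffs_relPrime f g hcop (m' + 2) hm α β hnz hdist
  rw [← hAdef, ← hBdef] at hnp
  have hABne : ¬ (A = 0 ∧ B = 0) := by
    rintro ⟨h1, h2⟩
    exact hnp (X 0) X_prime (by rw [h1]; exact dvd_zero _) (by rw [h2]; exact dvd_zero _)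
  have hAB0 : A ≠ 0 ∨ B ≠ 0 := by
    by_contra hcon
    push Not at hcon
    exact hABne hcon
  have hAB : IsRelPrime A B := WfDvdMonoid.isRelPrime_of_no_irreducible_factors hABne
    fun z hz h1 h2 => hnp z hz.prime h1 h2
  have hQ : ∀ i, (∏ j ∈ Finset.univ.erase i, (C (α j) * f + C (β j) * g)).IsHomogeneous
      (b + n') := by
    intro i
    have h1 := IsHomogeneous.prod (Finset.univ.erase i) (fun i => C (α i) * f + C (β i) * g)
      (fun _ => n' + 1) (fun i _ => hL i)
    convert h1 using 1
    rw [hb]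
    simp
    ring
  have hA : A.IsHomogeneous (b + n') := by
    rw [hAdef]
    exact IsHomogeneous.sum _ _ _ fun i _ => (hQ i).C_mul _
  have hB : B.IsHomogeneous (b + n') := by
    rw [hBdef]
    exact IsHomogeneous.sum _ _ _ fun i _ => (hQ i).C_mul _
  have hpF : ∀ w, dot w (grad F) = A * dot w (grad f) + B * dot w (grad g) := by
    intro w
    have h1 : ∀ l, grad F l = A * grad f l + B * grad g l := by
      intro l
      rw [hF, hAdef, hBdef]
      exact FreeJac.pderiv_prod f g (m' + 2) α β l
    simp only [dot, h1]
    ring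
  have hcq := fun t => FreeJac.count_quot (grad F) (a + b + t) (a + b) hgF J hJ
  constructor
  · rintro ⟨u, v, hu, hv, huF, hvF, hbas⟩
    refine ⟨a + b + (a + b), fun d hd => ?_⟩
    obtain ⟨t, rfl⟩ : ∃ t, d = a + b + t + (a + b) := ⟨d - (a + b + (a + b)), by omega⟩
    exact (FreeJac.numerics k n' m' t a b ha hb _ _ (hcq t)).2
      (FreeJac.count_free (grad F) u v a b t hu hv huF hvF hbas)
  · rintro ⟨N, hN⟩
    have hcount := (FreeJac.numerics k n' m' N a b ha hb _ _ (hcq N)).1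
      (hN (a + b + N + (a + b)) (by omega))
    have hsurj := FreeJac.surj_of_count (grad F) (grad f) (grad g) _ A B a b N n' huh hu0 huf hug
      hgf hgg hA hB hAB hAB0 hpF hker hcount
    obtain ⟨v, hvf, hvg⟩ := FreeJac.koszul_lift (a + N) (grad f) (grad g) _ A B hu0 huf hug hker
      fun i => hsurj _ (isHomogeneous_X_pow i (a + N))
    have hv'f : dot (fun i => homogeneousComponent b (v i)) (grad f) = B := by
      rw [FreeJac.dot_comp _ _ _ _ hgf, hvf, homogeneousComponent_eq_self hB]
    have hv'g : dot (fun i => homogeneousComponent b (v i)) (grad g) = -A := by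
      rw [FreeJac.dot_comp _ _ _ _ hgg, hvg, homogeneousComponent_eq_self hA.neg]
    obtain ⟨v', hv'⟩ : ∃ v' : Fin 3 → MvPolynomial (Fin 3) k,
      v' = fun i => homogeneousComponent b (v i) := ⟨_, rfl⟩
    rw [← hv'] at hv'f hv'g
    obtain ⟨u, hu⟩ : ∃ u, u = cross (grad f) (grad g) := ⟨_, rfl⟩
    rw [← hu] at huf hug hker huh hu0
    refine ⟨u, v', huh, fun i => ?_, ?_, ?_, ?_⟩
    · rw [hv']
      exact homogeneousComponent_isHomogeneous _ _
    · rw [hpF, huf, hug]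
      ring
    · rw [hpF, hv'f, hv'g]
      ring
    · intro w hw
      rw [hpF] at hw
      obtain ⟨y, hy1, hy2⟩ := FreeJac.relPrime_syz A B _ _ hAB hw
      obtain ⟨x, hx⟩ := hker (fun i => w i - y * v' i)
        (by
          simp only [dot] at hy1 hv'f ⊢
          linear_combination hy1 - y * hv'f)
        (by
          simp only [dot] at hy2 hv'g ⊢
          linear_combination hy2 - y * hv'g)
      refine ⟨(x, y), ?_, ?_⟩
      · funext i
        simp only
        linear_combination hx i
      · rintro ⟨x', y'⟩ hw'
        simp only at hw'
        have hy' : y' = y := by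
          have e1 : dot w (grad f) = y' * B := by
            rw [hw']
            simp only [dot] at huf hv'f ⊢
            linear_combination x' * huf + y' * hv'f
          have e2 : dot w (grad g) = -(y' * A) := by
            rw [hw']
            simp only [dot] at hug hv'g ⊢
            linear_combination x' * hug + y' * hv'g
          rcases hAB0 with h0 | h0
          · apply mul_right_cancel₀ h0
            linear_combination e2 - hy2
          · apply mul_right_cancel₀ h0
            linear_combination hy1 - e1
        obtain ⟨i, hi⟩ := hu0
        have hx' : x' = x := by
          apply mul_right_cancel₀ hi
          have e3 := congrFun hw' i
          rw [hy'] at e3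
          linear_combination hx i - e3
        rw [hx', hy']
end

section
/- Let k be an algebraically closed field of characteristic zero, S = k[x,y,z], n ≥ 2, and let f, g be homogeneous of degree n generating a pencil whose base locus is smooth (the common zeros of f and g in P²(k) are exactly n² distinct points) and in which every member αf + βg is squarefree and some member is smooth (has no zero of its gradient in k³ ∖ {0}). Then the union of any two distinct members of the pencil is never free: for any (α₁:β₁) ≠ (α₂:β₂) in P¹(k), setting F = (α₁f + β₁g)(α₂f + β₂g), the S-module T(F) = {v ∈ S³ : ⟨v, ∇F⟩ = 0} is not a free S-module. -/
open MvPolynomial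

/-- The graded module `T(F) = {v ∈ S³ : ⟨v, ∇F⟩ = 0}` of vector fields tangent to
`{F = 0}`, as a submodule of `S³`. -/
noncomputable def tangentModule {k : Type*} [CommRing k] (F : MvPolynomial (Fin 3) k) :
    Submodule (MvPolynomial (Fin 3) k) (Fin 3 → MvPolynomial (Fin 3) k) where
  carrier := {v | dot v (grad F) = 0}
  add_mem' := by
    intro a b ha hb
    simp only [Set.mem_setOf_eq, dot, Pi.add_apply] at *
    linear_combination ha + hb
  zero_mem' := by simp [dot]
  smul_mem' := by
    intro c v hv
    simp only [Set.mem_setOf_eq, dot, Pi.smul_apply, smul_eq_mul] at *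
    linear_combination c * hv



/-- Degree `t` part of the polynomial ring. -/
noncomputable abbrev Hs (k : Type*) [Field k] (t : ℕ) : Submodule k (MvPolynomial (Fin 3) k) :=
  homogeneousSubmodule (Fin 3) k t

section basics
variable {k : Type*} [Field k]

instance Hs_fin (t : ℕ) : FiniteDimensional k (Hs k t) :=
  Module.Finite.iff_fg.mpr (homogeneousSubmodule_fg (Fin 3) k t)

lemma hcomp_mul {a b : MvPolynomial (Fin 3) k} {j : ℕ} (hb : b.IsHomogeneous j) (i : ℕ) :
    homogeneousComponent (i + j) (a * b) = homogeneousComponent i a * b := by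
  let := MvPolynomial.gradedAlgebra (σ := Fin 3) (R := k)
  have := DirectSum.coe_decompose_mul_add_of_right_mem (homogeneousSubmodule (Fin 3) k)
    (i := i) (a := a) (b := b) (j := j) hb
  have e : ∀ (φ : MvPolynomial (Fin 3) k) (i : ℕ),
      ((DirectSum.decompose (homogeneousSubmodule (Fin 3) k) φ i : _) : MvPolynomial (Fin 3) k)
        = homogeneousComponent i φ := fun φ i => decomposition.decompose'_apply φ i
  rwa [e, e] at this

lemma homog_of_mul {W B : MvPolynomial (Fin 3) k} {t b : ℕ} (hB : B.IsHomogeneous b) (h0 : B ≠ 0)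
    (h : (W * B).IsHomogeneous (t + b)) : W.IsHomogeneous t := by
  have h1 := hcomp_mul (a := W) hB t
  rw [homogeneousComponent_of_mem (m := t + b) (n := t + b) h, if_pos rfl] at h1
  have := mul_right_cancel₀ h0 h1
  rw [this]
  exact homogeneousComponent_isHomogeneous t W

lemma hdim (t : ℕ) : 2 * Module.finrank k (Hs k t) = (t + 1) * (t + 2) := by
  have h1 : Module.finrank k (Hs k t) = (Finset.univ.finsuppAntidiag t : Finset (Fin 3 →₀ ℕ)).card := by
    have hs : {d : Fin 3 →₀ ℕ | d.degree = t} =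
        ((Finset.univ.finsuppAntidiag t : Finset (Fin 3 →₀ ℕ)) : Set (Fin 3 →₀ ℕ)) := by
      ext d
      simp [Finsupp.degree_eq_sum]
    rw [Hs, homogeneousSubmodule_eq_finsupp_supported, hs,
      (AddMonoidAlgebra.supportedEquivFinsupp (R := k) (S := k) _).finrank_eq]
    simp
  rw [h1, Finset.card_finsuppAntidiag_nat_eq_choose]
  have h2 : (Finset.univ : Finset (Fin 3)).card + t - 1 = t + 2 := by simp; omega
  rw [h2, Nat.choose_symm_add, Nat.choose_two_right, Nat.mul_div_cancel']
  · simp; ring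
  · simpa using (Nat.even_mul_pred_self (t+2)).two_dvd

/-- `A · U`. -/
noncomputable abbrev mulS (A : MvPolynomial (Fin 3) k) (U : Submodule k (MvPolynomial (Fin 3) k)) :
    Submodule k (MvPolynomial (Fin 3) k) := U.map (LinearMap.mulLeft k A)

lemma mem_mulS {A x : MvPolynomial (Fin 3) k} {U : Submodule k (MvPolynomial (Fin 3) k)} :
    x ∈ mulS A U ↔ ∃ u ∈ U, A * u = x := by
  simp [mulS]

lemma finrank_mulS {A : MvPolynomial (Fin 3) k} (hA : A ≠ 0)
    (U : Submodule k (MvPolynomial (Fin 3) k)) :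
    Module.finrank k (mulS A U) = Module.finrank k U := by
  have hinj : Function.Injective (LinearMap.mulLeft k A) := fun x y h => by
    simpa [hA] using h
  exact (Submodule.equivMapOfInjective _ hinj U).finrank_eq.symm

lemma key {A : MvPolynomial (Fin 3) k} (hA : A ≠ 0)
    (V I' : Submodule k (MvPolynomial (Fin 3) k)) [FiniteDimensional k V]
    (s : ℕ) (hI : I' ≤ Hs k s) (hAI : mulS A I' ≤ V) :
    Module.finrank k (V ⊔ mulS A (Hs k s) : Submodule k _) + Module.finrank k I' ≤
      Module.finrank k V + Module.finrank k (Hs k s) := by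
  have : FiniteDimensional k I' := Submodule.finiteDimensional_of_le hI
  have h0 := Submodule.finrank_sup_add_finrank_inf_eq V (mulS A (Hs k s))
  rw [finrank_mulS hA (Hs k s)] at h0
  have h2 := finrank_mulS hA I'
  have : mulS A I' ≤ V ⊓ mulS A (Hs k s) := le_inf hAI (Submodule.map_mono hI)
  have := Submodule.finrank_mono this
  omega

lemma two_gen {A B : MvPolynomial (Fin 3) k} (hA0 : A ≠ 0) (hB0 : B ≠ 0) {a b : ℕ}
    (hB : B.IsHomogeneous b) (hAB : IsRelPrime A B) (t : ℕ) :
    Module.finrank k (Hs k (t + a + b)) ≤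
    Module.finrank k (mulS A (Hs k (t + b)) ⊔ mulS B (Hs k (t + a)) : Submodule k _) + a * b := by
  have h1 := Submodule.finrank_sup_add_finrank_inf_eq (mulS A (Hs k (t + b))) (mulS B (Hs k (t + a)))
  rw [finrank_mulS hA0, finrank_mulS hB0] at h1
  have h2 : mulS A (Hs k (t + b)) ⊓ mulS B (Hs k (t + a)) ≤ mulS (A * B) (Hs k t) := by
    rintro x ⟨hx1, hx2⟩
    obtain ⟨u, hu, rfl⟩ := mem_mulS.1 hx1
    obtain ⟨v, hv, hv2⟩ := mem_mulS.1 hx2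
    have : B ∣ u := by
      have : B ∣ A * u := ⟨v, hv2.symm⟩
      exact hAB.symm.dvd_of_dvd_mul_left this
    obtain ⟨w, rfl⟩ := this
    refine mem_mulS.2 ⟨w, ?_, by ring⟩
    have hu' : (B * w).IsHomogeneous (t + b) := hu
    rw [mul_comm] at hu'
    exact homog_of_mul hB hB0 hu'
  have h3 := Submodule.finrank_mono h2
  rw [finrank_mulS (mul_ne_zero hA0 hB0)] at h3
  have e1 := hdim (k := k) (t + a + b)
  have e2 := hdim (k := k) (t + a)
  have e3 := hdim (k := k) (t + b)
  have e4 := hdim (k := k) t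
  nlinarith

end basics


section squarefree
variable {k : Type*} [Field k]

lemma totalDegree_pderiv_lt {p : MvPolynomial (Fin 3) k} {i : Fin 3} (h : pderiv i p ≠ 0) :
    (pderiv i p).totalDegree < p.totalDegree := by
  obtain ⟨m, hm, hm2⟩ := (pderiv i p).support.exists_mem_eq_sup
    (support_nonempty.2 h) (fun s => s.sum fun _ e => e)
  have hm3 : (pderiv i p).totalDegree = m.sum fun _ e => e := hm2
  rw [hm3]
  have hc := mem_support_iff.1 hm
  rw [coeff_pderiv] at hc
  have hc' : m + Finsupp.single i 1 ∈ p.support := mem_support_iff.2 (left_ne_zero_of_mul hc)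
  have := le_totalDegree hc'
  rw [Finsupp.sum_add_index' (by simp) (by simp)] at this
  simp at this
  omega

lemma eq_C_of_pderiv_zero [CharZero k] {p : MvPolynomial (Fin 3) k} (h : ∀ i, pderiv i p = 0) :
    p = C (coeff 0 p) := by
  ext m
  rw [coeff_C]
  split_ifs with h0
  · rw [h0]
  · obtain ⟨i, hi⟩ : ∃ i, m i ≠ 0 := by
      by_contra! hh
      exact h0 (Finsupp.ext (by simpa using hh)).symm
    have h1 := congrArg (coeff (m - Finsupp.single i 1)) (h i)
    rw [coeff_pderiv, tsub_add_cancel_of_le (by simpa using Nat.one_le_iff_ne_zero.2 hi)] at h1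
    rw [coeff_zero, mul_eq_zero] at h1
    rcases h1 with h1 | h1
    · exact h1
    · exact absurd h1 (Nat.cast_add_one_ne_zero _)

lemma euler {P : MvPolynomial (Fin 3) k} {n : ℕ} (hP : P.IsHomogeneous n) :
    X 0 * pderiv 0 P + X 1 * pderiv 1 P + X 2 * pderiv 2 P = C (n : k) * P := by
  have := hP.sum_X_mul_pderiv
  rw [Fin.sum_univ_three] at this
  rw [this]; simp

lemma grad_coprime [CharZero k] {F : MvPolynomial (Fin 3) k} {n : ℕ} (hn : n ≠ 0)
    (hF : F.IsHomogeneous n) (hsq : Squarefree F) (D : MvPolynomial (Fin 3) k)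
    (hD : ∀ i, D ∣ pderiv i F) : IsUnit D := by
  have hnk : (n : k) ≠ 0 := by exact_mod_cast hn
  have hDF : ∀ D : MvPolynomial (Fin 3) k, (∀ i, D ∣ pderiv i F) → D ∣ F := by
    intro D hD
    have h1 : D ∣ C (n : k) * F := by
      rw [← euler hF]
      exact dvd_add (dvd_add ((hD 0).mul_left _) ((hD 1).mul_left _)) ((hD 2).mul_left _)
    have h2 := h1.mul_left (C (n : k)⁻¹)
    rwa [← mul_assoc, ← C_mul, inv_mul_cancel₀ hnk, C_1, one_mul] at h2
  have hF0 : F ≠ 0 := hsq.ne_zero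
  by_contra hu
  have hD0 : D ≠ 0 := by
    rintro rfl
    exact hF0 (zero_dvd_iff.1 (hDF 0 hD))
  obtain ⟨π, hπ, hπD⟩ := WfDvdMonoid.exists_irreducible_factor hu hD0
  have hπi : ∀ i, π ∣ pderiv i F := fun i => hπD.trans (hD i)
  obtain ⟨G, rfl⟩ := hDF π hπi
  have hπG : ¬ π ∣ G := by
    rintro ⟨G', rfl⟩
    exact hπ.not_isUnit (hsq π ⟨G', by ring⟩)
  have hz : ∀ i, pderiv i π = 0 := by
    intro i
    have h1 := hπi i
    rw [pderiv_mul, dvd_add_left (Dvd.intro _ rfl)] at h1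
    have h2 := (hπ.prime.dvd_or_dvd h1).resolve_right hπG
    by_contra h3
    have := totalDegree_pderiv_lt h3
    have := totalDegree_le_of_dvd_of_isDomain h2 h3
    omega
  have h4 := eq_C_of_pderiv_zero hz
  apply hπ.not_isUnit
  rw [h4]
  apply IsUnit.map
  rw [isUnit_iff_ne_zero]
  intro h5
  rw [h5, C_0] at h4
  exact hπ.ne_zero h4

lemma exists_coprime [Infinite k] {A B B' : MvPolynomial (Fin 3) k} (hA : A ≠ 0)
    (h : ∀ D, D ∣ A → D ∣ B → D ∣ B' → IsUnit D) : ∃ s : k, IsRelPrime A (B + C s * B') := by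
  classical
  let bad : MvPolynomial (Fin 3) k → Set k := fun π => {s | π ∣ B + C s * B'}
  have hfin : (⋃ π ∈ (UniqueFactorizationMonoid.factors A).toFinset, bad π).Finite := by
    refine Set.Finite.biUnion (Finset.finite_toSet _) ?_
    intro π hπ
    have hπ' : π ∈ UniqueFactorizationMonoid.factors A := by simpa using hπ
    have hirr := UniqueFactorizationMonoid.irreducible_of_factor π hπ'
    have hdvd := UniqueFactorizationMonoid.dvd_of_mem_factors hπ'
    apply Set.Subsingleton.finite
    intro s hs s' hs'
    have hs : π ∣ B + C s * B' := hs
    have hs' : π ∣ B + C s' * B' := hs'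
    by_contra hne
    have h1 : π ∣ C (s - s')⁻¹ * ((B + C s * B') - (B + C s' * B')) := (dvd_sub hs hs').mul_left _
    have h2 : C (s - s')⁻¹ * ((B + C s * B') - (B + C s' * B')) = B' := by
      have : (C (s - s')⁻¹ * C (s - s') : MvPolynomial (Fin 3) k) = 1 := by
        rw [← C_mul, inv_mul_cancel₀ (sub_ne_zero.2 hne), C_1]
      rw [C_sub] at this
      linear_combination B' * this
    rw [h2] at h1
    have h3 : π ∣ B := (dvd_add_left (h1.mul_left _)).1 hs
    exact hirr.not_isUnit (h π hdvd h3 h1)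
  obtain ⟨s, hs⟩ := hfin.exists_notMem
  refine ⟨s, ?_⟩
  intro d hd1 hd2
  by_contra hu
  have hd0 : d ≠ 0 := by rintro rfl; exact hA (zero_dvd_iff.1 hd1)
  obtain ⟨π, hπ, hπd⟩ := WfDvdMonoid.exists_irreducible_factor hu hd0
  obtain ⟨q, hq, hq2⟩ := UniqueFactorizationMonoid.exists_mem_factors_of_dvd hA hπ (hπd.trans hd1)
  apply hs
  simp only [Set.mem_iUnion]
  exact ⟨q, by simpa using hq, hq2.symm.dvd.trans (hπd.trans hd2)⟩

lemma three_gen_aux [Infinite k] {A B B' : MvPolynomial (Fin 3) k} (hA0 : A ≠ 0) {m : ℕ}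
    (hm : m ≠ 0)
    (hA : A.IsHomogeneous m) (hB : B.IsHomogeneous m) (hB' : B'.IsHomogeneous m)
    (h : ∀ D, D ∣ A → D ∣ B → D ∣ B' → IsUnit D) (t : ℕ)
    (V : Submodule k (MvPolynomial (Fin 3) k)) [FiniteDimensional k V]
    (hVA : mulS A (Hs k (t + m)) ≤ V) (hVB : mulS B (Hs k (t + m)) ≤ V)
    (hVB' : mulS B' (Hs k (t + m)) ≤ V) :
    Module.finrank k (Hs k (t + m + m)) ≤ Module.finrank k V + m * m := by
  obtain ⟨s, hs⟩ := exists_coprime hA0 h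
  have h0 : B + C s * B' ≠ 0 := by
    intro h0
    rw [h0] at hs
    have hu : IsUnit A := hs dvd_rfl (dvd_zero _)
    have h1 := hA.totalDegree hA0
    obtain ⟨c, hc⟩ := hu.dvd (a := (1 : MvPolynomial (Fin 3) k))
    have := totalDegree_le_of_dvd_of_isDomain ⟨c, hc⟩ one_ne_zero
    rw [totalDegree_one] at this
    omega
  have hom : (B + C s * B').IsHomogeneous m := hB.add (hB'.C_mul s)
  have h2 := two_gen hA0 h0 (a := m) hom hs t
  have h3 : mulS A (Hs k (t + m)) ⊔ mulS (B + C s * B') (Hs k (t + m)) ≤ V := by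
    refine sup_le hVA ?_
    intro x hx
    obtain ⟨u, hu, rfl⟩ := mem_mulS.1 hx
    rw [add_mul]
    refine V.add_mem (hVB (mem_mulS.2 ⟨u, hu, rfl⟩)) ?_
    have := V.smul_mem s (hVB' (mem_mulS.2 ⟨u, hu, rfl⟩))
    rwa [smul_eq_C_mul, ← mul_assoc] at this
  have h4 := Submodule.finrank_mono h3
  omega

lemma three_gen [Infinite k] {G : Fin 3 → MvPolynomial (Fin 3) k} {m : ℕ} (hm : m ≠ 0)
    (hG : ∀ i, (G i).IsHomogeneous m)
    (h : ∀ D, (∀ i, D ∣ G i) → IsUnit D) (t : ℕ)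
    (V : Submodule k (MvPolynomial (Fin 3) k)) [FiniteDimensional k V]
    (hV : ∀ i, mulS (G i) (Hs k (t + m)) ≤ V) :
    Module.finrank k (Hs k (t + m + m)) ≤ Module.finrank k V + m * m := by
  obtain ⟨i, hi⟩ : ∃ i, G i ≠ 0 := by
    by_contra! hh
    exact not_isUnit_zero (h 0 (fun i => by rw [hh i]))
  fin_cases i
  · exact three_gen_aux hi hm (hG 0) (hG 1) (hG 2)
      (fun D h0 h1 h2 => h D (fun i => by fin_cases i <;> assumption)) t V (hV 0) (hV 1) (hV 2)
  · exact three_gen_aux hi hm (hG 1) (hG 0) (hG 2)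
      (fun D h0 h1 h2 => h D (fun i => by fin_cases i <;> assumption)) t V (hV 1) (hV 0) (hV 2)
  · exact three_gen_aux hi hm (hG 2) (hG 1) (hG 0)
      (fun D h0 h1 h2 => h D (fun i => by fin_cases i <;> assumption)) t V (hV 2) (hV 1) (hV 0)

end squarefree


section freeside
variable {k : Type*} [Field k]

lemma dvd_of_dvd_mul_all {G : Fin 3 → MvPolynomial (Fin 3) k}
    (h : ∀ D, (∀ i, D ∣ G i) → IsUnit D) {a c : MvPolynomial (Fin 3) k}
    (ha : ∀ i, a ∣ c * G i) : a ∣ c := by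
  classical
  let := UniqueFactorizationMonoid.toGCDMonoid (MvPolynomial (Fin 3) k)
  have h1 : a ∣ gcd (c * G 0) (gcd (c * G 1) (c * G 2)) :=
    dvd_gcd (ha 0) (dvd_gcd (ha 1) (ha 2))
  have h2 : gcd (c * G 0) (gcd (c * G 1) (c * G 2)) ∣ c * gcd (G 0) (gcd (G 1) (G 2)) := by
    refine (gcd_dvd_gcd dvd_rfl (gcd_mul_left' c (G 1) (G 2)).dvd).trans ?_
    exact (gcd_mul_left' c _ _).dvd
  have h3 : IsUnit (gcd (G 0) (gcd (G 1) (G 2))) := by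
    apply h
    intro i
    fin_cases i
    · exact gcd_dvd_left _ _
    · exact (gcd_dvd_right _ _).trans (gcd_dvd_left _ _)
    · exact (gcd_dvd_right _ _).trans (gcd_dvd_right _ _)
  exact (h3.dvd_mul_right).1 (h1.trans h2)

lemma mem_tangent {F : MvPolynomial (Fin 3) k} {v : Fin 3 → MvPolynomial (Fin 3) k} :
    v ∈ tangentModule F ↔ v 0 * pderiv 0 F + v 1 * pderiv 1 F + v 2 * pderiv 2 F = 0 := Iff.rfl

lemma tangent_finrank {F : MvPolynomial (Fin 3) k} {i0 : Fin 3} (hi : pderiv i0 F ≠ 0) :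
    Module.finrank (MvPolynomial (Fin 3) k) (tangentModule F) = 2 := by
  let S := MvPolynomial (Fin 3) k
  let φ : (Fin 3 → S) →ₗ[S] S :=
    { toFun := fun v => v 0 * pderiv 0 F + v 1 * pderiv 1 F + v 2 * pderiv 2 F
      map_add' := by intro x y; simp; ring
      map_smul' := by intro x y; simp; ring }
  have hker : LinearMap.ker φ = tangentModule F := by
    ext v; rfl
  have h := LinearMap.rank_range_add_rank_ker φ
  rw [hker, rank_fun', ← Module.finrank_eq_rank, ← Module.finrank_eq_rank] at h
  have h1 : Module.finrank S (LinearMap.range φ) ≤ 1 := by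
    have := Submodule.finrank_le (LinearMap.range φ)
    rwa [Module.finrank_self] at this
  have h2 : 0 < Module.finrank S (LinearMap.range φ) := by
    rw [Module.finrank_pos_iff]
    refine ⟨⟨⟨pderiv i0 F, ?_⟩, 0, ?_⟩⟩
    · refine ⟨Pi.single i0 1, ?_⟩
      fin_cases i0 <;> simp [φ]
    · intro h; exact hi (congrArg Subtype.val h)
  have h3 : Module.finrank S (LinearMap.range φ) + Module.finrank S (tangentModule F) = 3 := by
    exact_mod_cast h
  change Module.finrank S (tangentModule F) = 2
  omega

set_option maxHeartbeats 1000000 in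
lemma free_gens [CharZero k] {F : MvPolynomial (Fin 3) k} {N : ℕ} (hN : N ≠ 0)
    (hF : F.IsHomogeneous N) (hsq : Squarefree F)
    (hfree : Module.Free (MvPolynomial (Fin 3) k) (tangentModule F)) :
    ∃ (i j : ℕ) (v w : Fin 3 → MvPolynomial (Fin 3) k), i + j = N - 1 ∧
      (∀ l, (v l).IsHomogeneous i) ∧ (∀ l, (w l).IsHomogeneous j) ∧
      v ∈ tangentModule F ∧ w ∈ tangentModule F ∧ ∃ a b, v a * w b - v b * w a ≠ 0 := by
  have hcop := grad_coprime hN hF hsq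
  obtain ⟨i0, hi0⟩ : ∃ i, pderiv i F ≠ 0 := by
    by_contra! hh
    exact not_isUnit_zero (hcop 0 (fun i => by rw [hh i]))
  let b := Module.finBasisOfFinrankEq (MvPolynomial (Fin 3) k) (tangentModule F)
    (tangent_finrank hi0)
  obtain ⟨p, hpT, hpe⟩ : ∃ p : Fin 3 → MvPolynomial (Fin 3) k, p ∈ tangentModule F ∧
    p = (b 0).1 := ⟨_, (b 0).2, rfl⟩
  obtain ⟨q, hqT, hqe⟩ : ∃ p : Fin 3 → MvPolynomial (Fin 3) k, p ∈ tangentModule F ∧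
    p = (b 1).1 := ⟨_, (b 1).2, rfl⟩
  have hspan : ∀ x ∈ tangentModule F, ∃ α β, ∀ l, x l = α * p l + β * q l := by
    intro x hx
    have := b.sum_repr ⟨x, hx⟩
    rw [Fin.sum_univ_two] at this
    refine ⟨b.repr ⟨x, hx⟩ 0, b.repr ⟨x, hx⟩ 1, fun l => ?_⟩
    have h2 := congrFun (congrArg Subtype.val this) l
    rw [hpe, hqe]
    exact h2.symm
  have hp' := mem_tangent.1 hpT
  have hq' := mem_tangent.1 hqT
  have hcr : ∀ x ∈ tangentModule F, ∀ y ∈ tangentModule F, ∃ d, ∀ l,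
      cross x y l = d * cross p q l := by
    intro x hx y hy
    obtain ⟨α, β, h1⟩ := hspan x hx
    obtain ⟨γ, δ, h2⟩ := hspan y hy
    refine ⟨α * δ - β * γ, fun l => ?_⟩
    fin_cases l <;> simp [cross, h1, h2] <;> ring
  have e01 : cross p q 0 * pderiv 1 F = cross p q 1 * pderiv 0 F := by
    simp only [cross]; simp; linear_combination q 2 * hp' - p 2 * hq'
  have e12 : cross p q 1 * pderiv 2 F = cross p q 2 * pderiv 1 F := by
    simp only [cross]; simp; linear_combination q 0 * hp' - p 0 * hq'
  have e20 : cross p q 2 * pderiv 0 F = cross p q 0 * pderiv 2 F := by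
    simp only [cross]; simp; linear_combination q 1 * hp' - p 1 * hq'
  have hpar : ∀ i j, cross p q i * pderiv j F = cross p q j * pderiv i F := by
    intro i j
    match i, j with
    | 0, 0 => rfl
    | 1, 1 => rfl
    | 2, 2 => rfl
    | 0, 1 => exact e01
    | 1, 0 => exact e01.symm
    | 1, 2 => exact e12
    | 2, 1 => exact e12.symm
    | 2, 0 => exact e20
    | 0, 2 => exact e20.symm
  obtain ⟨c, hc⟩ : pderiv i0 F ∣ cross p q i0 :=
    dvd_of_dvd_mul_all (G := fun i => pderiv i F) hcop
      (fun j => by rw [hpar i0 j]; exact Dvd.intro_left _ rfl)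
  have hc' : ∀ j, cross p q j = c * pderiv j F := by
    intro j
    apply mul_right_cancel₀ hi0
    rw [← hpar i0 j, hc]; ring
  have hcF : ∀ i, c ∣ pderiv i F := by
    intro i
    have hx : (![0, pderiv 2 F, - pderiv 1 F] : Fin 3 → MvPolynomial (Fin 3) k)
        ∈ tangentModule F := by
      rw [mem_tangent]; simp; ring
    have hy : (![- pderiv 2 F, 0, pderiv 0 F] : Fin 3 → MvPolynomial (Fin 3) k)
        ∈ tangentModule F := by
      rw [mem_tangent]; simp; ring
    have hz : (![pderiv 1 F, - pderiv 0 F, 0] : Fin 3 → MvPolynomial (Fin 3) k)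
        ∈ tangentModule F := by
      rw [mem_tangent]; simp; ring
    have hmain : ∀ x ∈ tangentModule F, ∀ y ∈ tangentModule F,
        cross x y i0 = pderiv i F * pderiv i0 F → c ∣ pderiv i F := by
      intro x hx y hy h
      obtain ⟨d, hd⟩ := hcr x hx y hy
      have h1 := hd i0
      rw [h, hc' i0] at h1
      refine ⟨d, mul_right_cancel₀ hi0 ?_⟩
      rw [h1]; ring
    fin_cases i
    · exact hmain _ hy _ hz (by fin_cases i0 <;> simp [cross] <;> ring)
    · exact hmain _ hz _ hx (by fin_cases i0 <;> simp [cross] <;> ring)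
    · exact hmain _ hx _ hy (by fin_cases i0 <;> simp [cross] <;> ring)
  obtain ⟨c0, hc0, rfl⟩ := (MvPolynomial.isUnit_iff_eq_C_of_isReduced).1 (hcop c hcF)
  have hKhom : (cross p q i0).IsHomogeneous (N - 1) := by
    rw [hc' i0]; exact (hF.pderiv).C_mul c0
  have hK0 : cross p q i0 ≠ 0 := by
    rw [hc' i0]
    exact mul_ne_zero (by simpa using hc0.ne_zero) hi0
  obtain ⟨a, b', hab⟩ : ∃ a b', cross p q i0 = p a * q b' - p b' * q a := by
    fin_cases i0
    · exact ⟨1, 2, by simp [cross]⟩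
    · exact ⟨2, 0, by simp [cross]⟩
    · exact ⟨0, 1, by simp [cross]⟩
  have hTcomp : ∀ x ∈ tangentModule F, ∀ i,
      (fun l => homogeneousComponent i (x l)) ∈ tangentModule F := by
    intro x hx i
    rw [mem_tangent] at hx ⊢
    have := congrArg (homogeneousComponent (i + (N - 1))) hx
    simpa only [map_add, hcomp_mul hF.pderiv, map_zero] using this
  by_contra hcon
  have hz : ∀ i j, i + j = N - 1 → homogeneousComponent i (p a) * homogeneousComponent j (q b')
      - homogeneousComponent i (p b') * homogeneousComponent j (q a) = 0 := by
    intro i j hij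
    by_contra hne
    exact hcon ⟨i, j, _, _, hij, fun l => homogeneousComponent_isHomogeneous i (p l),
      fun l => homogeneousComponent_isHomogeneous j (q l), hTcomp p hpT i, hTcomp q hqT j,
      a, b', hne⟩
  have hz' : ∀ i j, homogeneousComponent (N - 1)
      (homogeneousComponent i (p a) * homogeneousComponent j (q b')
      - homogeneousComponent i (p b') * homogeneousComponent j (q a)) = 0 := by
    intro i j
    by_cases hij : i + j = N - 1
    · rw [hz i j hij, map_zero]
    · have : (homogeneousComponent i (p a) * homogeneousComponent j (q b')
        - homogeneousComponent i (p b') * homogeneousComponent j (q a)).IsHomogeneous (i + j) :=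
        ((homogeneousComponent_isHomogeneous _ _).mul (homogeneousComponent_isHomogeneous _ _)).sub
        ((homogeneousComponent_isHomogeneous _ _).mul (homogeneousComponent_isHomogeneous _ _))
      rw [homogeneousComponent_of_mem this, if_neg (Ne.symm hij)]
  have hsum : ∀ x : MvPolynomial (Fin 3) k, ∀ M, x.totalDegree < M →
      ∑ i ∈ Finset.range M, homogeneousComponent i x = x := by
    intro x M hM
    conv_rhs => rw [← sum_homogeneousComponent x]
    symm
    apply Finset.sum_subset
    · intro i hi; simp at hi ⊢; omega
    · intro i _ hi
      apply homogeneousComponent_eq_zero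
      simp at hi; omega
  let M := (p a).totalDegree + (p b').totalDegree + (q a).totalDegree + (q b').totalDegree + 1
  apply hK0
  have h1 : cross p q i0 = ∑ i ∈ Finset.range M, ∑ j ∈ Finset.range M,
      (homogeneousComponent i (p a) * homogeneousComponent j (q b')
      - homogeneousComponent i (p b') * homogeneousComponent j (q a)) := by
    simp only [Finset.sum_sub_distrib, ← Finset.mul_sum, ← Finset.sum_mul]
    rw [hsum _ M (by omega), hsum _ M (by omega), hsum _ M (by omega), hsum _ M (by omega), hab]
  have h2 := homogeneousComponent_of_mem (m := N - 1) (n := N - 1) hKhom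
  rw [if_pos rfl] at h2
  rw [← h2, h1]
  simp only [map_sum, hz', Finset.sum_const_zero]

end freeside


section dims
variable {k : Type*} [Field k]

lemma exists_V {F : MvPolynomial (Fin 3) k} {i j e : ℕ} {v w : Fin 3 → MvPolynomial (Fin 3) k}
    (hv : ∀ l, (v l).IsHomogeneous i) (hw : ∀ l, (w l).IsHomogeneous j)
    (hvT : v ∈ tangentModule F) (hwT : w ∈ tangentModule F)
    (hvw : ∃ a b, v a * w b - v b * w a ≠ 0) :
    ∃ V : Submodule k (MvPolynomial (Fin 3) k), FiniteDimensional k V ∧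
      (∀ l, mulS (pderiv l F) (Hs k (e + i + j)) ≤ V) ∧
      Module.finrank k V + Module.finrank k (Hs k (e + j)) + Module.finrank k (Hs k (e + i)) ≤
        3 * Module.finrank k (Hs k (e + i + j)) := by
  let φ : (Fin 3 → Hs k (e + i + j)) →ₗ[k] MvPolynomial (Fin 3) k :=
    { toFun := fun u => (u 0).1 * pderiv 0 F + (u 1).1 * pderiv 1 F + (u 2).1 * pderiv 2 F
      map_add' := by intro x y; simp; ring
      map_smul' := by intro x y; simp [smul_eq_C_mul]; ring }
  have hmem : ∀ (A : Hs k (e + j)) (B : Hs k (e + i)) (l : Fin 3),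
      A.1 * v l + B.1 * w l ∈ Hs k (e + i + j) := by
    intro A B l
    refine Submodule.add_mem _ ?_ ?_
    · have h : (A.1 * v l).IsHomogeneous (e + j + i) := IsHomogeneous.mul A.2 (hv l)
      rw [show e + i + j = e + j + i by omega]; exact h
    · have h : (B.1 * w l).IsHomogeneous (e + i + j) := IsHomogeneous.mul B.2 (hw l)
      exact h
  let ψ : (Hs k (e + j) × Hs k (e + i)) →ₗ[k] (Fin 3 → Hs k (e + i + j)) :=
    { toFun := fun x l => ⟨x.1.1 * v l + x.2.1 * w l, hmem x.1 x.2 l⟩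
      map_add' := by intro x y; ext1 l; apply Subtype.ext; simp; ring
      map_smul' := by intro x y; ext1 l; apply Subtype.ext; simp [smul_eq_C_mul]; ring }
  have hψ : Function.Injective ψ := by
    rw [← LinearMap.ker_eq_bot, LinearMap.ker_eq_bot']
    rintro ⟨⟨A, hA⟩, ⟨B, hB⟩⟩ h
    have h' : ∀ l, A * v l + B * w l = 0 := fun l => congrArg Subtype.val (congrFun h l)
    obtain ⟨a, b, hab⟩ := hvw
    have hA0 : A = 0 := by
      have : A * (v a * w b - v b * w a) = 0 := by
        linear_combination w b * h' a - w a * h' b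
      exact (mul_eq_zero.1 this).resolve_right hab
    have hB0 : B = 0 := by
      have : B * (v a * w b - v b * w a) = 0 := by
        linear_combination v a * h' b - v b * h' a
      exact (mul_eq_zero.1 this).resolve_right hab
    subst hA0 hB0
    rfl
  refine ⟨LinearMap.range φ, inferInstance, ?_, ?_⟩
  · intro l x hx
    obtain ⟨u, hu, rfl⟩ := mem_mulS.1 hx
    refine ⟨Pi.single l ⟨u, hu⟩, ?_⟩
    fin_cases l <;> simp [φ, mul_comm]
  · have h1 := LinearMap.finrank_range_add_finrank_ker φ
    have h2 : LinearMap.range ψ ≤ LinearMap.ker φ := by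
      rintro _ ⟨⟨A, B⟩, rfl⟩
      rw [LinearMap.mem_ker]
      have e1 := mem_tangent.1 hvT
      have e2 := mem_tangent.1 hwT
      change (A.1 * v 0 + B.1 * w 0) * pderiv 0 F + (A.1 * v 1 + B.1 * w 1) * pderiv 1 F
        + (A.1 * v 2 + B.1 * w 2) * pderiv 2 F = 0
      linear_combination A.1 * e1 + B.1 * e2
    have h3 := Submodule.finrank_mono h2
    rw [LinearMap.finrank_range_of_inj hψ, Module.finrank_prod] at h3
    rw [Module.finrank_pi_fintype] at h1
    simp only [Finset.sum_const, Finset.card_univ, Fintype.card_fin, smul_eq_mul] at h1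
    omega

lemma mulS_le_Hs {A : MvPolynomial (Fin 3) k} {a t s : ℕ} (hA : A.IsHomogeneous a)
    (h : a + t = s) : mulS A (Hs k t) ≤ Hs k s := by
  intro x hx
  obtain ⟨u, hu, rfl⟩ := mem_mulS.1 hx
  subst h
  exact IsHomogeneous.mul hA hu

/-- Upper bound for the codimension of the Jacobian ideal. -/
lemma codim_bound [CharZero k] {P Q : MvPolynomial (Fin 3) k} {r e : ℕ} (hr : r ≠ 0)
    (hP : P.IsHomogeneous (r + 1)) (hQ : Q.IsHomogeneous (r + 1)) (hPs : Squarefree P)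
    (hQs : Squarefree Q) (hPQ : IsRelPrime P Q)
    (V : Submodule k (MvPolynomial (Fin 3) k)) [FiniteDimensional k V]
    (hV : ∀ l, mulS (pderiv l (P * Q)) (Hs k (e + r + r + 2)) ≤ V)
    (hsurj : Hs k (e + r + r + r + 2) ≤ mulS P (Hs k (e + r + r + 1)) ⊔
      mulS Q (Hs k (e + r + r + 1)) ⊔ ⨆ l, mulS (cross (grad P) (grad Q) l) (Hs k (e + r + 2))) :
    Module.finrank k (Hs k (e + r + r + r + r + 3)) ≤
      Module.finrank k V + (r + 1) * (r + 1) + 2 * (r * r) := by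
  have hP0 := hPs.ne_zero
  have hQ0 := hQs.ne_zero
  have hPi : ∀ l, (pderiv l P).IsHomogeneous r := fun l => by simpa using hP.pderiv (i := l)
  have hQi : ∀ l, (pderiv l Q).IsHomogeneous r := fun l => by simpa using hQ.pderiv (i := l)
  have hVm : ∀ l u, u ∈ Hs k (e + r + r + 2) → pderiv l (P * Q) * u ∈ V := fun l u hu =>
    hV l (mem_mulS.2 ⟨u, hu, rfl⟩)
  -- multiplication bookkeeping
  have hmul : ∀ {A B : MvPolynomial (Fin 3) k} {a b c : ℕ}, A.IsHomogeneous a → B ∈ Hs k b →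
      a + b = c → A * B ∈ Hs k c := by
    intro A B a b c hA hB h
    subst h
    exact IsHomogeneous.mul hA hB
  have hFV : ∀ u, u ∈ Hs k (e + r + r + 1) → P * Q * u ∈ V := by
    intro u hu
    have h1 := euler (hP.mul hQ)
    have hne : ((r + 1 + (r + 1) : ℕ) : k) ≠ 0 := by
      exact_mod_cast (by omega : r + 1 + (r + 1) ≠ 0)
    have h2 : P * Q * u = C ((r + 1 + (r + 1) : ℕ) : k)⁻¹ * (pderiv 0 (P * Q) * (X 0 * u)
        + pderiv 1 (P * Q) * (X 1 * u) + pderiv 2 (P * Q) * (X 2 * u)) := by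
      have h3 : (C ((r + 1 + (r + 1) : ℕ) : k)⁻¹ * C ((r + 1 + (r + 1) : ℕ) : k) :
          MvPolynomial (Fin 3) k) = 1 := by
        rw [← C_mul, inv_mul_cancel₀ hne, C_1]
      linear_combination (-C ((r + 1 + (r + 1) : ℕ) : k)⁻¹ * u) * h1 - P * Q * u * h3
    rw [h2, ← smul_eq_C_mul]
    refine V.smul_mem _ (V.add_mem (V.add_mem ?_ ?_) ?_) <;> apply hVm <;>
      exact hmul (isHomogeneous_X _ _) hu (by omega)
  set s := e + r + r + r + 2 with hs
  let I' : Submodule k (MvPolynomial (Fin 3) k) := Hs k s ⊓ V.comap (LinearMap.mulLeft k P)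
  have hI'mem : ∀ x, x ∈ I' ↔ x ∈ Hs k s ∧ P * x ∈ V := fun x => Iff.rfl
  have hI' : I' ≤ Hs k s := inf_le_left
  have : FiniteDimensional k I' := Submodule.finiteDimensional_of_le hI'
  have k1 := key hP0 V I' s hI' (by
    intro x hx
    obtain ⟨u, hu, rfl⟩ := mem_mulS.1 hx
    exact hu.2)
  -- step 2
  let I2 : Submodule k (MvPolynomial (Fin 3) k) := ⨆ l, mulS (pderiv l P) (Hs k (e + r + r + 2))
  have hI2 : I2 ≤ Hs k s := iSup_le fun l => mulS_le_Hs (hPi l) (by omega)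
  have : FiniteDimensional k I2 := Submodule.finiteDimensional_of_le hI2
  have k2 := key hQ0 (V ⊔ mulS P (Hs k s)) I2 s hI2 (by
    rw [mulS, Submodule.map_iSup]
    refine iSup_le fun l => ?_
    rintro x hx
    obtain ⟨y, hy, rfl⟩ := mem_mulS.1 hx
    obtain ⟨u, hu, rfl⟩ := mem_mulS.1 hy
    have : Q * (pderiv l P * u) = pderiv l (P * Q) * u + P * (- (pderiv l Q * u)) := by
      rw [pderiv_mul]; ring
    rw [this]
    refine Submodule.add_mem_sup (hVm l u hu) (mem_mulS.2 ⟨_, ?_, rfl⟩)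
    exact Submodule.neg_mem _ (hmul (hQi l) hu (by omega)))
  have k3 := two_gen hP0 hQ0 (a := r + 1) hQ hPQ (e + r + r + 1)
  have k4 := three_gen hr hPi (grad_coprime (by omega) hP hPs) (e + r + 2) I2 (fun l => by
    rw [show e + r + 2 + r = e + r + r + 2 by omega]
    exact le_iSup (fun l => mulS (pderiv l P) (Hs k (e + r + r + 2))) l)
  -- step 3
  let I3 : Submodule k (MvPolynomial (Fin 3) k) := ⨆ l, mulS (pderiv l Q) (Hs k (e + r + 1))
  have hI3 : I3 ≤ Hs k (e + r + r + 1) := iSup_le fun l => mulS_le_Hs (hQi l) (by omega)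
  have : FiniteDimensional k I3 := Submodule.finiteDimensional_of_le hI3
  have k5 := key hP0 I' I3 (e + r + r + 1) hI3 (by
    rw [mulS, Submodule.map_iSup]
    refine iSup_le fun l => ?_
    rintro x hx
    obtain ⟨y, hy, rfl⟩ := mem_mulS.1 hx
    obtain ⟨u, hu, rfl⟩ := mem_mulS.1 hy
    rw [hI'mem]
    refine ⟨hmul hP (hmul (hQi l) hu rfl) (by omega), ?_⟩
    have : P * (P * (pderiv l Q * u)) =
        pderiv l (P * Q) * (P * u) - P * Q * (pderiv l P * u) := by
      rw [pderiv_mul]; ring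
    rw [this]
    exact V.sub_mem (hVm l _ (hmul hP hu (by omega))) (hFV _ (hmul (hPi l) hu (by omega))))
  have k6 := three_gen hr hQi (grad_coprime (by omega) hQ hQs) (e + 1) I3 (fun l => by
    rw [show e + 1 + r = e + r + 1 by omega]
    exact le_iSup (fun l => mulS (pderiv l Q) (Hs k (e + r + 1))) l)
  have k7 : Module.finrank k (Hs k s) ≤
      Module.finrank k (I' ⊔ mulS P (Hs k (e + r + r + 1)) : Submodule k _) := by
    refine Submodule.finrank_mono (hsurj.trans (sup_le (sup_le le_sup_right ?_) (iSup_le ?_)))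
    · refine le_sup_of_le_left ?_
      intro x hx
      obtain ⟨u, hu, rfl⟩ := mem_mulS.1 hx
      rw [hI'mem]
      refine ⟨hmul hQ hu (by omega), ?_⟩
      rw [← mul_assoc]
      exact hFV u hu
    · intro l
      refine le_sup_of_le_left ?_
      intro x hx
      obtain ⟨u, hu, rfl⟩ := mem_mulS.1 hx
      rw [hI'mem]
      have haux : ∀ i j : Fin 3, (pderiv i P * pderiv j Q - pderiv j P * pderiv i Q) * u ∈ Hs k s ∧
          P * ((pderiv i P * pderiv j Q - pderiv j P * pderiv i Q) * u) ∈ V := by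
        intro i j
        constructor
        · exact hmul (((hPi i).mul (hQi j)).sub ((hPi j).mul (hQi i))) hu (by omega)
        · have : P * ((pderiv i P * pderiv j Q - pderiv j P * pderiv i Q) * u) =
              pderiv j (P * Q) * (pderiv i P * u) - pderiv i (P * Q) * (pderiv j P * u) := by
            rw [pderiv_mul, pderiv_mul]; ring
          rw [this]
          exact V.sub_mem (hVm _ _ (hmul (hPi i) hu (by omega)))
            (hVm _ _ (hmul (hPi j) hu (by omega)))
      fin_cases l
      · exact haux 1 2
      · exact haux 2 0
      · exact haux 0 1
  have k8 : Module.finrank k (mulS P (Hs k s) ⊔ mulS Q (Hs k s) : Submodule k _) ≤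
      Module.finrank k (V ⊔ mulS P (Hs k s) ⊔ mulS Q (Hs k s) : Submodule k _) :=
    Submodule.finrank_mono (sup_le_sup_right le_sup_right _)
  rw [show e + r + r + 1 + (r + 1) = s by omega, show s + (r + 1) = e + r + r + r + r + 3 by omega]
    at k3
  rw [show e + r + 2 + r + r = s by omega] at k4
  rw [show e + 1 + r + r = e + r + r + 1 by omega] at k6
  omega

end dims


section points
variable {k : Type*} [Field k]

lemma exists_sep {ι : Type*} [Fintype ι] [DecidableEq ι] (pt : ι → Fin 3 → k)
    (h0 : ∀ i, pt i ≠ 0)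
    (hnp : ∀ i j, i ≠ j → ∃ a b, pt i a * pt j b - pt i b * pt j a ≠ 0) (i : ι) (N : ℕ)
    (hN : Fintype.card ι ≤ N) :
    ∃ L : MvPolynomial (Fin 3) k, L.IsHomogeneous N ∧ eval (pt i) L ≠ 0 ∧
      ∀ j, j ≠ i → eval (pt j) L = 0 := by
  have hl : ∀ j, ∃ l : MvPolynomial (Fin 3) k, l.IsHomogeneous 1 ∧ (j ≠ i →
      eval (pt i) l ≠ 0 ∧ eval (pt j) l = 0) := by
    intro j
    by_cases hj : j = i
    · exact ⟨0, isHomogeneous_zero _ _ _, fun h => absurd hj h⟩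
    · obtain ⟨a, b, hab⟩ := hnp i j (Ne.symm hj)
      refine ⟨C (pt j b) * X a - C (pt j a) * X b,
        (isHomogeneous_C_mul_X _ _).sub (isHomogeneous_C_mul_X _ _), fun _ => ⟨?_, ?_⟩⟩
      · simp only [map_sub, map_mul, eval_C, eval_X]
        intro h; apply hab; linear_combination h
      · simp only [map_sub, map_mul, eval_C, eval_X]; ring
  choose l hl1 hl2 using hl
  obtain ⟨a, ha⟩ : ∃ a, pt i a ≠ 0 := Function.ne_iff.1 (h0 i)
  refine ⟨(∏ j ∈ Finset.univ.erase i, l j) * X a ^ (N - (Finset.univ.erase i).card), ?_, ?_, ?_⟩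
  · have h1 := IsHomogeneous.prod (Finset.univ.erase i) l (fun _ => 1) (fun j _ => hl1 j)
    have h2 := h1.mul (isHomogeneous_X_pow (R := k) a (N - (Finset.univ.erase i).card))
    have hc : (Finset.univ.erase i).card ≤ N :=
      (Finset.card_le_univ _).trans hN
    simp only [Finset.sum_const, smul_eq_mul, mul_one] at h2
    rwa [Nat.add_sub_cancel' hc] at h2
  · simp only [map_mul, map_prod, map_pow, eval_X]
    refine mul_ne_zero (Finset.prod_ne_zero_iff.2 fun j hj => ?_) (pow_ne_zero _ ha)
    exact (hl2 j (Finset.ne_of_mem_erase hj)).1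
  · intro j hj
    simp only [map_mul, map_prod]
    rw [Finset.prod_eq_zero (Finset.mem_erase.2 ⟨hj, Finset.mem_univ j⟩) (hl2 j hj).2, zero_mul]

lemma mem_of_vanish {ι : Type*} [Fintype ι] [DecidableEq ι] (pt : ι → Fin 3 → k)
    (h0 : ∀ i, pt i ≠ 0)
    (hnp : ∀ i j, i ≠ j → ∃ a b, pt i a * pt j b - pt i b * pt j a ≠ 0)
    {P Q : MvPolynomial (Fin 3) k} {n t : ℕ} (hcard : Fintype.card ι = n * n) (ht : n * n ≤ t)
    (hP : P.IsHomogeneous n) (hQ : Q.IsHomogeneous n) (hP0 : P ≠ 0) (hQ0 : Q ≠ 0)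
    (hPQ : IsRelPrime P Q) (hPz : ∀ i, eval (pt i) P = 0) (hQz : ∀ i, eval (pt i) Q = 0)
    (G : MvPolynomial (Fin 3) k) (hG : G.IsHomogeneous (t + n + n))
    (hGz : ∀ i, eval (pt i) G = 0) :
    G ∈ mulS P (Hs k (t + n)) ⊔ mulS Q (Hs k (t + n)) := by
  let ev : Hs k (t + n + n) →ₗ[k] (ι → k) :=
    { toFun := fun G i => eval (pt i) G.1
      map_add' := by intro x y; ext; simp
      map_smul' := by intro x y; ext; simp [smul_eq_C_mul] }
  choose L hL1 hL2 hL3 using fun i => exists_sep pt h0 hnp i (t + n + n) (by omega)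
  have hsurj : Function.Surjective ev := by
    intro y
    refine ⟨∑ i, (y i * (eval (pt i) (L i))⁻¹) • ⟨L i, hL1 i⟩, ?_⟩
    rw [map_sum]
    ext j
    rw [Finset.sum_apply, Finset.sum_eq_single j]
    · simp only [map_smul, Pi.smul_apply, smul_eq_mul]
      change y j * (eval (pt j) (L j))⁻¹ * eval (pt j) (L j) = y j
      rw [mul_assoc, inv_mul_cancel₀ (hL2 j), mul_one]
    · intro i _ hij
      simp only [map_smul, Pi.smul_apply, smul_eq_mul]
      change _ * eval (pt j) (L i) = 0
      rw [hL3 i j (Ne.symm hij), mul_zero]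
    · simp
  have h1 := LinearMap.finrank_range_add_finrank_ker ev
  rw [LinearMap.range_eq_top.2 hsurj, finrank_top, Module.finrank_fintype_fun_eq_card, hcard] at h1
  let Z : Submodule k (MvPolynomial (Fin 3) k) := (LinearMap.ker ev).map (Hs k (t + n + n)).subtype
  have hZ : Module.finrank k Z = Module.finrank k (LinearMap.ker ev) :=
    (Submodule.equivMapOfInjective _ (Submodule.subtype_injective _) _).finrank_eq.symm
  have hZmem : ∀ x, x ∈ Hs k (t + n + n) → (∀ i, eval (pt i) x = 0) → x ∈ Z := by
    intro x hx hx2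
    exact ⟨⟨x, hx⟩, funext hx2, rfl⟩
  have hKZ : mulS P (Hs k (t + n)) ⊔ mulS Q (Hs k (t + n)) ≤ Z := by
    refine sup_le ?_ ?_
    · intro x hx
      have hx1 := mulS_le_Hs hP (show n + (t + n) = t + n + n by omega) hx
      obtain ⟨u, hu, rfl⟩ := mem_mulS.1 hx
      exact hZmem _ hx1 (fun i => by simp [hPz])
    · intro x hx
      have hx1 := mulS_le_Hs hQ (show n + (t + n) = t + n + n by omega) hx
      obtain ⟨u, hu, rfl⟩ := mem_mulS.1 hx
      exact hZmem _ hx1 (fun i => by simp [hQz])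
  have h2 := two_gen hP0 hQ0 (a := n) hQ hPQ t
  have : FiniteDimensional k Z := inferInstance
  have h3 := Submodule.eq_of_le_of_finrank_le hKZ (by omega)
  rw [h3]
  exact hZmem G hG hGz

lemma transversal {ι : Type*} [Fintype ι] [DecidableEq ι] (pt : ι → Fin 3 → k)
    (h0 : ∀ i, pt i ≠ 0)
    (hnp : ∀ i j, i ≠ j → ∃ a b, pt i a * pt j b - pt i b * pt j a ≠ 0)
    {P Q : MvPolynomial (Fin 3) k} {n : ℕ} (hcard : Fintype.card ι = n * n)
    (hP : P.IsHomogeneous n) (hQ : Q.IsHomogeneous n) (hP0 : P ≠ 0) (hQ0 : Q ≠ 0)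
    (hPQ : IsRelPrime P Q) (hPz : ∀ i, eval (pt i) P = 0) (hQz : ∀ i, eval (pt i) Q = 0)
    (i : ι) : ∃ l, eval (pt i) (cross (grad P) (grad Q) l) ≠ 0 := by
  by_contra! hw
  set p := pt i with hp
  have hclaim : ∀ c : Fin 3 → k, c 0 * p 0 + c 1 * p 1 + c 2 * p 2 = 0 →
      ∃ α β : k, ∀ a, c a = α * eval p (pderiv a P) + β * eval p (pderiv a Q) := by
    intro c hc
    obtain ⟨L, hL1, hL2, hL3⟩ := exists_sep pt h0 hnp i (n * n + n + n) (by omega)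
    let ℓ : MvPolynomial (Fin 3) k := C (c 0) * X 0 + C (c 1) * X 1 + C (c 2) * X 2
    have hℓ : ℓ.IsHomogeneous 1 := ((isHomogeneous_C_mul_X _ _).add
      (isHomogeneous_C_mul_X _ _)).add (isHomogeneous_C_mul_X _ _)
    have hℓp : eval p ℓ = 0 := by simpa [ℓ] using hc
    have hmem := mem_of_vanish pt h0 hnp (t := n * n + 1) hcard (by omega) hP hQ hP0 hQ0 hPQ
      hPz hQz (ℓ * L) (by
        have := hℓ.mul hL1
        rwa [show 1 + (n * n + n + n) = n * n + 1 + n + n by omega] at this) (by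
        intro j
        rw [map_mul]
        by_cases hj : j = i
        · rw [hj, ← hp, hℓp, zero_mul]
        · rw [hL3 j hj, mul_zero])
    obtain ⟨x, hx, y, hy, hxy⟩ := Submodule.mem_sup.1 hmem
    obtain ⟨U, -, rfl⟩ := mem_mulS.1 hx
    obtain ⟨W, -, rfl⟩ := mem_mulS.1 hy
    refine ⟨eval p U / eval p L, eval p W / eval p L, fun a => ?_⟩
    have h1 := congrArg (fun G => eval p (pderiv a G)) hxy
    have hℓa : eval p (pderiv a ℓ) = c a := by
      fin_cases a <;> simp [ℓ, pderiv_X]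
    have hPp : eval p P = 0 := hPz i
    have hQp : eval p Q = 0 := hQz i
    simp only [map_add, pderiv_mul, map_mul, hPp, hQp, hℓp, hℓa] at h1
    have hLp : eval p L ≠ 0 := hL2
    field_simp
    linear_combination -h1
  have hmin : ∀ a b, eval p (pderiv a P) * eval p (pderiv b Q)
      - eval p (pderiv b P) * eval p (pderiv a Q) = 0 := by
    have e0 := hw 0
    have e1 := hw 1
    have e2 := hw 2
    simp [cross, grad] at e0 e1 e2
    intro a b
    match a, b with
    | 0, 0 => ring
    | 1, 1 => ring
    | 2, 2 => ring
    | 1, 2 => exact e0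
    | 2, 1 => linear_combination -e0
    | 2, 0 => exact e1
    | 0, 2 => linear_combination -e1
    | 0, 1 => exact e2
    | 1, 0 => linear_combination -e2
  have hmin2 : ∀ c d : Fin 3 → k, c 0 * p 0 + c 1 * p 1 + c 2 * p 2 = 0 →
      d 0 * p 0 + d 1 * p 1 + d 2 * p 2 = 0 → ∀ a b, c a * d b - c b * d a = 0 := by
    intro c d hc hd a b
    obtain ⟨α, β, h1⟩ := hclaim c hc
    obtain ⟨γ, δ, h2⟩ := hclaim d hd
    rw [h1 a, h1 b, h2 a, h2 b]
    linear_combination (α * δ - β * γ) * hmin a b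
  have hc1 := hmin2 ![0, p 2, - p 1] ![- p 2, 0, p 0] (by simp; ring) (by simp; ring) 0 1
  have hc2 := hmin2 ![- p 2, 0, p 0] ![p 1, - p 0, 0] (by simp; ring) (by simp; ring) 1 2
  have hc3 := hmin2 ![p 1, - p 0, 0] ![0, p 2, - p 1] (by simp; ring) (by simp; ring) 2 0
  simp at hc1 hc2 hc3
  apply h0 i
  funext a
  fin_cases a <;> simp <;> assumption

lemma surj_of_points {ι : Type*} [Fintype ι] [DecidableEq ι] (pt : ι → Fin 3 → k)
    (h0 : ∀ i, pt i ≠ 0)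
    (hnp : ∀ i j, i ≠ j → ∃ a b, pt i a * pt j b - pt i b * pt j a ≠ 0)
    {P Q : MvPolynomial (Fin 3) k} {r e : ℕ} (hcard : Fintype.card ι = (r + 1) * (r + 1))
    (he : (r + 1) * (r + 1) ≤ e)
    (hP : P.IsHomogeneous (r + 1)) (hQ : Q.IsHomogeneous (r + 1)) (hP0 : P ≠ 0) (hQ0 : Q ≠ 0)
    (hPQ : IsRelPrime P Q) (hPz : ∀ i, eval (pt i) P = 0) (hQz : ∀ i, eval (pt i) Q = 0) :
    Hs k (e + r + r + r + 2) ≤ mulS P (Hs k (e + r + r + 1)) ⊔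
      mulS Q (Hs k (e + r + r + 1)) ⊔
      ⨆ l, mulS (cross (grad P) (grad Q) l) (Hs k (e + r + 2)) := by
  intro G hG
  choose a ha using transversal pt h0 hnp hcard hP hQ hP0 hQ0 hPQ hPz hQz
  choose L hL1 hL2 hL3 using fun i => exists_sep pt h0 hnp i (e + r + 2) (by omega)
  have hPi : ∀ l, (pderiv l P).IsHomogeneous r := fun l => by simpa using hP.pderiv (i := l)
  have hQi : ∀ l, (pderiv l Q).IsHomogeneous r := fun l => by simpa using hQ.pderiv (i := l)
  have hwh : ∀ l, (cross (grad P) (grad Q) l).IsHomogeneous (r + r) := by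
    intro l
    fin_cases l
    · exact ((hPi 1).mul (hQi 2)).sub ((hPi 2).mul (hQi 1))
    · exact ((hPi 2).mul (hQi 0)).sub ((hPi 0).mul (hQi 2))
    · exact ((hPi 0).mul (hQi 1)).sub ((hPi 1).mul (hQi 0))
  set w := cross (grad P) (grad Q) with hwdef
  let T : MvPolynomial (Fin 3) k :=
    ∑ i, (eval (pt i) G / (eval (pt i) (w (a i)) * eval (pt i) (L i))) • (w (a i) * L i)
  have hT : T ∈ ⨆ l, mulS (w l) (Hs k (e + r + 2)) := by
    refine Submodule.sum_mem _ fun i _ => Submodule.smul_mem _ _ ?_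
    exact Submodule.mem_iSup_of_mem (a i) (mem_mulS.2 ⟨L i, hL1 i, rfl⟩)
  have hTh : T ∈ Hs k (e + r + r + r + 2) := by
    have : (⨆ l, mulS (w l) (Hs k (e + r + 2))) ≤ Hs k (e + r + r + r + 2) :=
      iSup_le fun l => mulS_le_Hs (hwh l) (by omega)
    exact this hT
  have hTe : ∀ j, eval (pt j) T = eval (pt j) G := by
    intro j
    simp only [T, map_sum]
    rw [Finset.sum_eq_single j]
    · rw [smul_eq_C_mul, map_mul, map_mul, eval_C]
      exact div_mul_cancel₀ _ (mul_ne_zero (ha j) (hL2 j))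
    · intro i _ hij
      rw [smul_eq_C_mul, map_mul, map_mul, hL3 i j (Ne.symm hij), mul_zero, mul_zero]
    · simp
  have hmem := mem_of_vanish pt h0 hnp (t := e + r) hcard (by omega) hP hQ hP0 hQ0 hPQ
      hPz hQz (G - T) (by
        have h1 := Submodule.sub_mem _ hG hTh
        rw [show e + r + r + r + 2 = e + r + (r + 1) + (r + 1) by omega] at h1
        exact h1) (by intro j; rw [map_sub, hTe j, sub_self])
  have : G = (G - T) + T := by ring
  rw [this]
  exact Submodule.add_mem_sup hmem hT

end points

section six
variable {k : Type*} [Field k]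

lemma line_eval (D : MvPolynomial (Fin 3) k) (o q : Fin 3 → k) (s : k) :
    (aeval (fun i => Polynomial.C (o i) * Polynomial.X + Polynomial.C (q i)) D :
      Polynomial k).eval s = eval (s • o + q) D := by
  induction D using MvPolynomial.induction_on with
  | C a => simp
  | add a b ha hb => simp only [map_add, Polynomial.eval_add, ha, hb]
  | mul_X a i ha =>
    simp only [map_mul, Polynomial.eval_mul, ha, aeval_X, eval_X, Pi.add_apply, Pi.smul_apply,
      Polynomial.eval_add, Polynomial.eval_C, Polynomial.eval_X, smul_eq_mul, mul_comm s]

lemma eval_smul_homog_s12 {D : MvPolynomial (Fin 3) k} {d : ℕ} (hD : D.IsHomogeneous d) (t : k)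
    (p : Fin 3 → k) : eval (t • p) D = t ^ d * eval p D := by
  rw [eval_eq, eval_eq, Finset.mul_sum]
  refine Finset.sum_congr rfl fun m hm => ?_
  have h1 : ∑ i ∈ m.support, m i = d := by
    have := hD (mem_support_iff.1 hm)
    simpa [Finsupp.weight_apply, Finsupp.sum] using this
  simp only [Pi.smul_apply, smul_eq_mul, mul_pow, Finset.prod_mul_distrib,
    Finset.prod_pow_eq_pow_sum, h1]
  ring

lemma top_mul_aux {D E : MvPolynomial (Fin 3) k} {d c : ℕ} (hd : D.totalDegree = d)
    (hc : E.totalDegree = c) :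
    homogeneousComponent (d + c) (D * E) =
      homogeneousComponent d D * homogeneousComponent c E := by
  have hE : D * E = ∑ b ∈ Finset.range (c + 1), D * homogeneousComponent b E := by
    rw [← Finset.mul_sum, ← hc, sum_homogeneousComponent]
  rw [hE, map_sum, Finset.sum_range_succ, hcomp_mul (homogeneousComponent_isHomogeneous _ _) _,
    Finset.sum_eq_zero, zero_add]
  intro b hb
  have hb' := Finset.mem_range.1 hb
  obtain ⟨c', hc'⟩ : ∃ c', c = c' + b := ⟨c - b, by omega⟩
  have h2 : d + c = (d + c') + b := by omega
  rw [h2, hcomp_mul (homogeneousComponent_isHomogeneous _ _),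
    homogeneousComponent_eq_zero _ _ (by omega), zero_mul]

lemma top_dvd {D P : MvPolynomial (Fin 3) k} {n : ℕ} (hP : P.IsHomogeneous n) (h : D ∣ P) :
    homogeneousComponent D.totalDegree D ∣ P := by
  by_cases hP0 : P = 0
  · simp [hP0]
  obtain ⟨E, rfl⟩ := h
  have hD0 := left_ne_zero_of_mul hP0
  have hE0 := right_ne_zero_of_mul hP0
  have h1 := hP.totalDegree hP0
  rw [totalDegree_mul_of_isDomain hD0 hE0] at h1
  have h2 := top_mul_aux (D := D) (E := E) rfl rfl
  rw [h1, homogeneousComponent_of_mem (m := n) (n := n) hP, if_pos rfl] at h2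
  exact ⟨_, h2⟩

lemma line_root [IsAlgClosed k] {D : MvPolynomial (Fin 3) k} {d : ℕ} (hd : d ≠ 0)
    (hD : D.IsHomogeneous d) (o q : Fin 3 → k) (ho : eval o D ≠ 0) :
    ∃ s : k, eval (s • o + q) D = 0 := by
  set p : Polynomial k :=
    aeval (fun i => Polynomial.C (o i) * Polynomial.X + Polynomial.C (q i)) D with hp
  have hev : ∀ s : k, p.eval s = eval (s • o + q) D := by
    intro s
    exact line_eval D o q s
  by_contra hno
  push Not at hno
  have hdeg : p.degree = 0 := by
    by_contra h
    obtain ⟨s, hs⟩ := IsAlgClosed.exists_root p h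
    exact hno s (by rw [← hev]; exact hs)
  obtain ⟨c, hpc⟩ : ∃ c, p = Polynomial.C c :=
    ⟨_, Polynomial.eq_C_of_degree_eq_zero hdeg⟩
  have hconst : ∀ s : k, eval (s • o + q) D = c := by
    intro s; rw [← hev, hpc, Polynomial.eval_C]
  set u : Polynomial k :=
    aeval (fun i => Polynomial.C (q i) * Polynomial.X + Polynomial.C (o i)) D with hu
  have hev2 : ∀ s : k, u.eval s = eval (s • q + o) D := by
    intro s
    exact line_eval D q o s
  have hinf : Infinite k := IsAlgClosed.instInfinite
  have hzero : Polynomial.X * (u - Polynomial.C c * Polynomial.X ^ d) = 0 := by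
    apply Polynomial.funext
    intro t
    by_cases ht : t = 0
    · simp [ht]
    have h3 : t • q + o = t • (t⁻¹ • o + q) := by
      rw [smul_add, smul_smul, mul_inv_cancel₀ ht, one_smul, add_comm]
    have h4 : eval (t • (t⁻¹ • o + q)) D = t ^ d * eval (t⁻¹ • o + q) D :=
      eval_smul_homog_s12 hD t (t⁻¹ • o + q)
    simp only [Polynomial.eval_mul, Polynomial.eval_X, Polynomial.eval_sub, Polynomial.eval_C,
      Polynomial.eval_pow, Polynomial.eval_zero, hev2]
    rw [h3, h4, hconst]
    ring
  have h5 : u = Polynomial.C c * Polynomial.X ^ d :=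
    sub_eq_zero.1 ((mul_eq_zero.1 hzero).resolve_left Polynomial.X_ne_zero)
  have h6 := hev2 0
  rw [h5] at h6
  rw [zero_smul, zero_add] at h6
  simp [hd] at h6
  exact ho h6.symm

lemma proj_ne {p q : Projectivization k (Fin 3 → k)} (h : p ≠ q) :
    ∃ a b, p.rep a * q.rep b - p.rep b * q.rep a ≠ 0 := by
  by_contra hc
  push Not at hc
  apply h
  obtain ⟨b, hb⟩ : ∃ b, q.rep b ≠ 0 := by
    by_contra h0
    push Not at h0
    exact q.rep_nonzero (funext h0)
  rw [← p.mk_rep, ← q.mk_rep, Projectivization.mk_eq_mk_iff']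
  refine ⟨p.rep b / q.rep b, ?_⟩
  funext a
  have := hc a b
  simp only [Pi.smul_apply, smul_eq_mul]
  field_simp
  linear_combination -this

lemma coprime_of_finite [IsAlgClosed k] {P Q : MvPolynomial (Fin 3) k} {n : ℕ}
    (hP : P.IsHomogeneous n) (hQ : Q.IsHomogeneous n) (hP0 : P ≠ 0)
    (hfin : {p : Projectivization k (Fin 3 → k) |
        eval p.rep P = 0 ∧ eval p.rep Q = 0}.Finite) : IsRelPrime P Q := by
  have hinf : Infinite k := IsAlgClosed.instInfinite
  intro D' hDP' hDQ'
  by_contra hu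
  have hD0' : D' ≠ 0 := fun h => hP0 (zero_dvd_iff.1 (h ▸ hDP'))
  have hd : D'.totalDegree ≠ 0 := by
    intro h
    have h1 := totalDegree_eq_zero_iff_eq_C.1 h
    apply hu
    rw [h1]
    refine IsUnit.map C (isUnit_iff_ne_zero.2 fun h2 => hD0' ?_)
    rw [h1, h2, map_zero]
  have hDP := top_dvd hP hDP'
  have hDQ := top_dvd hQ hDQ'
  have hD := homogeneousComponent_isHomogeneous D'.totalDegree D'
  set D := homogeneousComponent D'.totalDegree D'
  set d := D'.totalDegree
  have hD0 : D ≠ 0 := fun h => hP0 (zero_dvd_iff.1 (h ▸ hDP))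
  obtain ⟨o, ho⟩ : ∃ o, eval o D ≠ 0 := by
    by_contra h
    push Not at h
    exact hD0 (MvPolynomial.funext fun x => by simp [h x])
  obtain ⟨i0, hi0⟩ : ∃ i, o i ≠ 0 := by
    by_contra h
    push Not at h
    apply ho
    have h3 : o = (0 : k) • o := by funext i; simp [h i]
    rw [h3, eval_smul_homog_s12 hD, zero_pow hd, zero_mul]
  obtain ⟨i1, i2, h01, h02, h12⟩ : ∃ i1 i2 : Fin 3, i1 ≠ i0 ∧ i2 ≠ i0 ∧ i1 ≠ i2 := by
    fin_cases i0
    · exact ⟨1, 2, by decide, by decide, by decide⟩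
    · exact ⟨0, 2, by decide, by decide, by decide⟩
    · exact ⟨0, 1, by decide, by decide, by decide⟩
  have hroot := fun c : k => line_root hd hD o (Pi.single i1 1 + Pi.single i2 c) ho
  choose s hs using hroot
  set x : k → Fin 3 → k := fun c => s c • o + (Pi.single i1 1 + Pi.single i2 c) with hx
  have x0 : ∀ c, x c i0 = s c * o i0 := by
    intro c; simp [hx, h01.symm, h02.symm]
  have x1 : ∀ c, x c i1 = s c * o i1 + 1 := by
    intro c; simp [hx, h12]
  have x2 : ∀ c, x c i2 = s c * o i2 + c := by
    intro c; simp [hx, h12.symm]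
  have hxne : ∀ c, x c ≠ 0 := by
    intro c h
    have e0 := congrFun h i0
    have e1 := congrFun h i1
    rw [x0] at e0
    rw [x1] at e1
    have : s c = 0 := by simpa [hi0] using e0
    simp [this] at e1
  have hinj : Function.Injective fun c => Projectivization.mk k (x c) (hxne c) := by
    intro c c' h
    obtain ⟨a, ha⟩ := (Projectivization.mk_eq_mk_iff' k _ _ _ _).1 h
    have e0 := congrFun ha i0
    have e1 := congrFun ha i1
    have e2 := congrFun ha i2
    simp only [Pi.smul_apply, smul_eq_mul, x0, x1, x2] at e0 e1 e2
    have e3 : a * s c' = s c := by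
      apply mul_right_cancel₀ hi0
      linear_combination e0
    have e4 : a = 1 := by linear_combination e1 - o i1 * e3
    subst e4
    linear_combination -e2 + o i2 * e3
  refine Set.infinite_of_injective_forall_mem hinj (fun c => ?_) hfin
  obtain ⟨a, ha⟩ := Projectivization.exists_smul_eq_mk_rep k (x c) (hxne c)
  have hz : eval (Projectivization.mk k (x c) (hxne c)).rep D = 0 := by
    rw [← ha]
    have : a • x c = (a : k) • x c := rfl
    rw [this, eval_smul_homog_s12 hD, hs c, mul_zero]
  obtain ⟨A, hA⟩ := hDP
  obtain ⟨B, hB⟩ := hDQ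
  constructor
  · rw [hA, map_mul, hz, zero_mul]
  · rw [hB, map_mul, hz, zero_mul]

lemma final_arith {i j r e H1 H2 H3 H4 : ℕ} (hr1 : 1 ≤ r) (hj : i + j = 2 * r + 1)
    (d1 : 2 * H1 = (e + r + r + r + r + 3 + 1) * (e + r + r + r + r + 3 + 2))
    (d2 : 2 * H2 = (e + r + r + 2 + 1) * (e + r + r + 2 + 2))
    (d3 : 2 * H3 = (e + 1 + j + 1) * (e + 1 + j + 2))
    (d4 : 2 * H4 = (e + 1 + i + 1) * (e + 1 + i + 2))
    (hineq : H1 + H3 + H4 ≤ 3 * H2 + (r + 1) * (r + 1) + 2 * (r * r)) : False := by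
  have hjz : (j : ℤ) = 2 * r + 1 - i := by omega
  have hmul : (0 : ℤ) ≤ ((r : ℤ) - i) * (r + 1 - i) := by
    rcases le_or_gt i r with h | h
    · exact mul_nonneg (by omega) (by omega)
    · exact mul_nonneg_of_nonpos_of_nonpos (by omega) (by omega)
  zify at hineq d1 d2 d3 d4 hr1
  rw [hjz] at d3
  ring_nf at hineq d1 d2 d3 d4 hmul
  linarith

end six

/-- for a pencil of degree-`n ≥ 2` curves with smooth base locus, all
members squarefree and some member smooth, the union of any two distinct members is
never free: `T(F)` is not a free `S`-module for `F = (α₁f + β₁g)(α₂f + β₂g)`. -/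
theorem union_of_two_members_not_free {k : Type*} [Field k] [IsAlgClosed k]
    [CharZero k] (n : ℕ) (hn : 2 ≤ n) (f g : MvPolynomial (Fin 3) k)
    (hf : f.IsHomogeneous n) (hg : g.IsHomogeneous n)
    (hbfin : {p : Projectivization k (Fin 3 → k) |
        eval p.rep f = 0 ∧ eval p.rep g = 0}.Finite)
    (hbcard : {p : Projectivization k (Fin 3 → k) |
        eval p.rep f = 0 ∧ eval p.rep g = 0}.ncard = n ^ 2)
    (hred : ∀ α β : k, (α, β) ≠ (0, 0) → Squarefree (C α * f + C β * g))
    (hsm : ∃ α β : k, (α, β) ≠ (0, 0) ∧ ∀ p : Fin 3 → k, p ≠ 0 →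
        ∃ i, eval p (grad (C α * f + C β * g) i) ≠ 0)
    (α₁ β₁ α₂ β₂ : k)
    (h1 : (α₁, β₁) ≠ (0, 0)) (h2 : (α₂, β₂) ≠ (0, 0))
    (hdist : α₁ * β₂ - α₂ * β₁ ≠ 0)
    (F : MvPolynomial (Fin 3) k)
    (hF : F = (C α₁ * f + C β₁ * g) * (C α₂ * f + C β₂ * g)) :
    ¬ Module.Free (MvPolynomial (Fin 3) k) (tangentModule F) := by
  intro hfree
  obtain ⟨r, rfl⟩ : ∃ r, n = r + 1 := ⟨n - 1, by omega⟩
  have hr : r ≠ 0 := by omega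
  set P := C α₁ * f + C β₁ * g with hPdef
  set Q := C α₂ * f + C β₂ * g with hQdef
  have hlin : ∀ α β : k, (C α * f + C β * g).IsHomogeneous (r + 1) := by
    intro α β
    refine IsHomogeneous.add ?_ ?_
    · simpa using (isHomogeneous_C (Fin 3) α).mul hf
    · simpa using (isHomogeneous_C (Fin 3) β).mul hg
  have hP : P.IsHomogeneous (r + 1) := hlin _ _
  have hQ : Q.IsHomogeneous (r + 1) := hlin _ _
  have hPs : Squarefree P := hred _ _ h1
  have hQs : Squarefree Q := hred _ _ h2
  have hP0 : P ≠ 0 := hPs.ne_zero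
  have hQ0 : Q ≠ 0 := hQs.ne_zero
  set Z := {p : Projectivization k (Fin 3 → k) | eval p.rep f = 0 ∧ eval p.rep g = 0} with hZ
  have hPQ : IsRelPrime P Q := by
    refine coprime_of_finite hP hQ hP0 (hbfin.subset ?_)
    rintro p ⟨hp, hq⟩
    simp only [hPdef, hQdef, map_add, map_mul, eval_C] at hp hq
    constructor
    · apply (mul_eq_zero.1 _).resolve_left hdist
      linear_combination β₂ * hp - β₁ * hq
    · apply (mul_eq_zero.1 _).resolve_left hdist
      linear_combination α₁ * hq - α₂ * hp
  have hFh : F.IsHomogeneous (r + 1 + (r + 1)) := hF ▸ hP.mul hQ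
  have hFs : Squarefree F := by
    rw [hF]
    exact squarefree_mul_iff.2 ⟨hPQ, hPs, hQs⟩
  obtain ⟨i, j, v, w, hij, hv, hw, hvT, hwT, hvw⟩ := free_gens (by omega) hFh hFs hfree
  set e := (r + 1) * (r + 1) with he
  obtain ⟨V, hVf, hV, hVd⟩ := exists_V (e := e + 1) hv hw hvT hwT hvw
  have hidx : e + 1 + i + j = e + r + r + 2 := by omega
  rw [hidx] at hV hVd
  classical
  haveI : Fintype Z := hbfin.fintype
  have hcard : Fintype.card Z = (r + 1) * (r + 1) := by
    rw [← Nat.card_eq_fintype_card, Nat.card_coe_set_eq, hbcard, sq]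
  have hsurj := surj_of_points (fun p : Z => p.1.rep) (fun p => p.1.rep_nonzero)
    (fun p q h => proj_ne (fun h' => h (Subtype.ext h'))) hcard (le_of_eq he.symm) hP hQ hP0 hQ0
    hPQ (fun p => by
      have h3 := p.2.1
      have h4 := p.2.2
      simp [hPdef, h3, h4]) (fun p => by
      have h3 := p.2.1
      have h4 := p.2.2
      simp [hQdef, h3, h4])
  have hcod := codim_bound hr hP hQ hPs hQs hPQ V (hF ▸ hV) hsurj
  have d1 := hdim (k := k) (e + r + r + r + r + 3)
  have d2 := hdim (k := k) (e + r + r + 2)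
  have d3 := hdim (k := k) (e + 1 + j)
  have d4 := hdim (k := k) (e + 1 + i)
  have hj : i + j = 2 * r + 1 := by omega
  exact final_arith (by omega) hj d1 d2 d3 d4 (by omega)
end

section
/- Let k be a field of characteristic zero, S = k[x,y,z], n ≥ 1, and F = (xⁿ − yⁿ)(yⁿ − zⁿ)(xⁿ − zⁿ). Then the curve {F = 0} (the union of the three singular members of the Fermat pencil generated by xⁿ − yⁿ and yⁿ − zⁿ) is free with exponents (2n−2, n+1): the S-module T(F) = {v ∈ S³ : ⟨v, ∇F⟩ = 0} is free with a basis of two elements whose components are homogeneous of degrees 2n−2 and n+1 respectively. -/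
open MvPolynomial

/-- A polynomial not involving `X 0` is fixed by every substitution for `X 0`. -/
theorem subst_fixed {k : Type*} [Field k] (d : MvPolynomial (Fin 3) k)
    (hd : degreeOf 0 d = 0) (c : MvPolynomial (Fin 3) k) :
    aeval (fun i : Fin 3 => if i = 0 then c else X i) d = d := by
  have h0 : (0 : Fin 3) ∉ d.vars := by
    rw [mem_vars_iff_degreeOf_ne_zero]
    simpa using hd
  conv_rhs => rw [← aeval_X_left_apply d]
  rw [aeval_def, aeval_def]
  refine eval₂Hom_congr' rfl ?_ rfl
  intro i hi _
  have : i ≠ 0 := by rintro rfl; exact h0 hi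
  simp [this]

theorem relPrime_st {k : Type*} [Field k] [CharZero k] (n : ℕ) (hn : n ≠ 0) :
    IsRelPrime (X 1 ^ n - X 2 ^ n : MvPolynomial (Fin 3) k) (X 0 ^ n - X 2 ^ n) := by
  intro d h1 h2
  have hne : (X 1 ^ n - X 2 ^ n : MvPolynomial (Fin 3) k) ≠ 0 := by
    intro h
    have := congrArg (eval (![0, 1, 0] : Fin 3 → k)) h
    simp [hn] at this
  have hd : degreeOf 0 d = 0 := by
    obtain ⟨e, he⟩ := h1
    have hd0 : d ≠ 0 := by rintro rfl; simp [he] at hne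
    have he0 : e ≠ 0 := by rintro rfl; simp [he] at hne
    have h3 := degreeOf_mul_eq (n := 0) hd0 he0
    rw [← he] at h3
    have h4 : degreeOf 0 (X 1 ^ n - X 2 ^ n : MvPolynomial (Fin 3) k) = 0 := by
      have := degreeOf_sub_le 0 (X 1 ^ n : MvPolynomial (Fin 3) k) (X 2 ^ n)
      have a1 := degreeOf_pow_le 0 (X 1 : MvPolynomial (Fin 3) k) n
      have a2 := degreeOf_pow_le 0 (X 2 : MvPolynomial (Fin 3) k) n
      rw [degreeOf_X_of_ne (by decide)] at a1 a2
      simp only [mul_zero, nonpos_iff_eq_zero] at a1 a2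
      rw [a1, a2] at this
      simpa using this
    omega
  have key : ∀ c : MvPolynomial (Fin 3) k, d ∣ c ^ n - X 2 ^ n := by
    intro c
    have := map_dvd (aeval (R := k) (fun i : Fin 3 => if i = 0 then c else X i)) h2
    rw [subst_fixed d hd c] at this
    simpa using this
  have k0 := key 0
  have k1 := key 1
  have := dvd_sub k1 k0
  simp [hn] at this
  exact isUnit_of_dvd_one this

theorem relPrime_AB {k : Type*} [Field k] [CharZero k] (s t : MvPolynomial (Fin 3) k)
    (h : IsRelPrime s t) : IsRelPrime (s * (2 * t - s)) (t * (t - 2 * s)) := by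
  have h3 : IsUnit (3 : MvPolynomial (Fin 3) k) := by
    have : (3 : MvPolynomial (Fin 3) k) = C 3 := (map_ofNat C 3).symm
    rw [this]
    exact (IsUnit.mk0 (3 : k) (by norm_num)).map C
  have hp : IsRelPrime (s ^ 3) (t ^ 3) := h.pow
  intro d hA hB
  obtain ⟨p, hp1⟩ := hA
  obtain ⟨q, hq1⟩ := hB
  refine hp (h3.dvd_mul_left.mp ?_) (h3.dvd_mul_left.mp ?_)
  · exact ⟨2 * (t * p - 2 * s * q) - 3 * s * p, by
      linear_combination (2 * t - 3 * s) * hp1 - 4 * s * hq1⟩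
  · exact ⟨3 * t * q + 4 * t * p - 2 * s * q, by
      linear_combination (3 * t - 2 * s) * hq1 + 4 * t * hp1⟩

theorem relPrime_X {k : Type*} [Field k] (i j : Fin 3) (hij : i ≠ j) (m : ℕ) :
    IsRelPrime (X i ^ m : MvPolynomial (Fin 3) k) (X j ^ m) := by
  apply IsRelPrime.pow
  rw [(X_prime (R := k) (i := i)).irreducible.isRelPrime_iff_not_dvd]
  rw [X_dvd_X]
  simpa using hij

/-- the union `F = (xⁿ − yⁿ)(yⁿ − zⁿ)(xⁿ − zⁿ)` of the three singular
members of the Fermat pencil is free with exponents `(2n−2, n+1)`: `T(F)` is free with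
a homogeneous basis of degrees `2n−2` and `n+1`. -/
theorem fermat_pencil_free {k : Type*} [Field k] [CharZero k] (n : ℕ) (hn : 1 ≤ n)
    (F : MvPolynomial (Fin 3) k)
    (hF : F = (X 0 ^ n - X 1 ^ n) * (X 1 ^ n - X 2 ^ n) * (X 0 ^ n - X 2 ^ n)) :
    ∃ u v : Fin 3 → MvPolynomial (Fin 3) k,
      (∀ i, (u i).IsHomogeneous (2 * n - 2)) ∧
      (∀ i, (v i).IsHomogeneous (n + 1)) ∧
      dot u (grad F) = 0 ∧ dot v (grad F) = 0 ∧
      ∀ w : Fin 3 → MvPolynomial (Fin 3) k, dot w (grad F) = 0 →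
        ∃! ab : MvPolynomial (Fin 3) k × MvPolynomial (Fin 3) k,
          w = fun i => ab.1 * u i + ab.2 * v i := by
  obtain ⟨m, rfl⟩ : ∃ m, n = m + 1 := ⟨n - 1, by omega⟩
  set x : MvPolynomial (Fin 3) k := X 0 with hx
  set y : MvPolynomial (Fin 3) k := X 1 with hy
  set z : MvPolynomial (Fin 3) k := X 2 with hz
  obtain ⟨a, ha⟩ : ∃ a, a = x ^ (m + 1) := ⟨_, rfl⟩
  obtain ⟨b, hb⟩ : ∃ b, b = y ^ (m + 1) := ⟨_, rfl⟩
  obtain ⟨c, hc⟩ : ∃ c, c = z ^ (m + 1) := ⟨_, rfl⟩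
  have ha' : a = x ^ m * x := by rw [ha, pow_succ]
  have hb' : b = y ^ m * y := by rw [hb, pow_succ]
  have hc' : c = z ^ m * z := by rw [hc, pow_succ]
  have hx0 : x ^ m ≠ 0 := pow_ne_zero _ (X_ne_zero _)
  have hy0 : y ^ m ≠ 0 := pow_ne_zero _ (X_ne_zero _)
  have hz0 : z ^ m ≠ 0 := pow_ne_zero _ (X_ne_zero _)
  have hm0 : ((m : MvPolynomial (Fin 3) k) + 1) ≠ 0 := by exact_mod_cast Nat.succ_ne_zero m
  have g0 : grad F 0 = (m + 1) * x ^ m * ((b - c) * (2 * a - b - c)) := by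
    rw [hF, ← ha, ← hb, ← hc]
    simp only [grad, Derivation.leibniz, map_sub, smul_eq_mul]
    have d1 : pderiv 0 a = (m + 1) * x ^ m := by rw [ha, hx]; simp [pderiv_X]
    have d2 : pderiv 0 b = 0 := by rw [hb, hy]; simp [pderiv_X]
    have d3 : pderiv 0 c = 0 := by rw [hc, hz]; simp [pderiv_X]
    rw [d1, d2, d3]; ring
  have g1 : grad F 1 = (m + 1) * y ^ m * ((a - c) * (a + c - 2 * b)) := by
    rw [hF, ← ha, ← hb, ← hc]
    simp only [grad, Derivation.leibniz, map_sub, smul_eq_mul]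
    have d1 : pderiv 1 a = 0 := by rw [ha, hx]; simp [pderiv_X]
    have d2 : pderiv 1 b = (m + 1) * y ^ m := by rw [hb, hy]; simp [pderiv_X]
    have d3 : pderiv 1 c = 0 := by rw [hc, hz]; simp [pderiv_X]
    rw [d1, d2, d3]; ring
  have g2 : grad F 2 = (m + 1) * z ^ m * (-(a - b) * (a + b - 2 * c)) := by
    rw [hF, ← ha, ← hb, ← hc]
    simp only [grad, Derivation.leibniz, map_sub, smul_eq_mul]
    have d1 : pderiv 2 a = 0 := by rw [ha, hx]; simp [pderiv_X]
    have d2 : pderiv 2 b = 0 := by rw [hb, hy]; simp [pderiv_X]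
    have d3 : pderiv 2 c = (m + 1) * z ^ m := by rw [hc, hz]; simp [pderiv_X]
    rw [d1, d2, d3]; ring
  have hB0 : (a - c) * (a + c - 2 * b) ≠ 0 := by
    intro h
    have := congrArg (eval (![1, 0, 0] : Fin 3 → k)) h
    simp [ha, hb, hc, hx, hy, hz] at this
  have hAB : IsRelPrime ((b - c) * (2 * (a - c) - (b - c))) ((a - c) * ((a - c) - 2 * (b - c))) := by
    apply relPrime_AB
    rw [ha, hb, hc]
    exact relPrime_st (m + 1) (by omega)
  have hom_a : a.IsHomogeneous (m + 1) := by
    rw [ha]; exact isHomogeneous_X_pow 0 (m + 1)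
  have hom_b : b.IsHomogeneous (m + 1) := by
    rw [hb]; exact isHomogeneous_X_pow 1 (m + 1)
  have hom_c : c.IsHomogeneous (m + 1) := by
    rw [hc]; exact isHomogeneous_X_pow 2 (m + 1)
  have hom2 : ∀ p q r : MvPolynomial (Fin 3) k, ∀ i : Fin 3, p.IsHomogeneous (m + 1) →
      q.IsHomogeneous (m + 1) → r.IsHomogeneous (m + 1) →
      (X i * (p - 2 * q - 2 * r)).IsHomogeneous (m + 1 + 1) := by
    intro p q r i h1 h2 h3
    have e : ∀ f : MvPolynomial (Fin 3) k, 2 * f = C 2 * f := by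
      intro f; rw [show (C 2 : MvPolynomial (Fin 3) k) = 2 from map_ofNat C 2]
    rw [add_comm (m + 1) 1, e, e]
    exact (isHomogeneous_X k i).mul ((h1.sub (h2.C_mul 2)).sub (h3.C_mul 2))
  have hdeg : 2 * (m + 1) - 2 = m + m := by omega
  refine ⟨![y ^ m * z ^ m, x ^ m * z ^ m, x ^ m * y ^ m],
    ![x * (a - 2 * b - 2 * c), y * (b - 2 * a - 2 * c), z * (c - 2 * a - 2 * b)],
    ?_, ?_, ?_, ?_, ?_⟩
  · rw [hdeg]
    intro i
    fin_cases i
    · exact (isHomogeneous_X_pow 1 m).mul (isHomogeneous_X_pow 2 m)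
    · exact (isHomogeneous_X_pow 0 m).mul (isHomogeneous_X_pow 2 m)
    · exact (isHomogeneous_X_pow 0 m).mul (isHomogeneous_X_pow 1 m)
  · intro i
    fin_cases i
    · exact hom2 _ _ _ 0 hom_a hom_b hom_c
    · exact hom2 _ _ _ 1 hom_b hom_a hom_c
    · exact hom2 _ _ _ 2 hom_c hom_a hom_b
  · simp only [dot, g0, g1, g2, Matrix.cons_val]
    ring
  · simp only [dot, g0, g1, g2, Matrix.cons_val]
    have e : x * (a - 2 * b - 2 * c) * ((m + 1) * x ^ m * ((b - c) * (2 * a - b - c))) +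
        y * (b - 2 * a - 2 * c) * ((m + 1) * y ^ m * ((a - c) * (a + c - 2 * b))) +
        z * (c - 2 * a - 2 * b) * ((m + 1) * z ^ m * (-(a - b) * (a + b - 2 * c))) =
        (m + 1) * ((x ^ m * x) * (a - 2 * b - 2 * c) * ((b - c) * (2 * a - b - c)) +
        (y ^ m * y) * (b - 2 * a - 2 * c) * ((a - c) * (a + c - 2 * b)) +
        (z ^ m * z) * (c - 2 * a - 2 * b) * (-(a - b) * (a + b - 2 * c))) := by ring
    rw [e, ← ha', ← hb', ← hc']
    ring
  · intro w hw
    have hw2 : (b - c) * (2 * (a - c) - (b - c)) * (x ^ m * w 0 - z ^ m * w 2) =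
        (a - c) * ((a - c) - 2 * (b - c)) * (z ^ m * w 2 - y ^ m * w 1) := by
      simp only [dot, g0, g1, g2] at hw
      apply mul_left_cancel₀ hm0
      linear_combination hw
    have hdvd : (a - c) * ((a - c) - 2 * (b - c)) ∣ x ^ m * w 0 - z ^ m * w 2 :=
      hAB.symm.dvd_of_dvd_mul_left (Dvd.intro _ hw2.symm)
    obtain ⟨β, hβ⟩ := hdvd
    have hβ2 : z ^ m * w 2 - y ^ m * w 1 = (b - c) * (2 * (a - c) - (b - c)) * β := by
      have hB0' : (a - c) * ((a - c) - 2 * (b - c)) ≠ 0 := by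
        intro h; apply hB0; linear_combination h
      apply mul_left_cancel₀ hB0'
      rw [← hw2, hβ]; ring
    -- the remaining vector is a multiple of `u`
    have e1 : x ^ m * (w 0 - β * (x * (a - 2 * b - 2 * c))) =
        z ^ m * (w 2 - β * (z * (c - 2 * a - 2 * b))) := by
      linear_combination hβ + β * (a - 2 * b - 2 * c) * ha' - β * (c - 2 * a - 2 * b) * hc'
    have e2 : y ^ m * (w 1 - β * (y * (b - 2 * a - 2 * c))) =
        z ^ m * (w 2 - β * (z * (c - 2 * a - 2 * b))) := by
      linear_combination -hβ2 + β * (b - 2 * a - 2 * c) * hb' - β * (c - 2 * a - 2 * b) * hc'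
    have hxy : IsRelPrime (x ^ m) (y ^ m) := relPrime_X 0 1 (by decide) m
    have hxz : IsRelPrime (x ^ m) (z ^ m) := relPrime_X 0 2 (by decide) m
    have hyz : IsRelPrime (y ^ m) (z ^ m) := relPrime_X 1 2 (by decide) m
    have q1 : z ^ m ∣ w 0 - β * (x * (a - 2 * b - 2 * c)) :=
      hxz.symm.dvd_of_dvd_mul_left (Dvd.intro _ e1.symm)
    have q2 : y ^ m ∣ w 0 - β * (x * (a - 2 * b - 2 * c)) :=
      hxy.symm.dvd_of_dvd_mul_left (Dvd.intro _ (e2.trans e1.symm))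
    obtain ⟨α, hα⟩ := hyz.mul_dvd q2 q1
    have r2 : w 2 - β * (z * (c - 2 * a - 2 * b)) = x ^ m * y ^ m * α := by
      apply mul_left_cancel₀ hz0
      rw [← e1, hα]; ring
    have r1 : w 1 - β * (y * (b - 2 * a - 2 * c)) = x ^ m * z ^ m * α := by
      apply mul_left_cancel₀ hy0
      rw [e2, r2]; ring
    refine ⟨(α, β), ?_, ?_⟩
    · funext i
      fin_cases i
      · simp only [Fin.zero_eta, Matrix.cons_val]
        linear_combination hα
      · simp only [Fin.mk_one, Matrix.cons_val]
        linear_combination r1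
      · simp only [Fin.reduceFinMk, Matrix.cons_val]
        linear_combination r2
    · rintro ⟨α', β'⟩ h
      have f0 := congrFun h 0
      have f2 := congrFun h 2
      simp only [Matrix.cons_val] at f0 f2
      have hββ : β' = β := by
        apply mul_left_cancel₀ hB0
        linear_combination hβ - x ^ m * f0 + z ^ m * f2 + β' * (a - 2 * b - 2 * c) * ha' -
          β' * (c - 2 * a - 2 * b) * hc'
      subst hββ
      have hαα : α' = α := by
        apply mul_left_cancel₀ (mul_ne_zero hy0 hz0)
        linear_combination hα - f0
      rw [hαα]
end
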